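/- arXiv:2604.01400 — 11 statements merged into one kernel-verified Lean document; each statement's English description precedes it below -/
import Mathlib

section
/- Consider a CSP instance over a finite nonempty alphabet Σ with arity k, with finite variable set V and constraints C_1,…,C_m (m ≥ 1), where constraint C_i is given by a k-tuple (v_{i,1},…,v_{i,k}) of variables and a predicate f_i : Σ^k → {0,1}. If every predicate f_i supports one-wise independence, then there exists a feasible solution (x, z) to BasicLP whose objective value equals 1. -/
open Finset

/-- If every predicate of a CSP instance supports one-wise independence, then the
basic LP has a feasible solution of objective value `1`. -/
theorem stmt1 {Γ V : Type*} [Fintype Γ] [Nonempty Γ] [DecidableEq Γ]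
    (k m : ℕ) (hm : 1 ≤ m)
    (vs : Fin m → Fin k → V) (f : Fin m → (Fin k → Γ) → Bool)
    (hone : ∀ i : Fin m, ∃ μ : (Fin k → Γ) → ℝ,
      (∀ b, 0 ≤ μ b) ∧ ((∑ b, μ b) = 1) ∧ (∀ b, 0 < μ b → f i b = true) ∧
      ∀ (j : Fin k) (σ : Γ),
        (∑ b ∈ Finset.univ.filter (fun b => b j = σ), μ b) = 1 / (Fintype.card Γ : ℝ)) :
    ∃ (x : V → Γ → ℝ) (z : Fin m → (Fin k → Γ) → ℝ),
      (∀ v σ, 0 ≤ x v σ) ∧ (∀ i b, 0 ≤ z i b) ∧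
      (∀ v, (∑ σ, x v σ) = 1) ∧
      (∀ (i : Fin m) (j : Fin k) (σ : Γ),
        (∑ b ∈ Finset.univ.filter (fun b => b j = σ), z i b) = x (vs i j) σ) ∧
      ((1 / (m : ℝ)) * ∑ i, ∑ b, (if f i b then (1 : ℝ) else 0) * z i b) = 1 := by
  choose μ hnonneg hsum hsupp hmarg using hone
  have hcard : (Fintype.card Γ : ℝ) ≠ 0 := Nat.cast_ne_zero.mpr Fintype.card_ne_zero
  have hm0 : (m : ℝ) ≠ 0 := Nat.cast_ne_zero.mpr (by omega)
  refine ⟨fun _ _ => 1 / (Fintype.card Γ : ℝ), μ, fun _ _ => by positivity, hnonneg,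
    fun _ => by simp [hcard], hmarg, ?_⟩
  have hval (i : Fin m) : ∑ b, (if f i b then (1 : ℝ) else 0) * μ i b = 1 := by
    refine Eq.trans ?_ (hsum i)
    refine Finset.sum_congr rfl fun b _ => ?_
    rcases (hnonneg i b).eq_or_lt with h | h
    · simp [← h]
    · simp [hsupp i b h]
  simp only [hval]
  simp [hm0]
end

section
/- Fix a k-universe U embedded in a finite set Λ, an integer N ≥ 2, and a positive integer m ≤ |U|. Let z be a restriction on Ω^{U,m} with |supp(z)| ≤ min{m, |U|/2}, and let A ⊆ Ω^{U,m}_z be a nonempty z-global set. Then for every matching S of size at most m that contains supp(z), the probability over a uniformly random y ∈ A that S ⊆ supp(y) is at most (6^k·m/|U|^k)^{|S|−|supp(z)|}. -/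
open Finset
open scoped Classical

variable {k : ℕ} {Λ : Type*} [Fintype Λ] [DecidableEq Λ]

noncomputable section

/-- `e` is an edge of the `k`-universe `U`: its `i`-th vertex lies in `U i`. -/
def IsEdge (U : Fin k → Finset Λ) (e : Fin k → Λ) : Prop := ∀ i, e i ∈ U i

/-- `S` is a matching in the universe `U`: a set of edges pairwise sharing no vertex. -/
def IsMatching (U : Fin k → Finset Λ) (S : Finset (Fin k → Λ)) : Prop :=
  (∀ e ∈ S, IsEdge U e) ∧ ∀ e ∈ S, ∀ e' ∈ S, e ≠ e' → ∀ i, e i ≠ e' i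

/-- The support of a labeled (partial) matching: the edges with a label. -/
def lsupp {N : ℕ} [NeZero N] (y : (Fin k → Λ) → Option (Fin k → ZMod N)) :
    Finset (Fin k → Λ) :=
  Finset.univ.filter (fun e => y e ≠ none)

/-- `Ω^{U,m}`: labeled matchings whose support is a matching with `m` edges. -/
def Omega (U : Fin k → Finset Λ) (N : ℕ) [NeZero N] (m : ℕ) :
    Finset ((Fin k → Λ) → Option (Fin k → ZMod N)) :=
  Finset.univ.filter (fun y => IsMatching U (lsupp y) ∧ (lsupp y).card = m)

/-- `Ω^{U,m}_z`: the labeled matchings agreeing with the restriction `z` on its support. -/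
def OmegaRes (U : Fin k → Finset Λ) (N : ℕ) [NeZero N] (m : ℕ)
    (z : (Fin k → Λ) → Option (Fin k → ZMod N)) :
    Finset ((Fin k → Λ) → Option (Fin k → ZMod N)) :=
  (Omega U N m).filter (fun y => ∀ e ∈ lsupp z, y e = z e)

/-- `z'` subsumes `z`. -/
def Subsumes {N : ℕ} [NeZero N] (z' z : (Fin k → Λ) → Option (Fin k → ZMod N)) : Prop :=
  lsupp z ⊆ lsupp z' ∧ ∀ e ∈ lsupp z, z' e = z e

/-- `z` is a restriction: its support is a matching with at most `m` edges. -/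
def IsRestriction (U : Fin k → Finset Λ) (m : ℕ) {N : ℕ} [NeZero N]
    (z : (Fin k → Λ) → Option (Fin k → ZMod N)) : Prop :=
  IsMatching U (lsupp z) ∧ (lsupp z).card ≤ m

/-- `A` is a `z`-global subset of `Ω^{U,m}`. -/
def IsGlobal (U : Fin k → Finset Λ) (N : ℕ) [NeZero N] (m : ℕ)
    (z : (Fin k → Λ) → Option (Fin k → ZMod N))
    (A : Finset ((Fin k → Λ) → Option (Fin k → ZMod N))) : Prop :=
  A ⊆ OmegaRes U N m z ∧
  ∀ z', IsRestriction U m z' → Subsumes z' z →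
    ((A ∩ OmegaRes U N m z').card : ℝ) / ((OmegaRes U N m z').card : ℝ) ≤
      (2 : ℝ) ^ ((lsupp z').card - (lsupp z).card) * (A.card : ℝ)
        / ((OmegaRes U N m z).card : ℝ)

end

/-- Falling factorials are at least a constant fraction of powers. -/
lemma pow_le_three_pow_mul_descFactorial (a d : ℕ) (h : d ≤ a) :
    a ^ d ≤ 3 ^ d * a.descFactorial d := by
  induction d generalizing a with
  | zero => simp
  | succ d ih =>
    obtain ⟨a, rfl⟩ : ∃ b, a = b + 1 := ⟨a - 1, by omega⟩
    have hd : d ≤ a := by omega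
    have key : (a + 1) ^ d ≤ 3 * a ^ d := by
      rcases Nat.eq_zero_or_pos a with rfl | ha
      · obtain rfl : d = 0 := by omega
        simp
      · have ha' : (0 : ℝ) < a := by exact_mod_cast ha
        have h1 : (1 + 1 / (a : ℝ)) ^ d ≤ 3 := by
          calc (1 + 1 / (a : ℝ)) ^ d ≤ (Real.exp (1 / a)) ^ d := by
                gcongr
                linarith [Real.add_one_le_exp (1 / (a : ℝ))]
            _ = Real.exp (d * (1 / a)) := by rw [Real.exp_nat_mul]
            _ ≤ Real.exp 1 := by
                gcongr
                rw [mul_one_div, div_le_one ha']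
                exact_mod_cast hd
            _ ≤ 3 := by linarith [Real.exp_one_lt_d9]
        have h2 : ((a : ℝ) + 1) ^ d ≤ 3 * (a : ℝ) ^ d := by
          have : (a : ℝ) + 1 = (1 + 1 / (a : ℝ)) * a := by field_simp
          rw [this, mul_pow]
          gcongr
        exact_mod_cast h2
    calc (a + 1) ^ (d + 1) = (a + 1) * (a + 1) ^ d := by ring
      _ ≤ (a + 1) * (3 * a ^ d) := by gcongr
      _ ≤ (a + 1) * (3 * (3 ^ d * a.descFactorial d)) := by
          gcongr
          exact ih a hd
      _ = 3 ^ (d + 1) * (a + 1).descFactorial (d + 1) := by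
          rw [Nat.succ_descFactorial_succ]; ring

lemma descFactorial_mul_pow_le (m n s d : ℕ) (hmn : m ≤ n) (hd : s + d ≤ m) :
    (m - s).descFactorial d * n ^ d ≤ m ^ d * (n - s).descFactorial d := by
  induction d with
  | zero => simp
  | succ d ih =>
    have step : (m - s - d) * n ≤ m * (n - s - d) := by
      obtain ⟨a, rfl⟩ : ∃ a, m = s + d + a := ⟨m - (s + d), by omega⟩
      obtain ⟨b, rfl⟩ : ∃ b, n = s + d + a + b := ⟨n - (s + d + a), by omega⟩
      rw [show s + d + a - s - d = a by omega, show s + d + a + b - s - d = a + b by omega]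
      nlinarith [Nat.zero_le (s * b), Nat.zero_le (d * b)]
    rw [Nat.descFactorial_succ, Nat.descFactorial_succ]
    calc (m - s - d) * (m - s).descFactorial d * n ^ (d + 1)
        = ((m - s - d) * n) * ((m - s).descFactorial d * n ^ d) := by ring
      _ ≤ (m * (n - s - d)) * (m ^ d * (n - s).descFactorial d) :=
          Nat.mul_le_mul step (ih (by omega))
      _ = _ := by ring

section LabeledMatchings

variable {N : ℕ} [NeZero N]

omit [DecidableEq Λ] in
lemma mem_lsupp {y : (Fin k → Λ) → Option (Fin k → ZMod N)} {e : Fin k → Λ} :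
    e ∈ lsupp y ↔ y e ≠ none := by
  simp [lsupp]

lemma mem_OmegaRes {U : Fin k → Finset Λ} {m : ℕ}
    {z y : (Fin k → Λ) → Option (Fin k → ZMod N)} :
    y ∈ OmegaRes U N m z ↔
      (IsMatching U (lsupp y) ∧ (lsupp y).card = m) ∧ ∀ e ∈ lsupp z, y e = z e := by
  simp [OmegaRes, Omega]

lemma lsupp_subset_of_mem_OmegaRes {U : Fin k → Finset Λ} {m : ℕ}
    {z y : (Fin k → Λ) → Option (Fin k → ZMod N)} (hy : y ∈ OmegaRes U N m z) :
    lsupp z ⊆ lsupp y := by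
  intro e he
  rw [mem_lsupp, (mem_OmegaRes.1 hy).2 e he]
  exact mem_lsupp.1 he

lemma lsupp_update (z : (Fin k → Λ) → Option (Fin k → ZMod N)) (e : Fin k → Λ)
    (l : Fin k → ZMod N) : lsupp (Function.update z e (some l)) = insert e (lsupp z) := by
  ext e'
  by_cases h : e' = e
  · subst h; simp [mem_lsupp]
  · simp [mem_lsupp, h]

/-- The edges of `U` sharing no vertex with any edge of `T`. -/
noncomputable def freeEdges (U : Fin k → Finset Λ) (T : Finset (Fin k → Λ)) :
    Finset (Fin k → Λ) :=
  Fintype.piFinset fun i => U i \ T.image (fun e => e i)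

omit [Fintype Λ] in
lemma mem_freeEdges {U : Fin k → Finset Λ} {T : Finset (Fin k → Λ)} {e : Fin k → Λ} :
    e ∈ freeEdges U T ↔ IsEdge U e ∧ ∀ e' ∈ T, ∀ i, e i ≠ e' i := by
  simp only [freeEdges, Fintype.mem_piFinset, mem_sdiff, mem_image, not_exists, not_and, IsEdge]
  constructor
  · exact fun h => ⟨fun i => (h i).1, fun e' he' i hi => (h i).2 e' he' hi.symm⟩
  · exact fun h i => ⟨h.1 i, fun e' he' hi => h.2 e' he' i hi.symm⟩

omit [Fintype Λ] in
lemma card_freeEdges {U : Fin k → Finset Λ} {n : ℕ} (hU : ∀ i, (U i).card = n)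
    {T : Finset (Fin k → Λ)} (hT : IsMatching U T) :
    (freeEdges U T).card = (n - T.card) ^ k := by
  rw [freeEdges, Fintype.card_piFinset]
  have : ∀ i, (U i \ T.image (fun e => e i)).card = n - T.card := by
    intro i
    rw [card_sdiff_of_subset, hU, card_image_of_injOn]
    · intro e he e' he' h
      by_contra hne
      exact hT.2 e he e' he' hne i h
    · intro v hv
      obtain ⟨e, he, rfl⟩ := mem_image.1 hv
      exact hT.1 e he i
  simp [this]

omit [Fintype Λ] in
lemma notMem_of_mem_freeEdges (hk : 1 ≤ k) {U : Fin k → Finset Λ} {T : Finset (Fin k → Λ)}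
    {e : Fin k → Λ} (he : e ∈ freeEdges U T) : e ∉ T :=
  fun h => (mem_freeEdges.1 he).2 e h ⟨0, hk⟩ rfl

omit [Fintype Λ] in
lemma IsMatching.insert_freeEdge {U : Fin k → Finset Λ} {T : Finset (Fin k → Λ)}
    (hT : IsMatching U T) {e : Fin k → Λ} (he : e ∈ freeEdges U T) :
    IsMatching U (insert e T) := by
  rw [mem_freeEdges] at he
  refine ⟨?_, ?_⟩
  · intro a ha
    rcases mem_insert.1 ha with rfl | ha
    · exact he.1
    · exact hT.1 a ha
  · intro a ha b hb hab i
    rcases mem_insert.1 ha with rfl | ha' <;> rcases mem_insert.1 hb with rfl | hb'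
    · exact absurd rfl hab
    · exact he.2 b hb' i
    · exact (he.2 a ha' i).symm
    · exact hT.2 a ha' b hb' hab i

lemma mem_OmegaRes_update_iff {U : Fin k → Finset Λ} {m : ℕ}
    {z y : (Fin k → Λ) → Option (Fin k → ZMod N)} (hy : y ∈ OmegaRes U N m z)
    {e : Fin k → Λ} (he : e ∉ lsupp z) (l : Fin k → ZMod N) :
    y ∈ OmegaRes U N m (Function.update z e (some l)) ↔ y e = some l := by
  rw [mem_OmegaRes] at hy ⊢
  rw [lsupp_update]
  constructor
  · intro h
    simpa using h.2 e (mem_insert_self _ _)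
  · intro h
    refine ⟨hy.1, fun e' he' => ?_⟩
    by_cases hee : e' = e
    · subst hee; simpa using h
    · rw [Function.update_of_ne hee]
      exact hy.2 e' ((mem_insert.1 he').resolve_left hee)

lemma OmegaRes_update_subset {U : Fin k → Finset Λ} {m : ℕ}
    {z : (Fin k → Λ) → Option (Fin k → ZMod N)} {e : Fin k → Λ} (he : e ∉ lsupp z)
    (l : Fin k → ZMod N) :
    OmegaRes U N m (Function.update z e (some l)) ⊆ OmegaRes U N m z := by
  intro y hy
  rw [mem_OmegaRes, lsupp_update] at hy
  refine mem_OmegaRes.2 ⟨hy.1, fun e' he' => ?_⟩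
  have := hy.2 e' (mem_insert_of_mem he')
  have hne : e' ≠ e := fun h => he (h ▸ he')
  rwa [Function.update_of_ne hne] at this

/-- Double counting of the one-edge extensions of `z`. -/
lemma sum_card_OmegaRes_update (hk : 1 ≤ k) {U : Fin k → Finset Λ} {m : ℕ}
    (z : (Fin k → Λ) → Option (Fin k → ZMod N)) :
    ∑ p ∈ freeEdges U (lsupp z) ×ˢ (univ : Finset (Fin k → ZMod N)),
        (OmegaRes U N m (Function.update z p.1 (some p.2))).card =
      (m - (lsupp z).card) * (OmegaRes U N m z).card := by
  set P := freeEdges U (lsupp z) ×ˢ (univ : Finset (Fin k → ZMod N)) with hP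
  have hnot : ∀ p ∈ P, p.1 ∉ lsupp z := fun p hp =>
    notMem_of_mem_freeEdges hk (mem_product.1 hp).1
  have h1 : ∀ p ∈ P, (OmegaRes U N m (Function.update z p.1 (some p.2))).card =
      ((OmegaRes U N m z).filter (fun y => y p.1 = some p.2)).card := by
    intro p hp
    congr 1
    ext y
    rw [mem_filter]
    constructor
    · intro h
      have h' := OmegaRes_update_subset (hnot p hp) p.2 h
      exact ⟨h', (mem_OmegaRes_update_iff h' (hnot p hp) p.2).1 h⟩
    · exact fun h => (mem_OmegaRes_update_iff h.1 (hnot p hp) p.2).2 h.2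
  have h2 : ∀ y ∈ OmegaRes U N m z,
      (P.filter (fun p => y p.1 = some p.2)).card = m - (lsupp z).card := by
    intro y hy
    have hsub := lsupp_subset_of_mem_OmegaRes hy
    have hy' := mem_OmegaRes.1 hy
    rw [← hy'.1.2, ← card_sdiff_of_subset hsub]
    refine card_bij (fun p _ => p.1) ?_ ?_ ?_
    · intro p hp
      obtain ⟨hp, hyp⟩ := mem_filter.1 hp
      refine mem_sdiff.2 ⟨mem_lsupp.2 ?_, hnot p hp⟩
      simp [hyp]
    · rintro ⟨a, l⟩ hp ⟨b, l'⟩ hq (rfl : a = b)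
      have e1 := (mem_filter.1 hp).2
      have e2 := (mem_filter.1 hq).2
      simp only at e1 e2
      rw [e1] at e2
      simpa using e2
    · intro e he
      obtain ⟨he, hez⟩ := mem_sdiff.1 he
      obtain ⟨l, hl⟩ := Option.ne_none_iff_exists'.1 (mem_lsupp.1 he)
      refine ⟨(e, l), mem_filter.2 ⟨mem_product.2 ⟨?_, mem_univ _⟩, hl⟩, rfl⟩
      refine mem_freeEdges.2 ⟨hy'.1.1.1 e he, fun e' he' i => ?_⟩
      exact hy'.1.1.2 e he e' (hsub he') (fun h => hez (h ▸ he')) i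
  rw [sum_congr rfl h1]
  have := sum_card_bipartiteAbove_eq_sum_card_bipartiteBelow (s := P) (t := OmegaRes U N m z)
    (fun p y => y p.1 = some p.2)
  simp only [bipartiteAbove, bipartiteBelow] at this
  rw [this, sum_congr rfl h2, sum_const, smul_eq_mul, mul_comm]

/-- The number of labeled matchings of size `m` extending a restriction. -/
lemma card_OmegaRes_mul_factorial (hk : 1 ≤ k) {U : Fin k → Finset Λ} {n : ℕ}
    (hU : ∀ i, (U i).card = n) {m : ℕ} (hm : m ≤ n)
    {z : (Fin k → Λ) → Option (Fin k → ZMod N)} (hz : IsRestriction U m z) :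
    (OmegaRes U N m z).card * (m - (lsupp z).card).factorial =
      ((n - (lsupp z).card).descFactorial (m - (lsupp z).card)) ^ k *
        (N ^ k) ^ (m - (lsupp z).card) := by
  generalize hr : m - (lsupp z).card = r
  induction r generalizing z with
  | zero =>
    have hcard : (lsupp z).card = m := le_antisymm hz.2 (by omega)
    have : OmegaRes U N m z = {z} := by
      ext y
      rw [mem_singleton]
      constructor
      · intro hy
        have hy' := mem_OmegaRes.1 hy
        have heq : lsupp z = lsupp y := eq_of_subset_of_card_le
          (lsupp_subset_of_mem_OmegaRes hy) (by rw [hy'.1.2, hcard])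
        funext e
        by_cases he : e ∈ lsupp z
        · exact hy'.2 e he
        · have h1 : y e = none := by
            by_contra h
            exact he (heq ▸ mem_lsupp.2 h)
          have h2 : z e = none := by
            by_contra h
            exact he (mem_lsupp.2 h)
          rw [h1, h2]
      · rintro rfl
        exact mem_OmegaRes.2 ⟨⟨hz.1, hcard⟩, fun _ _ => rfl⟩
    simp [this]
  | succ r ih =>
    have hsum := sum_card_OmegaRes_update hk (U := U) (m := m) z
    have hstep : ∀ p ∈ freeEdges U (lsupp z) ×ˢ (univ : Finset (Fin k → ZMod N)),
        (OmegaRes U N m (Function.update z p.1 (some p.2))).card * r.factorial =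
          ((n - (lsupp z).card - 1).descFactorial r) ^ k * (N ^ k) ^ r := by
      intro p hp
      have hp1 := (mem_product.1 hp).1
      have hc : (lsupp (Function.update z p.1 (some p.2))).card = (lsupp z).card + 1 := by
        rw [lsupp_update, card_insert_of_notMem (notMem_of_mem_freeEdges hk hp1)]
      have := ih (z := Function.update z p.1 (some p.2))
        ⟨by rw [lsupp_update]; exact hz.1.insert_freeEdge hp1, by rw [hc]; omega⟩
        (by rw [hc]; omega)
      rwa [hc, ← Nat.sub_sub] at this
    rw [hr] at hsum
    obtain ⟨a, ha⟩ : ∃ a, n - (lsupp z).card = a + 1 := ⟨n - (lsupp z).card - 1, by omega⟩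
    calc (OmegaRes U N m z).card * (r + 1).factorial
        = ((r + 1) * (OmegaRes U N m z).card) * r.factorial := by
          rw [Nat.factorial_succ]; ring
      _ = _ := by
          rw [← hsum, sum_mul, sum_congr rfl hstep, sum_const, card_product,
            card_freeEdges hU hz.1, ha, Nat.succ_descFactorial_succ, mul_pow]
          simp only [card_univ, Fintype.card_pi_const, ZMod.card, smul_eq_mul,
            Nat.add_sub_cancel]
          ring

lemma card_OmegaRes_pos (hk : 1 ≤ k) {U : Fin k → Finset Λ} {n : ℕ}
    (hU : ∀ i, (U i).card = n) {m : ℕ} (hm : m ≤ n)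
    {z : (Fin k → Λ) → Option (Fin k → ZMod N)} (hz : IsRestriction U m z) :
    0 < (OmegaRes U N m z).card := by
  have h := card_OmegaRes_mul_factorial hk hU hm hz
  have hpos : 0 < ((n - (lsupp z).card).descFactorial (m - (lsupp z).card)) ^ k *
      (N ^ k) ^ (m - (lsupp z).card) := by
    have h1 : 0 < (n - (lsupp z).card).descFactorial (m - (lsupp z).card) :=
      Nat.descFactorial_pos.2 (by omega)
    have h2 : 0 < N := NeZero.pos N
    positivity
  rw [← h] at hpos
  exact Nat.pos_of_mul_pos_right hpos

lemma card_OmegaRes_ratio (hk : 1 ≤ k) {U : Fin k → Finset Λ} {n : ℕ}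
    (hU : ∀ i, (U i).card = n) {m : ℕ} (hm : m ≤ n)
    {z z' : (Fin k → Λ) → Option (Fin k → ZMod N)} (hz : IsRestriction U m z)
    (hz' : IsRestriction U m z') {d : ℕ} (hd : (lsupp z').card = (lsupp z).card + d) :
    (OmegaRes U N m z).card * (m - (lsupp z).card).descFactorial d =
      (OmegaRes U N m z').card * (((n - (lsupp z).card).descFactorial d) ^ k * (N ^ k) ^ d) := by
  have h1 := card_OmegaRes_mul_factorial hk hU hm hz
  have h2 := card_OmegaRes_mul_factorial hk hU hm hz'
  have hle := hz'.2
  rw [hd] at h2 hle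
  set s := (lsupp z).card
  have e1 : (m - s).factorial = (m - (s + d)).factorial * (m - s).descFactorial d := by
    rw [← Nat.factorial_mul_descFactorial (show d ≤ m - s by omega), Nat.sub_sub]
  have e2 : (n - s).descFactorial (m - s) =
      (n - (s + d)).descFactorial (m - (s + d)) * (n - s).descFactorial d := by
    rw [← Nat.descFactorial_mul_descFactorial (show d ≤ m - s by omega), Nat.sub_sub, Nat.sub_sub]
  have e3 : (N ^ k) ^ (m - s) = (N ^ k) ^ (m - (s + d)) * (N ^ k) ^ d := by
    rw [← pow_add]; congr 1; omega
  apply Nat.eq_of_mul_eq_mul_right (Nat.factorial_pos (m - (s + d)))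
  calc (OmegaRes U N m z).card * (m - s).descFactorial d * (m - (s + d)).factorial
      = (OmegaRes U N m z).card * (m - s).factorial := by rw [e1]; ring
    _ = ((OmegaRes U N m z').card * (m - (s + d)).factorial) *
        (((n - s).descFactorial d) ^ k * (N ^ k) ^ d) := by
        rw [h1, h2, e2, e3]; ring
    _ = _ := by ring

/-- Extend `z` by labels on the edges of `S` outside the support of `z`. -/
noncomputable def extendLabels (z : (Fin k → Λ) → Option (Fin k → ZMod N))
    (S : Finset (Fin k → Λ)) (l : ↥(S \ lsupp z) → (Fin k → ZMod N)) :
    (Fin k → Λ) → Option (Fin k → ZMod N) :=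
  fun e => if h : e ∈ S \ lsupp z then some (l ⟨e, h⟩) else z e

lemma extendLabels_of_mem (z : (Fin k → Λ) → Option (Fin k → ZMod N))
    (S : Finset (Fin k → Λ)) (l : ↥(S \ lsupp z) → (Fin k → ZMod N)) {e : Fin k → Λ}
    (he : e ∈ lsupp z) : extendLabels z S l e = z e := by
  simp [extendLabels, he]

lemma lsupp_extendLabels {z : (Fin k → Λ) → Option (Fin k → ZMod N)}
    {S : Finset (Fin k → Λ)} (hzS : lsupp z ⊆ S) (l : ↥(S \ lsupp z) → (Fin k → ZMod N)) :
    lsupp (extendLabels z S l) = S := by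
  ext e
  rw [mem_lsupp]
  by_cases he : e ∈ S \ lsupp z
  · simp [extendLabels, he, (mem_sdiff.1 he).1]
  · rw [extendLabels, dif_neg he, ← mem_lsupp]
    refine ⟨fun h => hzS h, fun h => ?_⟩
    by_contra hne
    exact he (mem_sdiff.2 ⟨h, hne⟩)

lemma filter_subset_biUnion_extendLabels {U : Fin k → Finset Λ} {m : ℕ}
    {z : (Fin k → Λ) → Option (Fin k → ZMod N)} {S : Finset (Fin k → Λ)}
    (hzS : lsupp z ⊆ S) {A : Finset ((Fin k → Λ) → Option (Fin k → ZMod N))}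
    (hA : A ⊆ OmegaRes U N m z) :
    A.filter (fun y => S ⊆ lsupp y) ⊆
      univ.biUnion (fun l => A ∩ OmegaRes U N m (extendLabels z S l)) := by
  intro y hy
  obtain ⟨hyA, hSy⟩ := mem_filter.1 hy
  have hy' := mem_OmegaRes.1 (hA hyA)
  refine mem_biUnion.2 ⟨fun e => (y e.1).getD 0, mem_univ _, mem_inter.2 ⟨hyA, ?_⟩⟩
  refine mem_OmegaRes.2 ⟨hy'.1, fun e he => ?_⟩
  rw [lsupp_extendLabels hzS] at he
  by_cases hez : e ∈ lsupp z
  · rw [extendLabels_of_mem _ _ _ hez, hy'.2 e hez]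
  · obtain ⟨l, hl⟩ := Option.ne_none_iff_exists'.1 (mem_lsupp.1 (hSy he))
    simp [extendLabels, he, hez, hl]

end LabeledMatchings

lemma two_pow_mul_descFactorial_le (hk : 1 ≤ k) {m n s d : ℕ} (hm : m ≤ n) (hd : s + d ≤ m)
    (hs : 2 * s ≤ n) :
    2 ^ d * (m - s).descFactorial d * (n ^ k) ^ d ≤
      (6 ^ k * m) ^ d * ((n - s).descFactorial d) ^ k := by
  obtain ⟨j, rfl⟩ : ∃ j, k = j + 1 := ⟨k - 1, by omega⟩
  have h1 := descFactorial_mul_pow_le m n s d hm hd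
  have h2 : n ^ d ≤ 6 ^ d * (n - s).descFactorial d := by
    calc n ^ d ≤ (2 * (n - s)) ^ d := by gcongr; omega
      _ = 2 ^ d * (n - s) ^ d := mul_pow _ _ _
      _ ≤ 2 ^ d * (3 ^ d * (n - s).descFactorial d) := by
          gcongr
          exact pow_le_three_pow_mul_descFactorial _ _ (by omega)
      _ = 6 ^ d * (n - s).descFactorial d := by
          rw [← mul_assoc, ← mul_pow]; norm_num
  have h3 : 2 ^ d ≤ 6 ^ d := by gcongr; norm_num
  calc 2 ^ d * (m - s).descFactorial d * (n ^ (j + 1)) ^ d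
      = 2 ^ d * ((m - s).descFactorial d * n ^ d) * (n ^ d) ^ j := by
        rw [← pow_mul, ← pow_mul]; ring
    _ ≤ 6 ^ d * (m ^ d * (n - s).descFactorial d) *
        (6 ^ d * (n - s).descFactorial d) ^ j := by gcongr
    _ = _ := by
        rw [mul_pow, mul_pow, ← pow_mul, ← pow_mul]; ring

/-- If `A ⊆ Ω^{U,m}_z` is a nonempty `z`-global set with `|supp z| ≤ min{m, |U|/2}`, then
for every matching `S` of size at most `m` containing `supp z`,
`Pr_{y ∈ A}[S ⊆ supp y] ≤ (6^k·m/|U|^k)^{|S| − |supp z|}`. -/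
theorem stmt4 (hk : 1 ≤ k) (N : ℕ) [NeZero N] (hN : 2 ≤ N)
    (U : Fin k → Finset Λ) (n : ℕ)
    (hUcard : ∀ i, (U i).card = n)
    (hUdisj : ∀ i j, i ≠ j → Disjoint (U i) (U j))
    (m : ℕ) (hm0 : 0 < m) (hm : m ≤ n)
    (z : (Fin k → Λ) → Option (Fin k → ZMod N))
    (hz : IsRestriction U m z)
    (hzhalf : ((lsupp z).card : ℝ) ≤ min (m : ℝ) ((n : ℝ) / 2))
    (A : Finset ((Fin k → Λ) → Option (Fin k → ZMod N)))
    (hA : A.Nonempty)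
    (hglobal : IsGlobal U N m z A)
    (S : Finset (Fin k → Λ)) (hS : IsMatching U S) (hScard : S.card ≤ m)
    (hzS : lsupp z ⊆ S) :
    ((A.filter (fun y => S ⊆ lsupp y)).card : ℝ) / (A.card : ℝ) ≤
      ((6 ^ k * (m : ℝ)) / (n : ℝ) ^ k) ^ (S.card - (lsupp z).card) := by
  set s := (lsupp z).card with hs
  obtain ⟨d, hd⟩ : ∃ d, S.card = s + d := Nat.exists_eq_add_of_le (card_le_card hzS)
  have hSd : S.card - s = d := by omega
  rw [hSd]
  have hs2 : 2 * s ≤ n := by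
    have h := hzhalf.trans (min_le_right _ _)
    have h' : 2 * (s : ℝ) ≤ n := by linarith
    exact_mod_cast h'
  have hn : (0 : ℝ) < n := by
    have : 0 < n := by omega
    exact_mod_cast this
  have hApos : (0 : ℝ) < A.card := by exact_mod_cast hA.card_pos
  set F := (n - s).descFactorial d with hF
  have hFpos : (0 : ℝ) < F := by
    have : 0 < F := Nat.descFactorial_pos.2 (by omega)
    exact_mod_cast this
  have hNpos : (0 : ℝ) < N := by exact_mod_cast NeZero.pos N
  have hΩ : (0 : ℝ) < (OmegaRes U N m z).card := by
    exact_mod_cast card_OmegaRes_pos hk hUcard hm hz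
  have hFk : (0 : ℝ) < (F : ℝ) ^ k := pow_pos hFpos k
  have hNkd : (0 : ℝ) < ((N : ℝ) ^ k) ^ d := pow_pos (pow_pos hNpos k) d
  have hterm : ∀ l : ↥(S \ lsupp z) → (Fin k → ZMod N),
      ((A ∩ OmegaRes U N m (extendLabels z S l)).card : ℝ) ≤
        2 ^ d * A.card * (m - s).descFactorial d / ((F : ℝ) ^ k * ((N : ℝ) ^ k) ^ d) := by
    intro l
    have hsupp := lsupp_extendLabels hzS l
    have hres : IsRestriction U m (extendLabels z S l) := by
      rw [IsRestriction, hsupp]; exact ⟨hS, hScard⟩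
    have hsub : Subsumes (extendLabels z S l) z :=
      ⟨by rwa [hsupp], fun e he => extendLabels_of_mem z S l he⟩
    have hg := hglobal.2 _ hres hsub
    have hΩ' : (0 : ℝ) < (OmegaRes U N m (extendLabels z S l)).card := by
      exact_mod_cast card_OmegaRes_pos hk hUcard hm hres
    have hratio := card_OmegaRes_ratio hk hUcard hm hz hres (d := d) (by rw [hsupp]; exact hd)
    rw [← hs, ← hF] at hratio
    have hratio' : ((OmegaRes U N m z).card : ℝ) * (m - s).descFactorial d =
        (OmegaRes U N m (extendLabels z S l)).card * ((F : ℝ) ^ k * ((N : ℝ) ^ k) ^ d) := by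
      exact_mod_cast hratio
    rw [hsupp, ← hs, hSd, div_le_div_iff₀ hΩ' hΩ] at hg
    rw [le_div_iff₀ (mul_pos hFk hNkd)]
    refine le_of_mul_le_mul_right ?_ (mul_pos hΩ hΩ')
    calc _ = ((A ∩ OmegaRes U N m (extendLabels z S l)).card * (OmegaRes U N m z).card : ℝ) *
          ((OmegaRes U N m (extendLabels z S l)).card * ((F : ℝ) ^ k * ((N : ℝ) ^ k) ^ d)) := by
          ring
      _ ≤ (2 ^ d * A.card * (OmegaRes U N m (extendLabels z S l)).card : ℝ) *
          ((OmegaRes U N m (extendLabels z S l)).card * ((F : ℝ) ^ k * ((N : ℝ) ^ k) ^ d)) :=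
          mul_le_mul_of_nonneg_right hg (mul_pos hΩ' (mul_pos hFk hNkd)).le
      _ = _ := by rw [← hratio']; ring
  have hcardS : Fintype.card ↥(S \ lsupp z) = d := by
    rw [Fintype.card_coe, card_sdiff_of_subset hzS, ← hs, hSd]
  have hsum : ((A.filter (fun y => S ⊆ lsupp y)).card : ℝ) ≤
      2 ^ d * A.card * (m - s).descFactorial d / (F : ℝ) ^ k := by
    calc ((A.filter (fun y => S ⊆ lsupp y)).card : ℝ)
        ≤ ∑ l : ↥(S \ lsupp z) → (Fin k → ZMod N),
            ((A ∩ OmegaRes U N m (extendLabels z S l)).card : ℝ) := by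
          exact_mod_cast (card_le_card (filter_subset_biUnion_extendLabels hzS hglobal.1)).trans
            card_biUnion_le
      _ ≤ ∑ _l : ↥(S \ lsupp z) → (Fin k → ZMod N),
            2 ^ d * A.card * (m - s).descFactorial d / ((F : ℝ) ^ k * ((N : ℝ) ^ k) ^ d) :=
          sum_le_sum fun l _ => hterm l
      _ = _ := by
          rw [sum_const, card_univ, Fintype.card_fun, hcardS]
          simp only [Fintype.card_fun, Fintype.card_fin, ZMod.card, nsmul_eq_mul, Nat.cast_pow]
          rw [← mul_div_assoc, mul_comm ((F : ℝ) ^ k), mul_div_mul_left _ _ hNkd.ne']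
  have hnum : (2 : ℝ) ^ d * (m - s).descFactorial d * ((n : ℝ) ^ k) ^ d ≤
      (6 ^ k * m) ^ d * (F : ℝ) ^ k := by
    exact_mod_cast two_pow_mul_descFactorial_le hk hm (by omega) hs2
  calc ((A.filter (fun y => S ⊆ lsupp y)).card : ℝ) / A.card
      ≤ (2 ^ d * A.card * (m - s).descFactorial d / (F : ℝ) ^ k) / A.card :=
        div_le_div_of_nonneg_right hsum hApos.le
    _ = 2 ^ d * (m - s).descFactorial d / (F : ℝ) ^ k := by
        rw [div_right_comm, mul_right_comm, mul_div_cancel_right₀ _ hApos.ne']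
    _ ≤ (6 ^ k * m) ^ d / ((n : ℝ) ^ k) ^ d := by
        rw [div_le_div_iff₀ hFk (pow_pos (pow_pos hn k) d)]
        exact hnum
    _ = _ := by rw [div_pow]
end

section
/- Fix a k-universe U embedded in a finite set Λ, an integer N ≥ 2, and a nonnegative integer m ≤ |U|. Let t, i, b be nonnegative integers with i + b ≤ t. Then for every vector z : Λ → ZMod N with Hamming weight ‖z‖_H = t and every pseudo-uniform probability distribution D on M_{U,m}, the probability over M ∼ D that |in_{M,z}| = i and |bd_{M,z}| = b is at most (24k²)^t · (i·m/|U|²)^{i/2} · (m/|U|)^b (with the convention 0^0 = 1). -/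
open Finset
open scoped Classical

variable {k : ℕ} {Λ : Type*} [Fintype Λ] [DecidableEq Λ]

noncomputable section

/-- `M_{U,m}`: the set of all matchings of size `m` in the universe `U`. -/
def MM (U : Fin k → Finset Λ) (m : ℕ) : Finset (Finset (Fin k → Λ)) :=
  Finset.univ.filter (fun S => IsMatching U S ∧ S.card = m)

/-- A pseudo-uniform probability distribution on `M_{U,m}`. -/
def PseudoUniform (U : Fin k → Finset Λ) (m : ℕ) (D : Finset (Fin k → Λ) → ℝ) : Prop :=
  (∀ M, 0 ≤ D M) ∧ (∀ M, M ∉ MM U m → D M = 0) ∧ ((∑ M ∈ MM U m, D M) = 1) ∧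
  ∀ d, d ≤ m → ∀ S : Finset (Fin k → Λ), IsMatching U S → S.card = d →
    (∑ M ∈ (MM U m).filter (fun M => S ⊆ M), D M) ≤
      (2 : ℝ) ^ d * (((MM U m).filter (fun M => S ⊆ M)).card : ℝ) / ((MM U m).card : ℝ)

/-- The support of a vector `z : Λ → ZMod N`. -/
def vsupp {N : ℕ} [NeZero N] (z : Λ → ZMod N) : Finset Λ :=
  Finset.univ.filter (fun v => z v ≠ 0)

/-- The internal vertices of `z` with respect to the matching `M`: vertices of `supp z`
contained in an edge of `M` containing at least one other vertex of `supp z`. -/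
def inSet {N : ℕ} [NeZero N] (M : Finset (Fin k → Λ)) (z : Λ → ZMod N) : Finset Λ :=
  (vsupp z).filter (fun v => ∃ e ∈ M, (∃ i, e i = v) ∧ ∃ j, e j ≠ v ∧ z (e j) ≠ 0)

/-- The boundary vertices of `z` with respect to the matching `M`: vertices of `supp z`
contained in an edge of `M` containing no other vertex of `supp z`. -/
def bdSet {N : ℕ} [NeZero N] (M : Finset (Fin k → Λ)) (z : Λ → ZMod N) : Finset Λ :=
  (vsupp z).filter (fun v => ∃ e ∈ M, (∃ i, e i = v) ∧ ∀ j, e j ≠ v → z (e j) = 0)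

end

set_option linter.unusedSectionVars false

/-- The injective maps `Fin m → Λ` with values in `V`. -/
def injInto (m : ℕ) (V : Finset Λ) : Finset (Fin m → Λ) :=
  univ.filter (fun f => Function.Injective f ∧ ∀ l, f l ∈ V)

/-- The elements of `injInto m V` that send every index of `L` into `A`. -/
def injHit (m : ℕ) (V A : Finset Λ) (L : Finset (Fin m)) : Finset (Fin m → Λ) :=
  (injInto m V).filter (fun f => ∀ l ∈ L, f l ∈ A)

theorem card_injHit_fiber_le {m : ℕ} {V A : Finset Λ} {L : Finset (Fin m)} {l₀ : Fin m}
    (hl₀ : l₀ ∉ L) {u u' : Λ} (hu : u ∈ V) (hu' : u' ∈ V) (hu'A : u' ∉ A) :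
    ((injHit m V A L).filter (fun f => f l₀ = u)).card ≤
      ((injHit m V A L).filter (fun f => f l₀ = u')).card := by
  refine Finset.card_le_card_of_injOn (fun f => Equiv.swap u u' ∘ f) ?_ ?_
  · intro f hf
    simp only [injHit, injInto, Finset.coe_filter, Finset.mem_filter, Finset.mem_univ,
      true_and, Set.mem_ofPred_eq] at hf ⊢
    obtain ⟨⟨⟨hinj, hV⟩, hA⟩, hfl⟩ := hf
    refine ⟨⟨⟨(Equiv.swap u u').injective.comp hinj, fun l => ?_⟩, fun l hl => ?_⟩, ?_⟩
    · simp only [Function.comp, Equiv.swap_apply_def]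
      split_ifs
      exacts [hu', hu, hV l]
    · have h1 : f l ≠ u := fun h => hl₀ (hinj (h.trans hfl.symm) ▸ hl)
      have h2 : f l ≠ u' := fun h => hu'A (h ▸ hA l hl)
      simpa [Function.comp, Equiv.swap_apply_of_ne_of_ne h1 h2] using hA l hl
    · simp [hfl]
  · intro f _ g _ h
    exact funext fun l => (Equiv.swap u u').injective (congrFun h l)

theorem card_injHit_insert_mul_le {m : ℕ} {V A : Finset Λ} (hAV : A ⊆ V) {L : Finset (Fin m)}
    {l₀ : Fin m} (hl₀ : l₀ ∉ L) :
    (injHit m V A (insert l₀ L)).card * V.card ≤ A.card * (injHit m V A L).card := by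
  set c : Λ → ℕ := fun u => ((injHit m V A L).filter (fun f => f l₀ = u)).card with hc
  have hmaps : ∀ f ∈ injHit m V A L, f l₀ ∈ V := fun f hf => by
    simp only [injHit, injInto, Finset.mem_filter] at hf
    exact hf.1.2.2 l₀
  have htot : (injHit m V A L).card = ∑ u ∈ V, c u := Finset.card_eq_sum_card_fiberwise hmaps
  have hins : (injHit m V A (insert l₀ L)).card = ∑ u ∈ A, c u := by
    have hmaps' : ∀ f ∈ injHit m V A (insert l₀ L), f l₀ ∈ A := fun f hf => by
      simp only [injHit, Finset.mem_filter] at hf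
      exact hf.2 l₀ (Finset.mem_insert_self _ _)
    rw [Finset.card_eq_sum_card_fiberwise hmaps']
    refine Finset.sum_congr rfl fun u hu => congrArg Finset.card ?_
    ext f
    simp only [injHit, Finset.mem_filter, Finset.forall_mem_insert]
    constructor
    · rintro ⟨⟨h1, -, h2⟩, h3⟩
      exact ⟨⟨h1, h2⟩, h3⟩
    · rintro ⟨⟨h1, h2⟩, h3⟩
      exact ⟨⟨h1, h3 ▸ hu, h2⟩, h3⟩
  have hsplit : ∑ u ∈ V \ A, c u + ∑ u ∈ A, c u = ∑ u ∈ V, c u := Finset.sum_sdiff hAV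
  have hcross : (∑ u ∈ A, c u) * (V \ A).card ≤ A.card * ∑ u ∈ V \ A, c u := by
    have h : ∀ u ∈ A, c u * (V \ A).card ≤ ∑ u' ∈ V \ A, c u' := fun u hu => by
      rw [mul_comm, ← smul_eq_mul]
      refine Finset.card_nsmul_le_sum _ _ _ fun u' hu' => ?_
      rw [Finset.mem_sdiff] at hu'
      exact card_injHit_fiber_le hl₀ (hAV hu) hu'.1 hu'.2
    rw [Finset.sum_mul]
    simpa using Finset.sum_le_card_nsmul _ _ _ h
  have hcard : (V \ A).card + A.card = V.card := Finset.card_sdiff_add_card_eq_card hAV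
  rw [hins, htot, ← hsplit, ← hcard]
  nlinarith

theorem card_injHit_le {m : ℕ} {V A : Finset Λ} (hAV : A ⊆ V) (hV : 0 < V.card)
    (L : Finset (Fin m)) :
    ((injHit m V A L).card : ℝ) ≤ ((A.card : ℝ) / V.card) ^ L.card * (injInto m V).card := by
  induction L using Finset.induction_on with
  | empty => simp [injHit]
  | insert l₀ L hl₀ ih =>
    have hV' : (0 : ℝ) < V.card := by exact_mod_cast hV
    have h : ((injHit m V A (insert l₀ L)).card : ℝ) * V.card ≤
        A.card * (injHit m V A L).card := by
      exact_mod_cast card_injHit_insert_mul_le hAV hl₀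
    rw [Finset.card_insert_of_notMem hl₀, pow_succ']
    calc ((injHit m V A (insert l₀ L)).card : ℝ)
        ≤ (A.card / V.card) * (injHit m V A L).card := by
          rw [div_mul_eq_mul_div, le_div_iff₀ hV']
          exact h
      _ ≤ (A.card / V.card) * (((A.card : ℝ) / V.card) ^ L.card * (injInto m V).card) := by
          gcongr
      _ = _ := by ring

/-- The `k`-tuples of injections `Fin m → U j`, i.e. the ordered matchings of size `m`. -/
def orderedMatchings (U : Fin k → Finset Λ) (m : ℕ) : Finset (Fin k → Fin m → Λ) :=
  Fintype.piFinset (fun j => injInto m (U j))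

/-- If every edge weight is dominated by a nonnegative combination of indicators
`∏_{j ∈ T} 1[e_j ∈ A_j]`, the total weight of the ordered matchings is at most what it would be
if all the events `e_j ∈ A_j` were independent. -/
theorem sum_orderedMatchings_prod_le {U A : Fin k → Finset Λ} {n m : ℕ} (hn : 0 < n)
    (hU : ∀ j, (U j).card = n) (hA : ∀ j, A j ⊆ U j)
    {g : Finset (Fin k) → ℝ} (hg : ∀ T, 0 ≤ g T) :
    ∑ F ∈ orderedMatchings U m,
        ∏ l, ∑ T : Finset (Fin k), g T * ∏ j ∈ T, (if F j l ∈ A j then (1 : ℝ) else 0) ≤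
      (∑ T : Finset (Fin k), g T * ∏ j ∈ T, ((A j).card : ℝ) / n) ^ m *
        (orderedMatchings U m).card := by
  have hcard : ((orderedMatchings U m).card : ℝ) = ∏ j, ((injInto m (U j)).card : ℝ) := by
    rw [orderedMatchings, Fintype.card_piFinset]
    push_cast
    rfl
  have hprod : ∀ (τ : Fin m → Finset (Fin k)) (a : Fin k → Fin m → ℝ),
      ∏ l, ∏ j ∈ τ l, a j l = ∏ j, ∏ l, if j ∈ τ l then a j l else 1 := fun τ a => by
    rw [Finset.prod_comm]
    refine Finset.prod_congr rfl fun l _ => ?_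
    rw [Finset.prod_ite_mem, Finset.univ_inter]
  have hinner : ∀ τ : Fin m → Finset (Fin k),
      ∑ F ∈ orderedMatchings U m, ∏ l, ∏ j ∈ τ l, (if F j l ∈ A j then (1 : ℝ) else 0) ≤
        (∏ l, ∏ j ∈ τ l, ((A j).card : ℝ) / n) * (orderedMatchings U m).card := fun τ => by
    rw [hprod τ (fun j _ => ((A j).card : ℝ) / n), hcard, ← Finset.prod_mul_distrib]
    calc _ = ∑ F ∈ orderedMatchings U m, ∏ j, ∏ l,
            (if j ∈ τ l then (if F j l ∈ A j then (1 : ℝ) else 0) else 1) :=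
          Finset.sum_congr rfl fun F _ => hprod τ _
      _ = ∏ j, ∑ f ∈ injInto m (U j), ∏ l,
            (if j ∈ τ l then (if f l ∈ A j then (1 : ℝ) else 0) else 1) :=
          (Finset.prod_univ_sum _ (fun j (f : Fin m → Λ) => ∏ l,
            (if j ∈ τ l then (if f l ∈ A j then (1 : ℝ) else 0) else 1))).symm
      _ ≤ _ := by
          refine Finset.prod_le_prod (fun j _ => Finset.sum_nonneg fun f _ =>
            Finset.prod_nonneg fun l _ => by split_ifs <;> norm_num) fun j _ => ?_
          have h := card_injHit_le (hA j) (by rw [hU j]; exact hn)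
            (univ.filter fun l : Fin m => j ∈ τ l)
          rw [hU j] at h
          have e1 : ∏ l, (if j ∈ τ l then ((A j).card : ℝ) / n else 1) =
              (((A j).card : ℝ) / n) ^ (univ.filter fun l : Fin m => j ∈ τ l).card := by
            rw [← Finset.prod_filter, Finset.prod_const]
          rw [e1]
          refine le_trans (le_of_eq ?_) h
          rw [injHit, Finset.card_filter, Nat.cast_sum]
          refine Finset.sum_congr rfl fun f _ => ?_
          rw [← Finset.prod_filter, Finset.prod_ite_zero]
          simp
  calc _ = ∑ τ : Fin m → Finset (Fin k), (∏ l, g (τ l)) *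
          ∑ F ∈ orderedMatchings U m,
            ∏ l, ∏ j ∈ τ l, (if F j l ∈ A j then (1 : ℝ) else 0) := by
        simp_rw [Finset.mul_sum]
        rw [Finset.sum_comm]
        refine Finset.sum_congr rfl fun F _ => ?_
        rw [Finset.prod_univ_sum, Fintype.piFinset_univ]
        exact Finset.sum_congr rfl fun τ _ => Finset.prod_mul_distrib
    _ ≤ ∑ τ : Fin m → Finset (Fin k), (∏ l, g (τ l)) *
          ((∏ l, ∏ j ∈ τ l, ((A j).card : ℝ) / n) * (orderedMatchings U m).card) :=
        Finset.sum_le_sum fun τ _ =>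
          mul_le_mul_of_nonneg_left (hinner τ) (Finset.prod_nonneg fun l _ => hg _)
    _ = _ := by
        have hpow : (∑ T : Finset (Fin k), g T * ∏ j ∈ T, ((A j).card : ℝ) / n) ^ m =
            ∏ _l : Fin m, ∑ T : Finset (Fin k), g T * ∏ j ∈ T, ((A j).card : ℝ) / n := by
          simp
        rw [hpow, Finset.prod_univ_sum, Fintype.piFinset_univ, Finset.sum_mul]
        refine Finset.sum_congr rfl fun τ _ => ?_
        rw [Finset.prod_mul_distrib]
        ring

/-- The unordered matching underlying an ordered one. -/
def unorder {m : ℕ} (F : Fin k → Fin m → Λ) : Finset (Fin k → Λ) :=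
  univ.image (fun l j => F j l)

theorem injective_edge_of_mem_orderedMatchings (hk : 1 ≤ k) {U : Fin k → Finset Λ} {m : ℕ}
    {F : Fin k → Fin m → Λ} (hF : F ∈ orderedMatchings U m) :
    Function.Injective (fun (l : Fin m) (j : Fin k) => F j l) := fun l l' h => by
  simp only [orderedMatchings, Fintype.mem_piFinset, injInto, Finset.mem_filter] at hF
  exact (hF ⟨0, hk⟩).2.1 (congrFun h ⟨0, hk⟩)

theorem unorder_mem_MM (hk : 1 ≤ k) {U : Fin k → Finset Λ} {m : ℕ}
    {F : Fin k → Fin m → Λ} (hF : F ∈ orderedMatchings U m) : unorder F ∈ MM U m := by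
  have hinj := injective_edge_of_mem_orderedMatchings hk hF
  simp only [orderedMatchings, Fintype.mem_piFinset, injInto, Finset.mem_filter,
    Finset.mem_univ, true_and] at hF
  simp only [MM, Finset.mem_filter, Finset.mem_univ, true_and]
  refine ⟨⟨fun e he => ?_, fun e he e' he' hne j h => ?_⟩, ?_⟩
  · simp only [unorder, Finset.mem_image, Finset.mem_univ, true_and] at he
    obtain ⟨l, rfl⟩ := he
    exact fun j => (hF j).2 l
  · simp only [unorder, Finset.mem_image, Finset.mem_univ, true_and] at he he'
    obtain ⟨l, rfl⟩ := he
    obtain ⟨l', rfl⟩ := he'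
    exact hne (by rw [(hF j).1 h])
  · rw [unorder, Finset.card_image_of_injective _ hinj]
    simp

theorem card_fiber_unorder (hk : 1 ≤ k) {U : Fin k → Finset Λ} {m : ℕ}
    {M : Finset (Fin k → Λ)} (hM : M ∈ MM U m) :
    ((orderedMatchings U m).filter (fun F => unorder F = M)).card = m.factorial := by
  simp only [MM, Finset.mem_filter, Finset.mem_univ, true_and] at hM
  obtain ⟨⟨hedge, hdisj⟩, hcard⟩ := hM
  have e₀ : Fin m ≃ M := Fintype.equivOfCardEq (by simp [hcard])
  have hfact : Fintype.card (Fin m ≃ M) = m.factorial := by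
    rw [Fintype.card_equiv e₀, Fintype.card_fin]
  rw [← hfact, ← Finset.card_univ]
  symm
  refine Finset.card_bij (fun σ _ j l => (σ l).1 j) ?_ ?_ ?_
  · intro σ _
    simp only [Finset.mem_filter, orderedMatchings, Fintype.mem_piFinset, injInto,
      Finset.mem_univ, true_and]
    refine ⟨fun j => ⟨fun l l' h => ?_, fun l => hedge _ (σ l).2 j⟩, ?_⟩
    · by_contra hne
      exact hdisj _ (σ l).2 _ (σ l').2
        (fun h' => hne (σ.injective (Subtype.ext h'))) j h
    · ext e
      simp only [unorder, Finset.mem_image, Finset.mem_univ, true_and]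
      constructor
      · rintro ⟨l, rfl⟩
        exact (σ l).2
      · intro he
        exact ⟨σ.symm ⟨e, he⟩, by simp⟩
  · intro σ _ σ' _ h
    ext l j
    exact congrFun (congrFun h j) l
  · intro F hF
    rw [Finset.mem_filter] at hF
    obtain ⟨hF, rfl⟩ := hF
    have hinj := injective_edge_of_mem_orderedMatchings hk hF
    refine ⟨Equiv.ofBijective
      (fun l => ⟨fun j => F j l, Finset.mem_image_of_mem _ (Finset.mem_univ l)⟩) ⟨?_, ?_⟩,
      Finset.mem_univ _, rfl⟩
    · exact fun l l' h => hinj (congrArg Subtype.val h)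
    · rintro ⟨e, he⟩
      simp only [unorder, Finset.mem_image, Finset.mem_univ, true_and] at he
      obtain ⟨l, hl⟩ := he
      exact ⟨l, Subtype.ext hl⟩

theorem sum_orderedMatchings_unorder (hk : 1 ≤ k) (U : Fin k → Finset Λ) (m : ℕ)
    (G : Finset (Fin k → Λ) → ℝ) :
    ∑ F ∈ orderedMatchings U m, G (unorder F) = m.factorial * ∑ M ∈ MM U m, G M := by
  rw [← Finset.sum_fiberwise_of_maps_to (fun F hF => unorder_mem_MM hk hF), Finset.mul_sum]
  refine Finset.sum_congr rfl fun M hM => ?_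
  rw [Finset.sum_congr rfl (fun F hF => congrArg G (Finset.mem_filter.1 hF).2),
    Finset.sum_const, card_fiber_unorder hk hM, nsmul_eq_mul]

/-- The expected product of edge weights over a uniform matching of size `m`. -/
theorem sum_MM_prod_le (hk : 1 ≤ k) {U A : Fin k → Finset Λ} {n m : ℕ} (hn : 0 < n)
    (hU : ∀ j, (U j).card = n) (hA : ∀ j, A j ⊆ U j)
    {g : Finset (Fin k) → ℝ} (hg : ∀ T, 0 ≤ g T) :
    ∑ M ∈ MM U m,
        ∏ e ∈ M, ∑ T : Finset (Fin k), g T * ∏ j ∈ T, (if e j ∈ A j then (1 : ℝ) else 0) ≤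
      (∑ T : Finset (Fin k), g T * ∏ j ∈ T, ((A j).card : ℝ) / n) ^ m * (MM U m).card := by
  have h := sum_orderedMatchings_prod_le (m := m) hn hU hA hg
  have h1 := sum_orderedMatchings_unorder hk U m (fun M => ∏ e ∈ M,
    ∑ T : Finset (Fin k), g T * ∏ j ∈ T, (if e j ∈ A j then (1 : ℝ) else 0))
  have h2 := sum_orderedMatchings_unorder hk U m (fun _ => 1)
  simp only [Finset.sum_const, nsmul_eq_mul, mul_one] at h2
  have h3 : ∀ F ∈ orderedMatchings U m, (∏ e ∈ unorder F,
      ∑ T : Finset (Fin k), g T * ∏ j ∈ T, (if e j ∈ A j then (1 : ℝ) else 0)) =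
      ∏ l, ∑ T : Finset (Fin k), g T * ∏ j ∈ T, (if F j l ∈ A j then (1 : ℝ) else 0) :=
    fun F hF => by
      rw [unorder, Finset.prod_image
        fun l _ l' _ hl => injective_edge_of_mem_orderedMatchings hk hF hl]
  rw [Finset.sum_congr rfl h3] at h1
  rw [h1, h2, mul_left_comm] at h
  exact le_of_mul_le_mul_left h (by exact_mod_cast m.factorial_pos)

theorem PseudoUniform.sum_event_mul_le {U : Fin k → Finset Λ} {m : ℕ}
    {D : Finset (Fin k → Λ) → ℝ} (hD : PseudoUniform U m D)
    (P : Finset (Fin k → Λ) → Prop) [DecidablePred P]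
    (sel : (Fin k → Λ) → Prop) [DecidablePred sel]
    {ω : (Fin k → Λ) → ℝ} (hω : ∀ e, 0 ≤ ω e) {c : ℝ} (hc : 0 ≤ c)
    (hP : ∀ M ∈ MM U m, P M → c ≤ ∏ e ∈ M.filter sel, ω e) :
    (∑ M ∈ (MM U m).filter P, D M) * c * (MM U m).card ≤
      ∑ M ∈ MM U m, ∏ e ∈ M, (1 + 2 * ω e) := by
  obtain ⟨hD0, -, hD1, hDle⟩ := hD
  set 𝒮 := ((MM U m).filter P).image (fun M => M.filter sel) with h𝒮
  have hne : (MM U m).Nonempty := by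
    by_contra h
    rw [Finset.not_nonempty_iff_eq_empty] at h
    simp [h] at hD1
  have hpos : (0 : ℝ) < (MM U m).card := by exact_mod_cast hne.card_pos
  have hsum : (∑ M ∈ (MM U m).filter P, D M) ≤
      ∑ S ∈ 𝒮, (2 : ℝ) ^ S.card * (((MM U m).filter (fun M => S ⊆ M)).card : ℝ) /
        (MM U m).card := by
    rw [← Finset.sum_fiberwise_of_maps_to (g := fun M => M.filter sel) (t := 𝒮)
      (fun M hM => Finset.mem_image_of_mem _ hM)]
    refine Finset.sum_le_sum fun S hS => ?_
    obtain ⟨M₀, hM₀, rfl⟩ := Finset.mem_image.1 hS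
    have hM₀' := (Finset.mem_filter.1 hM₀).1
    simp only [MM, Finset.mem_filter, Finset.mem_univ, true_and] at hM₀'
    refine le_trans ?_ (hDle _ (hM₀'.2 ▸ Finset.card_filter_le _ _) _ ⟨fun e he =>
      hM₀'.1.1 e (Finset.mem_filter.1 he).1, fun e he e' he' => hM₀'.1.2 e
      (Finset.mem_filter.1 he).1 e' (Finset.mem_filter.1 he').1⟩ rfl)
    refine Finset.sum_le_sum_of_subset_of_nonneg (fun M hM => ?_) fun M _ _ => hD0 M
    simp only [Finset.mem_filter] at hM ⊢
    exact ⟨hM.1.1, hM.2 ▸ Finset.filter_subset _ _⟩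
  have hc𝒮 : ∀ S ∈ 𝒮, c ≤ ∏ e ∈ S, ω e := fun S hS => by
    obtain ⟨M, hM, rfl⟩ := Finset.mem_image.1 hS
    exact hP M (Finset.mem_filter.1 hM).1 (Finset.mem_filter.1 hM).2
  calc (∑ M ∈ (MM U m).filter P, D M) * c * (MM U m).card
      ≤ (∑ S ∈ 𝒮, (2 : ℝ) ^ S.card * (((MM U m).filter (fun M => S ⊆ M)).card : ℝ) /
        (MM U m).card) * c * (MM U m).card := by gcongr
    _ = ∑ S ∈ 𝒮, (2 : ℝ) ^ S.card * c * ((MM U m).filter (fun M => S ⊆ M)).card := by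
        rw [Finset.sum_mul, Finset.sum_mul]
        refine Finset.sum_congr rfl fun S _ => ?_
        field_simp
    _ ≤ ∑ S ∈ 𝒮, (∏ e ∈ S, 2 * ω e) * ((MM U m).filter (fun M => S ⊆ M)).card := by
        refine Finset.sum_le_sum fun S hS => ?_
        rw [Finset.prod_mul_distrib, Finset.prod_const]
        have := hc𝒮 S hS
        gcongr
    _ ≤ ∑ S, (∏ e ∈ S, 2 * ω e) * ((MM U m).filter (fun M => S ⊆ M)).card :=
        Finset.sum_le_sum_of_subset_of_nonneg (Finset.subset_univ _) fun S _ _ =>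
          mul_nonneg (Finset.prod_nonneg fun e _ => mul_nonneg zero_le_two (hω e))
            (Nat.cast_nonneg _)
    _ = ∑ M ∈ MM U m, ∑ S ∈ M.powerset, ∏ e ∈ S, 2 * ω e := by
        simp_rw [Finset.card_filter, Nat.cast_sum, Finset.mul_sum]
        rw [Finset.sum_comm]
        refine Finset.sum_congr rfl fun M _ => ?_
        simp only [Nat.cast_ite, Nat.cast_one, Nat.cast_zero, mul_ite, mul_one, mul_zero]
        rw [← Finset.sum_filter]
        refine Finset.sum_congr ?_ fun _ _ => rfl
        ext S
        simp
    _ = ∑ M ∈ MM U m, ∏ e ∈ M, (1 + 2 * ω e) := by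
        simp_rw [Finset.prod_one_add]

/-- The coordinates at which the edge `e` meets the support of `z`. -/
def hitCoords {N : ℕ} (z : Λ → ZMod N) (e : Fin k → Λ) : Finset (Fin k) :=
  univ.filter (fun j => z (e j) ≠ 0)

theorem mem_hitCoords {N : ℕ} {z : Λ → ZMod N} {e : Fin k → Λ} {j : Fin k} :
    j ∈ hitCoords z e ↔ z (e j) ≠ 0 := by
  simp [hitCoords]

theorem IsEdge.injective {U : Fin k → Finset Λ} (hU : ∀ i j, i ≠ j → Disjoint (U i) (U j))
    {e : Fin k → Λ} (he : IsEdge U e) : Function.Injective e := fun i j h => by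
  by_contra hne
  exact Finset.disjoint_left.1 (hU i j hne) (he i) (h ▸ he j)

theorem IsMatching.eq_of_apply_eq {U : Fin k → Finset Λ}
    (hU : ∀ i j, i ≠ j → Disjoint (U i) (U j)) {M : Finset (Fin k → Λ)} (hM : IsMatching U M)
    {e e' : Fin k → Λ} (he : e ∈ M) (he' : e' ∈ M) {i j : Fin k} (h : e i = e' j) : e = e' := by
  by_contra hne
  by_cases hij : i = j
  · subst hij
    exact hM.2 e he e' he' hne i h
  · exact Finset.disjoint_left.1 (hU i j hij) (hM.1 e he i) (h ▸ hM.1 e' he' j)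

theorem IsMatching.card_biUnion_hit {N : ℕ} {U : Fin k → Finset Λ}
    (hU : ∀ i j, i ≠ j → Disjoint (U i) (U j)) {M : Finset (Fin k → Λ)} (hM : IsMatching U M)
    (z : Λ → ZMod N) {M' : Finset (Fin k → Λ)} (hM' : M' ⊆ M) :
    (M'.biUnion fun e => (hitCoords z e).image e).card = ∑ e ∈ M', (hitCoords z e).card := by
  rw [Finset.card_biUnion]
  · exact Finset.sum_congr rfl fun e he =>
      Finset.card_image_of_injective _ ((hM.1 e (hM' he)).injective hU)
  · intro e he e' he' hne
    rw [Function.onFun, Finset.disjoint_left]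
    intro v hv hv'
    obtain ⟨i, -, hi⟩ := Finset.mem_image.1 hv
    obtain ⟨j, -, hj⟩ := Finset.mem_image.1 hv'
    exact hne (hM.eq_of_apply_eq hU (hM' he) (hM' he') (hi.trans hj.symm))

theorem IsMatching.card_inSet {N : ℕ} [NeZero N] {U : Fin k → Finset Λ}
    (hU : ∀ i j, i ≠ j → Disjoint (U i) (U j)) {M : Finset (Fin k → Λ)} (hM : IsMatching U M)
    (z : Λ → ZMod N) :
    (inSet M z).card = ∑ e ∈ M.filter (fun e => 1 < (hitCoords z e).card),
      (hitCoords z e).card := by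
  rw [← hM.card_biUnion_hit hU z (Finset.filter_subset _ _)]
  congr 1
  ext v
  simp only [inSet, vsupp, mem_hitCoords, Finset.mem_filter, Finset.mem_univ, true_and,
    Finset.mem_biUnion, Finset.mem_image, Finset.one_lt_card]
  constructor
  · rintro ⟨hv, e, he, ⟨i, rfl⟩, j, hj, hzj⟩
    exact ⟨e, ⟨he, i, hv, j, hzj, fun h => hj (h ▸ rfl)⟩, i, hv, rfl⟩
  · rintro ⟨e, ⟨he, a, ha, b, hb, hab⟩, i, hi, rfl⟩
    refine ⟨hi, e, he, ⟨i, rfl⟩, ?_⟩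
    have hinj := (hM.1 e he).injective hU
    by_cases h : a = i
    · exact ⟨b, fun h' => hab (h.trans (hinj h').symm), hb⟩
    · exact ⟨a, fun h' => h (hinj h'), ha⟩

theorem IsMatching.card_bdSet {N : ℕ} [NeZero N] {U : Fin k → Finset Λ}
    (hU : ∀ i j, i ≠ j → Disjoint (U i) (U j)) {M : Finset (Fin k → Λ)} (hM : IsMatching U M)
    (z : Λ → ZMod N) :
    (bdSet M z).card = (M.filter (fun e => (hitCoords z e).card = 1)).card := by
  have h : (M.filter (fun e => (hitCoords z e).card = 1)).card =
      ∑ e ∈ M.filter (fun e => (hitCoords z e).card = 1), (hitCoords z e).card := by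
    rw [Finset.sum_congr rfl fun e he => (Finset.mem_filter.1 he).2, Finset.sum_const,
      smul_eq_mul, mul_one]
  rw [h, ← hM.card_biUnion_hit hU z (Finset.filter_subset _ _)]
  congr 1
  ext v
  simp only [bdSet, vsupp, mem_hitCoords, Finset.mem_filter, Finset.mem_univ, true_and,
    Finset.mem_biUnion, Finset.mem_image]
  constructor
  · rintro ⟨hv, e, he, ⟨i, rfl⟩, hj⟩
    refine ⟨e, ⟨he, Finset.card_eq_one.2 ⟨i, ?_⟩⟩, i, hv, rfl⟩
    ext j
    rw [mem_hitCoords, Finset.mem_singleton]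
    constructor
    · intro hzj
      by_contra hne
      exact hzj (hj j fun h => hne ((hM.1 e he).injective hU h))
    · rintro rfl
      exact hv
  · rintro ⟨e, ⟨he, h1⟩, i, hi, rfl⟩
    refine ⟨hi, e, he, ⟨i, rfl⟩, fun j hj => ?_⟩
    by_contra hzj
    have := Finset.card_le_one.1 h1.le i (mem_hitCoords.2 hi) j (mem_hitCoords.2 hzj)
    exact hj (this ▸ rfl)

/-- The weight of an edge meeting the support in `q` vertices. -/
def hitWeight (x y : ℝ) (q : ℕ) : ℝ := if q = 0 then 0 else if q = 1 then y else x ^ q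

theorem hitWeight_nonneg {x y : ℝ} (hx : 0 ≤ x) (hy : 0 ≤ y) (q : ℕ) : 0 ≤ hitWeight x y q := by
  unfold hitWeight
  split_ifs <;> positivity

theorem IsMatching.prod_hitWeight {N : ℕ} [NeZero N] {U : Fin k → Finset Λ}
    (hU : ∀ i j, i ≠ j → Disjoint (U i) (U j)) {M : Finset (Fin k → Λ)} (hM : IsMatching U M)
    (z : Λ → ZMod N) (x y : ℝ) :
    ∏ e ∈ M.filter (fun e => (hitCoords z e).card ≠ 0), hitWeight x y (hitCoords z e).card =
      x ^ (inSet M z).card * y ^ (bdSet M z).card := by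
  rw [hM.card_inSet hU, hM.card_bdSet hU, ← Finset.prod_pow_eq_pow_sum, ← Finset.prod_const,
    Finset.prod_filter, Finset.prod_filter, Finset.prod_filter, ← Finset.prod_mul_distrib]
  refine Finset.prod_congr rfl fun e _ => ?_
  rcases Nat.lt_trichotomy (hitCoords z e).card 1 with h | h | h
  · simp [Nat.lt_one_iff.1 h]
  · simp [h, hitWeight]
  · have h0 : (hitCoords z e).card ≠ 0 := by omega
    have h1 : (hitCoords z e).card ≠ 1 := by omega
    simp only [hitWeight, ne_eq, h0, not_false_eq_true, h1, h, if_true, if_false, mul_one]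

/-- The coefficient of `∏ j ∈ T, 1[e j ∈ A j]` in the expansion of an edge factor. -/
def hitCoeff (x y : ℝ) (T : Finset (Fin k)) : ℝ :=
  if T.card = 0 then 1 else 2 * hitWeight x y T.card

theorem hitCoeff_nonneg {x y : ℝ} (hx : 0 ≤ x) (hy : 0 ≤ y) (T : Finset (Fin k)) :
    0 ≤ hitCoeff x y T := by
  have := hitWeight_nonneg hx hy T.card
  unfold hitCoeff
  split_ifs <;> positivity

theorem one_add_hitWeight_le {N : ℕ} [NeZero N] {x y : ℝ} (hx : 0 ≤ x) (hy : 0 ≤ y)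
    {U : Fin k → Finset Λ} {e : Fin k → Λ} (he : IsEdge U e) (z : Λ → ZMod N) :
    1 + 2 * hitWeight x y (hitCoords z e).card ≤ ∑ T : Finset (Fin k), hitCoeff x y T *
      ∏ j ∈ T, (if e j ∈ vsupp z ∩ U j then (1 : ℝ) else 0) := by
  set f : Finset (Fin k) → ℝ := fun T => hitCoeff x y T *
      ∏ j ∈ T, (if e j ∈ vsupp z ∩ U j then (1 : ℝ) else 0) with hf
  have hf0 : ∀ T, 0 ≤ f T := fun T => mul_nonneg (hitCoeff_nonneg hx hy T)
    (Finset.prod_nonneg fun j _ => by split_ifs <;> norm_num)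
  have hempty : f ∅ = 1 := by simp [hf, hitCoeff]
  by_cases h : hitCoords z e = ∅
  · have := Finset.single_le_sum (fun T _ => hf0 T) (Finset.mem_univ (∅ : Finset (Fin k)))
    rw [h, Finset.card_empty]
    simpa [hitWeight, hempty] using this
  · have hT : f (hitCoords z e) = 2 * hitWeight x y (hitCoords z e).card := by
      have h1 : ∏ j ∈ hitCoords z e, (if e j ∈ vsupp z ∩ U j then (1 : ℝ) else 0) = 1 :=
        Finset.prod_eq_one fun j hj => if_pos (by
          rw [mem_hitCoords] at hj
          simp [vsupp, hj, he j])
      simp only [hf, h1, hitCoeff, Finset.card_eq_zero, h, if_false, mul_one]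
    calc _ = ∑ T ∈ {∅, hitCoords z e}, f T := by
          rw [Finset.sum_pair (Ne.symm h), hempty, hT]
      _ ≤ _ := Finset.sum_le_sum_of_subset_of_nonneg (Finset.subset_univ _) fun T _ _ => hf0 T

theorem sum_hitCoeff_mul_prod_le {x y : ℝ} (hx : 0 ≤ x) {c : Fin k → ℝ} (hc : ∀ j, 0 ≤ c j)
    (hxc : x * ∑ j, c j ≤ 1) :
    ∑ T : Finset (Fin k), hitCoeff x y T * ∏ j ∈ T, c j ≤
      1 + 2 * (x * ∑ j, c j) ^ 2 + 2 * y * ∑ j, c j := by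
  have hterm : ∀ T : Finset (Fin k), hitCoeff x y T * ∏ j ∈ T, c j =
      2 * (∏ j ∈ T, x * c j) - (if T = ∅ then 1 else 0) +
        (2 * y - 2 * x) * (if T.card = 1 then ∏ j ∈ T, c j else 0) := fun T => by
    rw [Finset.prod_mul_distrib, Finset.prod_const]
    rcases Nat.lt_trichotomy T.card 1 with h | h | h
    · rw [Nat.lt_one_iff, Finset.card_eq_zero] at h
      subst h
      simp [hitCoeff]
      norm_num
    · have h0 : T ≠ ∅ := fun h' => by simp [h'] at h
      simp only [hitCoeff, hitWeight, h, h0, if_true, if_false, one_ne_zero, pow_one]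
      ring
    · have h0 : T.card ≠ 0 := by omega
      have h1 : T.card ≠ 1 := by omega
      have h2 : T ≠ ∅ := fun h' => h0 (by simp [h'])
      simp only [hitCoeff, hitWeight, h0, h1, h2, if_false]
      ring
  have hone : ∑ T : Finset (Fin k), (if T.card = 1 then ∏ j ∈ T, c j else 0) = ∑ j, c j := by
    rw [← Finset.sum_filter, Finset.univ_filter_card_eq, Finset.powersetCard_one, Finset.sum_map]
    simp
  have hexp : ∑ T : Finset (Fin k), ∏ j ∈ T, x * c j ≤ Real.exp (x * ∑ j, c j) := by
    rw [← Finset.powerset_univ, ← Finset.prod_one_add, Finset.mul_sum, Real.exp_sum]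
    refine Finset.prod_le_prod (fun j _ => ?_) fun j _ => ?_
    · have := mul_nonneg hx (hc j)
      positivity
    · rw [add_comm]
      exact Real.add_one_le_exp _
  have hu : 0 ≤ x * ∑ j, c j := mul_nonneg hx (Finset.sum_nonneg fun j _ => hc j)
  have hquad := (abs_le.1 (Real.abs_exp_sub_one_sub_id_le (abs_le.2 ⟨by linarith, hxc⟩))).2
  rw [Finset.sum_congr rfl fun T _ => hterm T, Finset.sum_add_distrib, Finset.sum_sub_distrib,
    ← Finset.mul_sum, ← Finset.mul_sum, hone]
  simp only [Finset.sum_ite_eq', Finset.mem_univ, if_true]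
  nlinarith

theorem PseudoUniform.sum_event_mul_pow_le (hk : 1 ≤ k) {N : ℕ} [NeZero N]
    {U : Fin k → Finset Λ} {n m t : ℕ} (hn : 0 < n) (hUcard : ∀ i, (U i).card = n)
    (hUdisj : ∀ i j, i ≠ j → Disjoint (U i) (U j))
    {z : Λ → ZMod N} (hz : (vsupp z).card = t) {D : Finset (Fin k → Λ) → ℝ}
    (hD : PseudoUniform U m D) (i b : ℕ) {x y : ℝ} (hx : 0 ≤ x) (hy : 0 ≤ y)
    (hxt : x * (t / n) ≤ 1) :
    (∑ M ∈ (MM U m).filter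
        (fun M => (inSet M z).card = i ∧ (bdSet M z).card = b), D M) * (x ^ i * y ^ b) ≤
      Real.exp (m * (2 * (x * (t / n)) ^ 2 + 2 * y * (t / n))) := by
  set c : Fin k → ℝ := fun j => ((vsupp z ∩ U j).card : ℝ) / n with hc
  have hc0 : ∀ j, 0 ≤ c j := fun j => by positivity
  have hct : ∑ j, c j ≤ t / n := by
    rw [hc, ← Finset.sum_div, ← Nat.cast_sum, ← Finset.card_biUnion
      fun i _ j _ hij => (hUdisj i j hij).mono Finset.inter_subset_right Finset.inter_subset_right]
    gcongr
    rw [← hz]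
    exact Finset.card_le_card (Finset.biUnion_subset.2 fun j _ => Finset.inter_subset_left)
  have hct0 : 0 ≤ ∑ j, c j := Finset.sum_nonneg fun j _ => hc0 j
  have hpos : (0 : ℝ) < (MM U m).card := by
    have hne : (MM U m).Nonempty := by
      by_contra h
      rw [Finset.not_nonempty_iff_eq_empty] at h
      simpa [h] using hD.2.2.1
    exact_mod_cast hne.card_pos
  have hmatch : ∀ M ∈ MM U m, IsMatching U M := fun M hM => (Finset.mem_filter.1 hM).2.1
  have h1 := hD.sum_event_mul_le
    (fun M => (inSet M z).card = i ∧ (bdSet M z).card = b)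
    (fun e => (hitCoords z e).card ≠ 0)
    (ω := fun e => hitWeight x y (hitCoords z e).card)
    (fun e => hitWeight_nonneg hx hy _) (c := x ^ i * y ^ b) (by positivity)
    (fun M hM ⟨hi, hb⟩ => by
      have := (hmatch M hM).prod_hitWeight hUdisj z x y
      rw [hi, hb] at this
      exact this.ge)
  have h2 : ∑ M ∈ MM U m, ∏ e ∈ M, (1 + 2 * hitWeight x y (hitCoords z e).card) ≤
      (∑ T : Finset (Fin k), hitCoeff x y T * ∏ j ∈ T, c j) ^ m * (MM U m).card := by
    refine le_trans (Finset.sum_le_sum fun M hM => Finset.prod_le_prod (fun e _ => ?_)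
      fun e he => one_add_hitWeight_le hx hy ((hmatch M hM).1 e he) z)
      (sum_MM_prod_le hk hn hUcard (fun j => Finset.inter_subset_right) (hitCoeff_nonneg hx hy))
    have := hitWeight_nonneg hx hy (hitCoords z e).card
    positivity
  refine (le_of_mul_le_mul_right (h1.trans h2) hpos).trans ?_
  rw [Real.exp_nat_mul]
  refine pow_le_pow_left₀ (Finset.sum_nonneg fun T _ => mul_nonneg (hitCoeff_nonneg hx hy T)
    (Finset.prod_nonneg fun j _ => hc0 j)) ?_ m
  refine (sum_hitCoeff_mul_prod_le hx hc0
    ((mul_le_mul_of_nonneg_left hct hx).trans hxt)).trans ?_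
  refine le_trans ?_ (Real.add_one_le_exp _)
  have h3 : (x * ∑ j, c j) ^ 2 ≤ (x * (t / n)) ^ 2 :=
    pow_le_pow_left₀ (mul_nonneg hx hct0) (mul_le_mul_of_nonneg_left hct hx) 2
  have h4 : 2 * y * ∑ j, c j ≤ 2 * y * (t / n) :=
    mul_le_mul_of_nonneg_left hct (by positivity)
  linarith

theorem card_hitCoords_le {N : ℕ} (z : Λ → ZMod N) (e : Fin k → Λ) :
    (hitCoords z e).card ≤ k := by
  simpa using Finset.card_le_univ (hitCoords z e)

theorem IsMatching.card_inSet_le {N : ℕ} [NeZero N] {U : Fin k → Finset Λ}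
    (hU : ∀ i j, i ≠ j → Disjoint (U i) (U j)) {M : Finset (Fin k → Λ)} (hM : IsMatching U M)
    (z : Λ → ZMod N) : (inSet M z).card ≤ M.card * k := by
  rw [hM.card_inSet hU]
  calc _ ≤ (M.filter (fun e => 1 < (hitCoords z e).card)).card * k := by
        simpa using Finset.sum_le_card_nsmul _ _ k fun e _ => card_hitCoords_le z e
    _ ≤ M.card * k := Nat.mul_le_mul_right _ (Finset.card_filter_le _ _)

theorem IsMatching.card_bdSet_le {N : ℕ} [NeZero N] {U : Fin k → Finset Λ}
    (hU : ∀ i j, i ≠ j → Disjoint (U i) (U j)) {M : Finset (Fin k → Λ)} (hM : IsMatching U M)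
    (z : Λ → ZMod N) : (bdSet M z).card ≤ M.card := by
  rw [hM.card_bdSet hU]
  exact Finset.card_filter_le _ _

theorem rpow_half_eq_sqrt_pow {a : ℝ} (ha : 0 ≤ a) (i : ℕ) : a ^ ((i : ℝ) / 2) = √a ^ i := by
  rw [Real.sqrt_eq_rpow, ← Real.rpow_natCast, ← Real.rpow_mul ha]
  congr 1
  ring

theorem exp_mul_pow_mul_two_pow_le {k t i b : ℕ} (hk : 1 ≤ k) (hib : i + b ≤ t) :
    Real.exp (2 * i + t) * ((t : ℝ) * k / i) ^ i * 2 ^ b ≤ (24 * (k : ℝ) ^ 2) ^ t := by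
  have hk' : (1 : ℝ) ≤ k := by exact_mod_cast hk
  have hib' : (i : ℝ) + b ≤ t := by exact_mod_cast hib
  have hratio : ((t : ℝ) / i) ^ i ≤ Real.exp ((t : ℝ) - i) := by
    rcases Nat.eq_zero_or_pos i with rfl | hi
    · simp
    · have hi' : (0 : ℝ) < i := by exact_mod_cast hi
      have h : (t : ℝ) / i ≤ Real.exp ((t : ℝ) / i - 1) := by
        linarith [Real.add_one_le_exp ((t : ℝ) / i - 1)]
      calc ((t : ℝ) / i) ^ i ≤ Real.exp ((t : ℝ) / i - 1) ^ i := by gcongr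
        _ = Real.exp ((t : ℝ) - i) := by
          rw [← Real.exp_nat_mul]
          congr 1
          field_simp
  have htwo : (2 : ℝ) ^ b ≤ Real.exp b := by
    rw [← mul_one (b : ℝ), Real.exp_nat_mul]
    gcongr
    linarith [Real.add_one_le_exp (1 : ℝ)]
  have hthree : Real.exp 3 ≤ 24 := by
    have h := Real.exp_one_lt_d9
    have h3 : Real.exp 3 = Real.exp 1 ^ 3 := by rw [← Real.exp_nat_mul]; norm_num
    rw [h3]
    calc Real.exp 1 ^ 3 ≤ 2.7182818286 ^ 3 := by gcongr
      _ ≤ 24 := by norm_num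
  have hkpow : (k : ℝ) ^ i ≤ ((k : ℝ) ^ 2) ^ t := by
    rw [← pow_mul]
    exact pow_le_pow_right₀ hk' (by omega)
  calc Real.exp (2 * i + t) * ((t : ℝ) * k / i) ^ i * 2 ^ b
      = Real.exp (2 * i + t) * ((t : ℝ) / i) ^ i * 2 ^ b * (k : ℝ) ^ i := by
        rw [mul_div_right_comm, mul_pow]
        ring
    _ ≤ Real.exp (2 * i + t) * Real.exp ((t : ℝ) - i) * Real.exp b * ((k : ℝ) ^ 2) ^ t := by
        gcongr
    _ = Real.exp (2 * i + t + (t - i) + b) * ((k : ℝ) ^ 2) ^ t := by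
        simp only [Real.exp_add]
    _ ≤ Real.exp (t * 3) * ((k : ℝ) ^ 2) ^ t := by
        gcongr
        linarith
    _ ≤ 24 ^ t * ((k : ℝ) ^ 2) ^ t := by
        rw [Real.exp_nat_mul]
        gcongr
    _ = (24 * (k : ℝ) ^ 2) ^ t := (mul_pow _ _ _).symm

theorem PseudoUniform.sum_event_le_of_pos (hk : 1 ≤ k) {N : ℕ} [NeZero N]
    {U : Fin k → Finset Λ} {n m t i b : ℕ} (hm0 : 0 < m) (hm : m ≤ n)
    (hUcard : ∀ i, (U i).card = n) (hUdisj : ∀ i j, i ≠ j → Disjoint (U i) (U j))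
    (hib : i + b ≤ t) (hik : i ≤ m * k)
    {z : Λ → ZMod N} (hz : (vsupp z).card = t) {D : Finset (Fin k → Λ) → ℝ}
    (hD : PseudoUniform U m D) :
    (∑ M ∈ (MM U m).filter
        (fun M => (inSet M z).card = i ∧ (bdSet M z).card = b), D M) ≤
      (24 * (k : ℝ) ^ 2) ^ t * (((i : ℝ) * (m : ℝ)) / (n : ℝ) ^ 2) ^ ((i : ℝ) / 2)
        * ((m : ℝ) / (n : ℝ)) ^ b := by
  have hmR : (0 : ℝ) < m := by exact_mod_cast hm0
  have hnR : (0 : ℝ) < n := by exact_mod_cast hm0.trans_le hm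
  have hk' : (1 : ℝ) ≤ k := by exact_mod_cast hk
  have hkR : (0 : ℝ) < k := by linarith
  have hikR : (i : ℝ) ≤ m * k := by exact_mod_cast hik
  have hsm : (0 : ℝ) < √m := Real.sqrt_pos.2 hmR
  set x : ℝ := n * √i / (t * √m * k) with hxdef
  set y : ℝ := n / (2 * m) with hydef
  have hx : 0 ≤ x := by positivity
  have hy : 0 < y := by positivity
  have hxt : x * (t / n) ≤ √i / (√m * k) := by
    rcases Nat.eq_zero_or_pos t with rfl | ht
    · simp
      positivity
    · have htR : (0 : ℝ) < t := by exact_mod_cast ht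
      refine le_of_eq ?_
      rw [hxdef]
      field_simp
  have hratio : (√i / (√m * k)) ^ 2 = i / (m * k ^ 2) := by
    rw [div_pow, mul_pow, Real.sq_sqrt hmR.le, Real.sq_sqrt (Nat.cast_nonneg i)]
  have hxt0 : 0 ≤ x * (t / n) := by positivity
  have hsq : (x * (t / n)) ^ 2 ≤ i / (m * k ^ 2) := by
    rw [← hratio]
    gcongr
  have hxt1 : x * (t / n) ≤ 1 := by
    refine (sq_le_one_iff₀ hxt0).1 (hsq.trans ?_)
    rw [div_le_one (by positivity)]
    nlinarith
  have hmain := hD.sum_event_mul_pow_le hk (hm0.trans_le hm) hUcard hUdisj hz i b hx hy.le hxt1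
  have hexp : (m : ℝ) * (2 * (x * (t / n)) ^ 2 + 2 * y * (t / n)) ≤ 2 * i + t := by
    have h1 : (m : ℝ) * (2 * y * (t / n)) = t := by
      rw [hydef]
      field_simp
    have h2 : (m : ℝ) * (i / (m * k ^ 2)) ≤ i := by
      have : (m : ℝ) * (i / (m * k ^ 2)) = i / k ^ 2 := by field_simp
      rw [this]
      exact div_le_self (Nat.cast_nonneg i) (one_le_pow₀ hk')
    nlinarith
  have hxpow : 0 < x ^ i := by
    rcases Nat.eq_zero_or_pos i with rfl | hi
    · simp
    · have hiR : (0 : ℝ) < i := by exact_mod_cast hi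
      have htR : (0 : ℝ) < t := by exact_mod_cast (show 0 < t by omega)
      positivity
  have hcancel : ((t : ℝ) * k / i) ^ i * 2 ^ b *
      (√((i : ℝ) * m / n ^ 2) ^ i * (m / n) ^ b * (x ^ i * y ^ b)) = 1 := by
    have hyb : (2 : ℝ) ^ b * ((m / n) ^ b * y ^ b) = 1 := by
      rw [← mul_pow, ← mul_pow, hydef]
      have : (2 : ℝ) * (m / n * (n / (2 * m))) = 1 := by field_simp
      rw [this, one_pow]
    have hxi : ((t : ℝ) * k / i) ^ i * (√((i : ℝ) * m / n ^ 2) ^ i * x ^ i) = 1 := by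
      rcases Nat.eq_zero_or_pos i with rfl | hi
      · simp
      · have hiR : (0 : ℝ) < i := by exact_mod_cast hi
        have htR : (0 : ℝ) < t := by exact_mod_cast (show 0 < t by omega)
        rw [← mul_pow, ← mul_pow, Real.sqrt_div' _ (by positivity), Real.sqrt_sq hnR.le,
          Real.sqrt_mul hiR.le, hxdef]
        have : (t : ℝ) * k / i * (√i * √m / n * (n * √i / (t * √m * k))) = √i * √i / i := by
          field_simp
        rw [this, Real.mul_self_sqrt hiR.le, div_self hiR.ne', one_pow]
    calc _ = (((t : ℝ) * k / i) ^ i * (√((i : ℝ) * m / n ^ 2) ^ i * x ^ i)) *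
          ((2 : ℝ) ^ b * ((m / n) ^ b * y ^ b)) := by ring
      _ = 1 := by rw [hyb, hxi, one_mul]
  rw [rpow_half_eq_sqrt_pow (by positivity)]
  refine le_of_mul_le_mul_right ?_ (mul_pos hxpow (pow_pos hy b))
  set R : ℝ := √((i : ℝ) * m / n ^ 2) ^ i * (m / n) ^ b * (x ^ i * y ^ b) with hR
  have hR0 : 0 ≤ R := by positivity
  calc _ ≤ Real.exp (2 * i + t) := hmain.trans (Real.exp_le_exp.2 hexp)
    _ = Real.exp (2 * i + t) * ((t : ℝ) * k / i) ^ i * 2 ^ b * R := by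
        rw [mul_assoc, mul_assoc, ← mul_assoc (((t : ℝ) * k / i) ^ i), hcancel, mul_one]
    _ ≤ (24 * (k : ℝ) ^ 2) ^ t * R :=
        mul_le_mul_of_nonneg_right (exp_mul_pow_mul_two_pow_le hk hib) hR0
    _ = _ := by
        rw [hR]
        ring

/-- For a pseudo-uniform distribution `D` on `M_{U,m}` and `‖z‖_H = t`, the probability
that `|in_{M,z}| = i` and `|bd_{M,z}| = b` is at most
`(24k²)^t · (i·m/|U|²)^{i/2} · (m/|U|)^b`. -/
theorem stmt5 (hk : 1 ≤ k) (N : ℕ) [NeZero N] (hN : 2 ≤ N)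
    (U : Fin k → Finset Λ) (n : ℕ)
    (hUcard : ∀ i, (U i).card = n)
    (hUdisj : ∀ i j, i ≠ j → Disjoint (U i) (U j))
    (m : ℕ) (hm : m ≤ n)
    (t i b : ℕ) (hib : i + b ≤ t)
    (z : Λ → ZMod N) (hz : (vsupp z).card = t)
    (D : Finset (Fin k → Λ) → ℝ) (hD : PseudoUniform U m D) :
    (∑ M ∈ (MM U m).filter
        (fun M => (inSet M z).card = i ∧ (bdSet M z).card = b), D M) ≤
      (24 * (k : ℝ) ^ 2) ^ t * (((i : ℝ) * (m : ℝ)) / (n : ℝ) ^ 2) ^ ((i : ℝ) / 2)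
        * ((m : ℝ) / (n : ℝ)) ^ b := by
  by_cases hne : ((MM U m).filter
      (fun M => (inSet M z).card = i ∧ (bdSet M z).card = b)).Nonempty
  · obtain ⟨M, hM⟩ := hne
    simp only [MM, Finset.mem_filter, Finset.mem_univ, true_and] at hM
    obtain ⟨⟨hM, hMm⟩, hi, hb⟩ := hM
    have hik := hM.card_inSet_le hUdisj z
    have hbm := hM.card_bdSet_le hUdisj z
    rw [hi, hMm] at hik
    rw [hb, hMm] at hbm
    rcases Nat.eq_zero_or_pos m with rfl | hm0
    · obtain rfl : i = 0 := by simpa using hik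
      obtain rfl : b = 0 := by simpa using hbm
      have hk' : (1 : ℝ) ≤ k := by exact_mod_cast hk
      have h1 : (1 : ℝ) ≤ (24 * (k : ℝ) ^ 2) ^ t := one_le_pow₀ (by nlinarith)
      refine le_trans ?_ (le_of_le_of_eq h1 (by simp))
      rw [← hD.2.2.1]
      exact Finset.sum_le_sum_of_subset_of_nonneg (Finset.filter_subset _ _)
        fun M _ _ => hD.1 M
    · exact hD.sum_event_le_of_pos hk hm0 hm hUcard hUdisj hib hik hz
  · rw [Finset.not_nonempty_iff_eq_empty.1 hne, Finset.sum_empty]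
    positivity
end

section
/- Let V_1,…,V_t be pairwise disjoint finite sets with |V_i| ≥ 2 for every i ∈ [t]. Then for every integer ℓ ≥ 2, the number of subsets S ⊆ V_1 ∪ … ∪ V_t with |S| = ℓ such that |S ∩ V_i| ≠ 1 for every i ∈ [t] is at most ((20/ℓ)·(|V_1|² + … + |V_t|²))^{ℓ/2}. -/
open Finset

/-- The elementary inequality `exp y ≤ y + exp (y ^ 2)` on the nonnegative reals. -/
theorem Real.exp_le_add_exp_sq {y : ℝ} (hy : 0 ≤ y) : Real.exp y ≤ y + Real.exp (y ^ 2) := by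
  rcases le_total y 1 with h | h
  · have h1 := (abs_le.1 (Real.abs_exp_sub_one_sub_id_le (abs_le.2 ⟨by linarith, h⟩))).2
    linarith [Real.add_one_le_exp (y ^ 2)]
  · have : Real.exp y ≤ Real.exp (y ^ 2) := Real.exp_le_exp.2 (by nlinarith)
    linarith

/-- The size generating function of the subsets of `A` that are not singletons. -/
theorem Finset.sum_pow_card_filter_card_ne_one {α : Type*} [DecidableEq α] (A : Finset α) (x : ℝ) :
    ∑ T ∈ A.powerset.filter (fun T => T.card ≠ 1), x ^ T.card =
      (x + 1) ^ A.card - A.card * x := by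
  have h1 : ∑ T ∈ A.powerset, x ^ T.card = (x + 1) ^ A.card := by
    simpa using Finset.sum_pow_mul_eq_add_pow x 1 A
  have h2 : ∑ T ∈ A.powerset.filter (fun T => T.card = 1), x ^ T.card = A.card * x := by
    rw [Finset.sum_congr rfl (g := fun _ => x) (fun T hT => by rw [(mem_filter.1 hT).2, pow_one]),
      ← Finset.powersetCard_eq_filter]
    simp
  have h3 := Finset.sum_filter_add_sum_filter_not A.powerset (fun T => T.card = 1)
    (fun T => x ^ T.card)
  linarith

theorem Finset.sum_pow_card_filter_card_ne_one_le {α : Type*} [DecidableEq α] (A : Finset α)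
    {x : ℝ} (hx : 0 ≤ x) :
    ∑ T ∈ A.powerset.filter (fun T => T.card ≠ 1), x ^ T.card ≤
      Real.exp (x ^ 2 * (A.card : ℝ) ^ 2) := by
  rw [Finset.sum_pow_card_filter_card_ne_one]
  have h1 : (x + 1) ^ A.card ≤ Real.exp (A.card * x) := by
    rw [Real.exp_nat_mul]
    exact pow_le_pow_left₀ (by positivity) (Real.add_one_le_exp x) _
  have h2 := Real.exp_le_add_exp_sq (y := A.card * x) (by positivity)
  rw [mul_pow, mul_comm ((A.card : ℝ) ^ 2)] at h2
  linarith

/-- Chernoff-type bound for the size of a family of `ℓ`-element subsets of a disjoint union, each of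
which meets no part in exactly one element. -/
theorem Finset.card_mul_pow_le_exp_of_card_inter_ne_one {α ι : Type*} [DecidableEq α] [Fintype ι]
    [DecidableEq ι] (V : ι → Finset α) (hdisj : ∀ i j, i ≠ j → Disjoint (V i) (V j)) (ℓ : ℕ)
    (F : Finset (Finset α))
    (hmem : ∀ S ∈ F, S ⊆ Finset.univ.biUnion V ∧ S.card = ℓ ∧ ∀ i, (S ∩ V i).card ≠ 1)
    {x : ℝ} (hx : 0 ≤ x) :
    (F.card : ℝ) * x ^ ℓ ≤ Real.exp (x ^ 2 * ∑ i, ((V i).card : ℝ) ^ 2) := by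
  have hunion : ∀ S ∈ F, Finset.univ.biUnion (fun i => S ∩ V i) = S := by
    intro S hS
    rw [← Finset.inter_biUnion]
    exact inter_eq_left.2 (hmem S hS).1
  have hinj : Set.InjOn (fun (S : Finset α) (i : ι) => S ∩ V i) F := by
    intro S hS T hT h
    rw [← hunion S hS, ← hunion T hT]
    exact congrArg (fun p : ι → Finset α => Finset.univ.biUnion p) h
  have hcardprod : ∀ S ∈ F, ∏ i, x ^ (S ∩ V i).card = x ^ ℓ := by
    intro S hS
    rw [Finset.prod_pow_eq_pow_sum, ← (hmem S hS).2.1, ← Finset.card_biUnion, hunion S hS]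
    intro i _ j _ hij
    exact (hdisj i j hij).mono inter_subset_right inter_subset_right
  calc (F.card : ℝ) * x ^ ℓ = ∑ S ∈ F, ∏ i, x ^ (S ∩ V i).card := by
        rw [Finset.sum_congr rfl hcardprod, Finset.sum_const, nsmul_eq_mul]
    _ = ∑ p ∈ F.image (fun S i => S ∩ V i), ∏ i, x ^ (p i).card := by
        rw [Finset.sum_image hinj]
    _ ≤ ∑ p ∈ Fintype.piFinset (fun i => (V i).powerset.filter (fun T => T.card ≠ 1)),
          ∏ i, x ^ (p i).card := by
        refine Finset.sum_le_sum_of_subset_of_nonneg ?_ (fun _ _ _ => by positivity)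
        intro p hp
        obtain ⟨S, hS, rfl⟩ := mem_image.1 hp
        refine Fintype.mem_piFinset.2 fun i => mem_filter.2 ⟨?_, (hmem S hS).2.2 i⟩
        exact mem_powerset.2 inter_subset_right
    _ = ∏ i, ∑ T ∈ (V i).powerset.filter (fun T => T.card ≠ 1), x ^ T.card := by
        rw [Finset.prod_univ_sum]
    _ ≤ ∏ i, Real.exp (x ^ 2 * ((V i).card : ℝ) ^ 2) :=
        Finset.prod_le_prod (fun _ _ => Finset.sum_nonneg fun _ _ => by positivity)
          fun i _ => Finset.sum_pow_card_filter_card_ne_one_le (V i) hx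
    _ = Real.exp (x ^ 2 * ∑ i, ((V i).card : ℝ) ^ 2) := by
        rw [← Real.exp_sum, Finset.mul_sum]

theorem stmt6 {α : Type*} [DecidableEq α] (t : ℕ) (V : Fin t → Finset α)
    (hdisj : ∀ i j, i ≠ j → Disjoint (V i) (V j)) (hcard : ∀ i, 2 ≤ (V i).card)
    (ℓ : ℕ) (hℓ : 2 ≤ ℓ) :
    ((((Finset.univ.biUnion V).powerset).filter
        (fun S => S.card = ℓ ∧ ∀ i, (S ∩ V i).card ≠ 1)).card : ℝ) ≤
      ((20 / (ℓ : ℝ)) * ∑ i, ((V i).card : ℝ) ^ 2) ^ ((ℓ : ℝ) / 2) := by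
  have hℓ0 : (0 : ℝ) < ℓ := by exact_mod_cast (by omega : 0 < ℓ)
  rcases Nat.eq_zero_or_pos t with rfl | ht
  · rw [Finset.filter_false_of_mem]
    · simp only [card_empty, Nat.cast_zero]
      positivity
    · rintro S hS ⟨hS', -⟩
      have : S = ∅ := by simpa using hS
      simp [this] at hS'
      omega
  have hQ : 0 < ∑ i, ((V i).card : ℝ) ^ 2 := by
    refine Finset.sum_pos (fun i _ => ?_) ⟨⟨0, ht⟩, mem_univ _⟩
    have : (0 : ℝ) < (V i).card := by exact_mod_cast (by have := hcard i; omega : 0 < (V i).card)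
    positivity
  have hmain := Finset.card_mul_pow_le_exp_of_card_inter_ne_one V hdisj ℓ
    (((Finset.univ.biUnion V).powerset).filter
      (fun S => S.card = ℓ ∧ ∀ i, (S ∩ V i).card ≠ 1))
    (fun S hS => by simpa only [mem_filter, mem_powerset] using hS)
    (Real.sqrt_nonneg (ℓ / (2 * ∑ i, ((V i).card : ℝ) ^ 2)))
  generalize (∑ i, ((V i).card : ℝ) ^ 2) = Q at hQ hmain ⊢
  have hpow : Real.sqrt (ℓ / (2 * Q)) ^ ℓ = (ℓ / (2 * Q)) ^ ((ℓ : ℝ) / 2) := by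
    rw [Real.sqrt_eq_rpow, ← Real.rpow_mul_natCast (by positivity)]
    congr 1
    ring
  have hexp : Real.exp (ℓ / (2 * Q) * Q) = Real.exp 1 ^ ((ℓ : ℝ) / 2) := by
    rw [← Real.exp_mul]
    congr 1
    field_simp
  rw [hpow, Real.sq_sqrt (by positivity), hexp] at hmain
  refine le_of_mul_le_mul_right (hmain.trans ?_)
    (Real.rpow_pos_of_pos (show 0 < ℓ / (2 * Q) by positivity) ((ℓ : ℝ) / 2))
  rw [← Real.mul_rpow (by positivity) (by positivity)]
  refine Real.rpow_le_rpow (by positivity) ?_ (by positivity)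
  have : 20 / (ℓ : ℝ) * Q * (ℓ / (2 * Q)) = 10 := by
    field_simp
    norm_num
  rw [this]
  linarith [Real.exp_one_lt_d9]
end

section
/- For t ≥ 1 and real numbers a_1,…,a_t, let P = (a_1·X_1 + … + a_t·X_t)^ℓ be the ℓ-th power of the linear form in the polynomial ring ℝ[X_1,…,X_t], and let SF(P) denote the sum of the coefficients of all singleton-free monomials of P, i.e., the sum of coeff(P, d) over all exponent vectors d with d_i ≠ 1 for every i ∈ [t]. Then for every integer ℓ ≥ 2, SF((a_1·X_1 + … + a_t·X_t)^ℓ) ≤ (2ℓ·(a_1² + … + a_t²))^{ℓ/2}. -/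
open Finset

theorem exp_sub_self_le_exp_sq {x : ℝ} (hx : 0 ≤ x) : Real.exp x - x ≤ Real.exp (x ^ 2) := by
  rcases le_total x 1 with h | h
  · have h1 := (abs_le.mp (Real.abs_exp_sub_one_sub_id_le (abs_le.mpr ⟨by linarith, h⟩))).2
    linarith [Real.add_one_le_exp (x ^ 2)]
  · have : Real.exp x ≤ Real.exp (x ^ 2) := Real.exp_le_exp.mpr (by nlinarith)
    linarith

theorem sum_erase_one_pow_div_factorial_le {x : ℝ} (hx : 0 ≤ x) {n : ℕ} (hn : 2 ≤ n) :
    ∑ k ∈ (range n).erase 1, x ^ k / (k.factorial : ℝ) ≤ Real.exp (x ^ 2) := by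
  have h := Finset.add_sum_erase (range n) (fun k => x ^ k / (k.factorial : ℝ))
    (a := 1) (by simp; omega)
  have h2 := Real.sum_le_exp_of_nonneg hx n
  have h3 := exp_sub_self_le_exp_sq hx
  simp only [pow_one, Nat.factorial_one, Nat.cast_one, div_one] at h
  linarith

theorem coeff_linearForm_pow {t : ℕ} (a : Fin t → ℝ) (l : ℕ) (d : Fin t →₀ ℕ) :
    MvPolynomial.coeff d ((∑ i, MvPolynomial.C (a i) * MvPolynomial.X i) ^ l) =
      if ∑ i, d i = l then (l.factorial : ℝ) * ∏ i, a i ^ d i / ((d i).factorial : ℝ) else 0 := by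
  have key : ∀ k : Fin t → ℕ,
      ((Nat.multinomial univ k : ℕ) : MvPolynomial (Fin t) ℝ) *
        ∏ i, (MvPolynomial.C (a i) * MvPolynomial.X i) ^ k i =
      MvPolynomial.monomial (Finsupp.equivFunOnFinite.symm k)
        ((Nat.multinomial univ k : ℝ) * ∏ i, a i ^ k i) := by
    intro k
    rw [MvPolynomial.monomial_eq, Finsupp.prod_fintype _ _ (by simp)]
    simp [mul_pow, prod_mul_distrib, mul_assoc]
  rw [Finset.sum_pow_eq_sum_piAntidiag, MvPolynomial.coeff_sum]
  simp_rw [key, MvPolynomial.coeff_monomial, Equiv.symm_apply_eq]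
  rw [Finset.sum_ite_eq']
  simp only [mem_piAntidiag, Finsupp.equivFunOnFinite_apply]
  by_cases h : ∑ i, d i = l
  · have hs : ((∏ i, (d i).factorial : ℕ) : ℝ) * (Nat.multinomial univ d : ℝ) = l.factorial := by
      rw [← h]
      exact_mod_cast Nat.multinomial_spec univ d
    rw [if_pos h, if_pos (by simpa using h), ← hs, prod_div_distrib]
    have : (∏ i, ((d i).factorial : ℝ)) ≠ 0 :=
      prod_ne_zero_iff.mpr fun i _ => by positivity
    push_cast
    field_simp
    exact mul_comm _ _
  · rw [if_neg h, if_neg (fun hh => h (by simpa using hh.1))]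

theorem sum_singletonFree_coeff_mul_pow_le {t : ℕ} (a : Fin t → ℝ) {l : ℕ} (hl : 2 ≤ l)
    {z : ℝ} (hz : 0 ≤ z) {P : MvPolynomial (Fin t) ℝ}
    (hP : P = (∑ i, MvPolynomial.C (a i) * MvPolynomial.X i) ^ l) :
    (∑ d ∈ P.support.filter (fun d => ∀ i, d i ≠ 1), MvPolynomial.coeff d P) * z ^ l ≤
      l.factorial * (Real.exp (z ^ 2 * ∑ i, a i ^ 2) - 1) := by
  set w : (Fin t → ℕ) → ℝ := fun k => ∏ i, (|a i| * z) ^ k i / ((k i).factorial : ℝ) with hw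
  have hw0 : ∀ k, 0 ≤ w k := fun k => prod_nonneg fun i _ => by positivity
  set B : Finset (Fin t → ℕ) := Fintype.piFinset fun _ => (range (l + 1)).erase 1 with hB
  have hdeg : ∀ d ∈ P.support, ∑ i, d i = l := by
    intro d hd
    rw [MvPolynomial.mem_support_iff, hP, coeff_linearForm_pow] at hd
    by_contra h
    exact hd (if_neg h)
  have hterm : ∀ d ∈ P.support, MvPolynomial.coeff d P * z ^ l ≤ l.factorial * w d := by
    intro d hd
    have hdl := hdeg d hd
    rw [hP, coeff_linearForm_pow, if_pos hdl, mul_assoc]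
    refine mul_le_mul_of_nonneg_left ?_ (by positivity)
    rw [← hdl, ← prod_pow_eq_pow_sum, ← prod_mul_distrib]
    refine (le_abs_self _).trans ?_
    rw [abs_prod]
    refine (prod_congr rfl fun i _ => ?_).le
    rw [abs_mul, abs_div, abs_pow, abs_pow, abs_of_nonneg hz, Nat.abs_cast, mul_pow]
    ring
  have hB0 : (0 : Fin t → ℕ) ∈ B := by simp [hB]
  have hsum : ∑ d ∈ P.support.filter (fun d => ∀ i, d i ≠ 1), w d ≤ ∑ k ∈ B.erase 0, w k := by
    rw [← sum_image (f := w) (g := fun d : Fin t →₀ ℕ => (d : Fin t → ℕ))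
      (DFunLike.coe_injective.injOn)]
    refine sum_le_sum_of_subset_of_nonneg ?_ fun k _ _ => hw0 k
    intro k hk
    obtain ⟨d, hd, rfl⟩ := mem_image.mp hk
    obtain ⟨hd, h1⟩ := mem_filter.mp hd
    have hdl := hdeg d hd
    refine mem_erase.mpr ⟨fun h => ?_, Fintype.mem_piFinset.mpr fun i => ?_⟩
    · simp only [h, Pi.zero_apply, sum_const_zero] at hdl
      omega
    · have := single_le_sum (f := fun i => d i) (fun _ _ => Nat.zero_le _) (mem_univ i)
      exact mem_erase.mpr ⟨h1 i, mem_range.mpr (by omega)⟩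
  have hall : ∑ k ∈ B, w k ≤ Real.exp (z ^ 2 * ∑ i, a i ^ 2) := by
    rw [hB, hw, ← prod_univ_sum (fun _ => (range (l + 1)).erase 1)
      (fun i k => (|a i| * z) ^ k / (k.factorial : ℝ)), mul_sum, Real.exp_sum]
    refine prod_le_prod (fun i _ => sum_nonneg fun k _ => by positivity) fun i _ => ?_
    refine (sum_erase_one_pow_div_factorial_le (by positivity) (by omega)).trans_eq ?_
    rw [mul_pow, sq_abs, mul_comm]
  have hzero : w 0 = 1 := by simp [hw]
  have hsplit := add_sum_erase B w hB0
  calc _ = ∑ d ∈ P.support.filter (fun d => ∀ i, d i ≠ 1), MvPolynomial.coeff d P * z ^ l :=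
        sum_mul ..
    _ ≤ ∑ d ∈ P.support.filter (fun d => ∀ i, d i ≠ 1), l.factorial * w d :=
        sum_le_sum fun d hd => hterm d (mem_filter.mp hd).1
    _ = l.factorial * ∑ d ∈ P.support.filter (fun d => ∀ i, d i ≠ 1), w d := (mul_sum ..).symm
    _ ≤ _ := mul_le_mul_of_nonneg_left (by linarith) (by positivity)

theorem factorial_mul_exp_half_le {l : ℕ} (hl : 3 ≤ l) :
    (l.factorial : ℝ) * Real.exp (1 / 2) ^ l ≤ (l : ℝ) ^ l := by
  have hq : Real.exp (1 / 2) ^ 2 = Real.exp 1 := by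
    rw [← Real.exp_nat_mul]
    norm_num
  have he := Real.exp_one_lt_d9
  have hpos := Real.exp_pos (1 / 2)
  have hub : Real.exp (1 / 2) ≤ 1.6488 := by nlinarith
  induction l, hl using Nat.le_induction with
  | base =>
    norm_num [Nat.factorial, pow_succ] at *
    nlinarith
  | succ n hn ih =>
    have hb : 2 * (n : ℝ) ^ n ≤ ((n : ℝ) + 1) ^ n := by
      have hn0 : (0 : ℝ) < n := by positivity
      have h := one_add_mul_le_pow (a := 1 / (n : ℝ))
        (by have : 0 ≤ 1 / (n : ℝ) := by positivity
            linarith) n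
      have h2 : ((n : ℝ) + 1) = n * (1 + 1 / n) := by field_simp
      have h3 : (1 : ℝ) + n * (1 / n) = 2 := by field_simp; norm_num
      rw [h2, mul_pow, mul_comm 2]
      exact mul_le_mul_of_nonneg_left (by linarith) (by positivity)
    rw [Nat.factorial_succ, pow_succ, pow_succ]
    push_cast
    calc ((n : ℝ) + 1) * n.factorial * (Real.exp (1 / 2) ^ n * Real.exp (1 / 2))
        = (n.factorial * Real.exp (1 / 2) ^ n) * Real.exp (1 / 2) * (n + 1) := by ring
      _ ≤ (n : ℝ) ^ n * 2 * (n + 1) := by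
          gcongr
          linarith
      _ ≤ _ := by
          gcongr
          linarith

theorem factorial_mul_exp_half_sub_one_le {l : ℕ} (hl : 2 ≤ l) :
    (l.factorial : ℝ) * (Real.exp (l / 2) - 1) ≤ (l : ℝ) ^ l := by
  rcases hl.eq_or_lt with rfl | h
  · have he := Real.exp_one_lt_d9
    norm_num [Nat.factorial]
    linarith
  · have := factorial_mul_exp_half_le h
    rw [← Real.exp_nat_mul, mul_one_div] at this
    have h0 : (0 : ℝ) ≤ l.factorial := by positivity
    linarith

theorem stmt7 (t : ℕ) (ht : 1 ≤ t) (a : Fin t → ℝ) (ℓ : ℕ) (hℓ : 2 ≤ ℓ)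
    (P : MvPolynomial (Fin t) ℝ)
    (hP : P = (∑ i, MvPolynomial.C (a i) * MvPolynomial.X i) ^ ℓ) :
    (∑ d ∈ P.support.filter (fun d => ∀ i, d i ≠ 1), MvPolynomial.coeff d P) ≤
      (2 * (ℓ : ℝ) * ∑ i, a i ^ 2) ^ ((ℓ : ℝ) / 2) := by
  have hS0 : 0 ≤ ∑ i, a i ^ 2 := sum_nonneg fun i _ => sq_nonneg _
  have hl0 : (0 : ℝ) < ℓ := by positivity
  rcases hS0.eq_or_lt with hS | hS
  · have ha : ∀ i, a i = 0 := fun i => by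
      simpa using (sum_eq_zero_iff_of_nonneg fun i _ => sq_nonneg (a i)).mp hS.symm i (mem_univ i)
    have hP0 : P = 0 := by
      rw [hP]
      simp only [ha, map_zero, zero_mul, sum_const_zero]
      exact zero_pow (by omega)
    rw [hP0]
    simp only [MvPolynomial.coeff_zero, sum_const_zero]
    positivity
  · set S := ∑ i, a i ^ 2
    set z := √(ℓ / (2 * S)) with hz
    have hzpos : 0 < z := Real.sqrt_pos.mpr (by positivity)
    have hz2 : z ^ 2 = ℓ / (2 * S) := Real.sq_sqrt (by positivity)
    have h := sum_singletonFree_coeff_mul_pow_le a hℓ hzpos.le hP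
    have hexp : z ^ 2 * S = ℓ / 2 := by
      rw [hz2]
      field_simp
    have hroot : (2 * (ℓ : ℝ) * S) ^ ((ℓ : ℝ) / 2) * z ^ ℓ = (ℓ : ℝ) ^ ℓ := by
      have hsq : √(2 * ℓ * S) * z = ℓ := by
        rw [hz, ← Real.sqrt_mul (by positivity)]
        rw [show 2 * (ℓ : ℝ) * S * (ℓ / (2 * S)) = ℓ ^ 2 by field_simp]
        exact Real.sqrt_sq hl0.le
      rw [show (ℓ : ℝ) / 2 = 1 / 2 * ℓ by ring, Real.rpow_mul (by positivity),
        ← Real.sqrt_eq_rpow, Real.rpow_natCast, ← mul_pow, hsq]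
    refine le_of_mul_le_mul_right ?_ (pow_pos hzpos ℓ)
    rw [hroot]
    refine h.trans ?_
    rw [hexp]
    exact factorial_mul_exp_half_sub_one_le hℓ
end

section
/- Let k ≥ 2 and let d, t, r be positive integers with r ≥ t. Let (V, E) be a k-uniform hypergraph with m hyperedges such that every hyperedge is incident to at most d other hyperedges. Then the number of subsets E' ⊆ E with |E'| = r such that the hypergraph (V, E') has exactly t nontrivial connected components is at most (6d)^r · (3m/t)^t. -/
open Finset

variable {V : Type*} [Fintype V] [DecidableEq V]

/-- The simple graph associated to a `k`-uniform hypergraph: distinct vertices are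
adjacent iff some hyperedge contains both. -/
def hGraph {k : ℕ} (E : Finset (Fin k → V)) : SimpleGraph V :=
  SimpleGraph.fromRel (fun u v => ∃ e ∈ E, ∃ i j : Fin k, e i = u ∧ e j = v)

/-- A connected component is nontrivial if it contains at least two vertices. -/
def NontrivComp {k : ℕ} (E : Finset (Fin k → V)) (c : (hGraph E).ConnectedComponent) : Prop :=
  ∃ u v : V, u ≠ v ∧ (hGraph E).connectedComponentMk u = c ∧
    (hGraph E).connectedComponentMk v = c

/-- The number of nontrivial connected components of a hypergraph. -/
noncomputable def ntCount {k : ℕ} (E : Finset (Fin k → V)) : ℕ :=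
  Nat.card {c : (hGraph E).ConnectedComponent // NontrivComp E c}

/-- The sum of the binomial weights `p ^ #W * q ^ (#E - #W)` with `p + q = 1` over the sets `W`
with `A ⊆ W ⊆ E` that avoid `B`. -/
lemma sum_binomial_weights_avoiding {α : Type*} [DecidableEq α] {E A B : Finset α} (hA : A ⊆ E)
    (hB : B ⊆ E) (hAB : Disjoint A B) {p q : ℝ} (hpq : p + q = 1) :
    ∑ W ∈ Finset.Icc A (E \ B), p ^ #W * q ^ (#E - #W) = p ^ #A * q ^ #B := by
  have hsub : A ⊆ E \ B := Finset.subset_sdiff.2 ⟨hA, hAB⟩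
  rw [Finset.Icc_eq_image_powerset hsub, Finset.sum_image]
  · have hcard : #((E \ B) \ A) + #A + #B = #E := by
      rw [Finset.card_sdiff_add_card_eq_card hsub, Finset.card_sdiff_add_card_eq_card hB]
    have hterm : ∀ U ∈ ((E \ B) \ A).powerset, p ^ #(A ∪ U) * q ^ (#E - #(A ∪ U)) =
        p ^ #A * q ^ #B * (p ^ #U * q ^ (#((E \ B) \ A) - #U)) := by
      intro U hU
      rw [Finset.mem_powerset] at hU
      have hle := Finset.card_le_card hU
      rw [Finset.card_union_of_disjoint (Finset.disjoint_of_subset_right hU Finset.disjoint_sdiff),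
        show #E - (#A + #U) = #B + (#((E \ B) \ A) - #U) by omega, pow_add, pow_add]
      ring
    rw [Finset.sum_congr rfl hterm, ← Finset.mul_sum, Finset.sum_pow_mul_eq_add_pow, hpq, one_pow,
      mul_one]
  · intro U hU U' hU' h
    simp only [Finset.coe_powerset, Set.mem_preimage, Set.mem_powerset_iff, Finset.coe_subset]
      at hU hU'
    have hd := Finset.disjoint_of_subset_right hU Finset.disjoint_sdiff
    have hd' := Finset.disjoint_of_subset_right hU' Finset.disjoint_sdiff
    rw [← Finset.union_sdiff_cancel_left hd, ← Finset.union_sdiff_cancel_left hd']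
    exact congrArg (· \ A) h

/-- Every element of `A` is reachable from `S` along the relation `R` inside `A`, phrased as: the
only subset of `A` that contains `S` and is closed under `R` is `A` itself. -/
def ReachableFrom {α : Type*} (R : α → α → Prop) (S A : Finset α) : Prop :=
  S ⊆ A ∧ ∀ T ⊆ A, S ⊆ T → (∀ e ∈ T, ∀ f ∈ A, R e f → f ∈ T) → A ⊆ T

open Classical in
/-- The elements of `E` outside `A` that are related to an element of `A`. -/
noncomputable def outerBoundary {α : Type*} (R : α → α → Prop) (E A : Finset α) : Finset α :=
  {f ∈ E | f ∉ A ∧ ∃ e ∈ A, R e f}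

lemma ReachableFrom.subset_of_separated {α : Type*} {R : α → α → Prop} {E S A B W : Finset α}
    (hA : ReachableFrom R S A) (hB : ReachableFrom R S B) (hWE : W ⊆ E) (hAW : A ⊆ W)
    (hBW : Disjoint W (outerBoundary R E B)) : A ⊆ B := by
  classical
  refine (hA.2 (A ∩ B) Finset.inter_subset_left (Finset.subset_inter hA.1 hB.1) ?_).trans
    Finset.inter_subset_right
  intro e he f hf hef
  rw [Finset.mem_inter] at he ⊢
  refine ⟨hf, by_contra fun hfB => Finset.disjoint_left.1 hBW (hAW hf) ?_⟩
  simp only [outerBoundary, Finset.mem_filter]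
  exact ⟨hWE (hAW hf), hfB, e, he.2, hef⟩

open Classical in
lemma card_outerBoundary_le {α : Type*} {R : α → α → Prop} {E A : Finset α} {d : ℕ} (hA : A ⊆ E)
    (hdeg : ∀ e ∈ E, #{f ∈ E | f ≠ e ∧ R e f} ≤ d) : #(outerBoundary R E A) ≤ #A * d := by
  have hsub : outerBoundary R E A ⊆ A.biUnion fun e => {f ∈ E | f ≠ e ∧ R e f} := by
    intro f hf
    simp only [outerBoundary, Finset.mem_filter] at hf
    obtain ⟨hfE, hfA, e, he, hef⟩ := hf
    simp only [Finset.mem_biUnion, Finset.mem_filter]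
    exact ⟨e, he, hfE, fun h => hfA (h ▸ he), hef⟩
  exact (Finset.card_le_card hsub).trans
    (Finset.card_biUnion_le_card_mul _ _ _ fun e he => hdeg e (hA he))

open Classical in
/-- The sets with `r` elements reachable from `S` satisfy a percolation bound: the events that the
cluster of `S` is `A` are disjoint, and each has probability at least `p ^ r * q ^ (r * d)`. -/
lemma card_reachableFrom_mul_le_one {α : Type*} {R : α → α → Prop} {E S : Finset α} {d r : ℕ}
    (hdeg : ∀ e ∈ E, #{f ∈ E | f ≠ e ∧ R e f} ≤ d) {p q : ℝ} (hp : 0 ≤ p) (hq : 0 ≤ q)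
    (hpq : p + q = 1) :
    (#{A ∈ E.powerset | #A = r ∧ ReachableFrom R S A} : ℝ) * (p ^ r * q ^ (r * d)) ≤ 1 := by
  set F := {A ∈ E.powerset | #A = r ∧ ReachableFrom R S A} with hF
  have hmem : ∀ A ∈ F, A ⊆ E ∧ #A = r ∧ ReachableFrom R S A := by
    intro A hA
    simpa [hF] using hA
  have hsubE : ∀ A, outerBoundary R E A ⊆ E := fun A => Finset.filter_subset _ _
  have hdisj : (F : Set (Finset α)).PairwiseDisjoint
      fun A => Finset.Icc A (E \ outerBoundary R E A) := by
    intro A hA B hB hne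
    refine Finset.disjoint_left.2 fun W hWA hWB => hne ?_
    obtain ⟨hAE, -, hAr⟩ := hmem A hA
    obtain ⟨hBE, -, hBr⟩ := hmem B hB
    simp only [Finset.mem_Icc, Finset.subset_sdiff] at hWA hWB
    exact (hAr.subset_of_separated hBr hWA.2.1 hWA.1 hWB.2.2).antisymm
      (hBr.subset_of_separated hAr hWA.2.1 hWB.1 hWA.2.2)
  calc (#F : ℝ) * (p ^ r * q ^ (r * d))
      = ∑ A ∈ F, p ^ r * q ^ (r * d) := by rw [Finset.sum_const, nsmul_eq_mul]
    _ ≤ ∑ A ∈ F, ∑ W ∈ Finset.Icc A (E \ outerBoundary R E A), p ^ #W * q ^ (#E - #W) := by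
        refine Finset.sum_le_sum fun A hA => ?_
        obtain ⟨hAE, hAr, -⟩ := hmem A hA
        rw [sum_binomial_weights_avoiding hAE (hsubE A) _ hpq, hAr]
        · refine mul_le_mul_of_nonneg_left ?_ (by positivity)
          exact pow_le_pow_of_le_one hq (by linarith) (hAr ▸ card_outerBoundary_le hAE hdeg)
        · refine Finset.disjoint_left.2 fun e he he' => ?_
          simp only [outerBoundary, Finset.mem_filter] at he'
          exact he'.2.1 he
    _ = ∑ W ∈ F.biUnion fun A => Finset.Icc A (E \ outerBoundary R E A),
          p ^ #W * q ^ (#E - #W) := (Finset.sum_biUnion hdisj).symm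
    _ ≤ ∑ W ∈ E.powerset, p ^ #W * q ^ (#E - #W) := by
        refine Finset.sum_le_sum_of_subset_of_nonneg ?_ fun _ _ _ => by positivity
        intro W hW
        simp only [Finset.mem_biUnion, Finset.mem_Icc] at hW
        obtain ⟨A, -, -, hW⟩ := hW
        exact Finset.mem_powerset.2 (hW.trans Finset.sdiff_subset)
    _ = 1 := by rw [Finset.sum_pow_mul_eq_add_pow, hpq, one_pow]

lemma one_add_inv_pow_le_three {d : ℕ} (hd : 0 < d) : (1 + (d : ℝ)⁻¹) ^ d ≤ 3 := by
  have hd' : (d : ℝ) ≠ 0 := by positivity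
  calc (1 + (d : ℝ)⁻¹) ^ d ≤ Real.exp (d : ℝ)⁻¹ ^ d := by
        refine pow_le_pow_left₀ (by positivity) ?_ d
        linarith [Real.add_one_le_exp (d : ℝ)⁻¹]
    _ = Real.exp 1 := by rw [← Real.exp_nat_mul, mul_inv_cancel₀ hd']
    _ ≤ 3 := by linarith [Real.exp_one_lt_d9]

open Classical in
lemma card_reachableFrom_le {α : Type*} {R : α → α → Prop} {E : Finset α} (S : Finset α)
    {d : ℕ} (r : ℕ) (hd : 0 < d) (hdeg : ∀ e ∈ E, #{f ∈ E | f ≠ e ∧ R e f} ≤ d) :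
    (#{A ∈ E.powerset | #A = r ∧ ReachableFrom R S A} : ℝ) ≤ (6 * (d : ℝ)) ^ r := by
  have hd' : (1 : ℝ) ≤ d := by exact_mod_cast hd
  have h := card_reachableFrom_mul_le_one (S := S) (r := r) hdeg
    (p := ((d : ℝ) + 1)⁻¹) (q := (1 + (d : ℝ)⁻¹)⁻¹) (by positivity) (by positivity)
    (by field_simp; ring)
  rw [inv_pow, inv_pow, ← mul_inv, ← div_eq_mul_inv, div_le_one (by positivity), mul_comm r d,
    pow_mul, ← mul_pow] at h
  refine h.trans (pow_le_pow_left₀ (by positivity) ?_ r)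
  calc ((d : ℝ) + 1) * (1 + (d : ℝ)⁻¹) ^ d ≤ (2 * d) * 3 :=
        mul_le_mul (by linarith) (one_add_inv_pow_le_three hd) (by positivity) (by positivity)
    _ = 6 * d := by ring

lemma choose_le_three_mul_div_pow (m : ℕ) {t : ℕ} (ht : 0 < t) :
    (m.choose t : ℝ) ≤ (3 * (m : ℝ) / t) ^ t := by
  have ht' : (0 : ℝ) < t := by exact_mod_cast ht
  have hfac : (t : ℝ) ^ t / t.factorial ≤ 3 ^ t := by
    calc (t : ℝ) ^ t / t.factorial ≤ Real.exp t := Real.pow_div_factorial_le_exp _ ht'.le t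
      _ = Real.exp 1 ^ t := by rw [← Real.exp_nat_mul, mul_one]
      _ ≤ 3 ^ t := pow_le_pow_left₀ (Real.exp_pos 1).le (by linarith [Real.exp_one_lt_d9]) t
  calc (m.choose t : ℝ) ≤ (m : ℝ) ^ t / t.factorial := Nat.choose_le_pow_div t m
    _ = (t : ℝ) ^ t / t.factorial * ((m : ℝ) / t) ^ t := by rw [div_pow]; field_simp
    _ ≤ 3 ^ t * ((m : ℝ) / t) ^ t := mul_le_mul_of_nonneg_right hfac (by positivity)
    _ = (3 * (m : ℝ) / t) ^ t := by rw [← mul_pow, mul_div_assoc]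

lemma hGraph_adj_iff {U : Type*} {k : ℕ} {E : Finset (Fin k → U)} {u v : U} :
    (hGraph E).Adj u v ↔ u ≠ v ∧ ∃ e ∈ E, u ∈ Set.range e ∧ v ∈ Set.range e := by
  simp only [hGraph, SimpleGraph.fromRel_adj, Set.mem_range]
  refine and_congr_right fun _ => ⟨?_, ?_⟩
  · rintro (⟨e, he, i, j, hi, hj⟩ | ⟨e, he, i, j, hi, hj⟩)
    exacts [⟨e, he, ⟨i, hi⟩, j, hj⟩, ⟨e, he, ⟨j, hj⟩, i, hi⟩]
  · rintro ⟨e, he, ⟨i, hi⟩, j, hj⟩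
    exact Or.inl ⟨e, he, i, j, hi, hj⟩

lemma hGraph_connectedComponentMk_eq {U : Type*} {k : ℕ} {E : Finset (Fin k → U)}
    {e : Fin k → U} (he : e ∈ E) (i j : Fin k) :
    (hGraph E).connectedComponentMk (e i) = (hGraph E).connectedComponentMk (e j) := by
  by_cases h : e i = e j
  · rw [h]
  · exact SimpleGraph.ConnectedComponent.sound
      (hGraph_adj_iff.2 ⟨h, e, he, ⟨i, rfl⟩, j, rfl⟩).reachable

lemma NontrivComp.exists_edge {U : Type*} {k : ℕ} {E : Finset (Fin k → U)}
    {c : (hGraph E).ConnectedComponent} (hc : NontrivComp E c) :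
    ∃ e ∈ E, ∀ i, (hGraph E).connectedComponentMk (e i) = c := by
  obtain ⟨u, v, huv, hu, hv⟩ := hc
  obtain ⟨p⟩ := SimpleGraph.ConnectedComponent.exact (hu.trans hv.symm)
  cases p with
  | nil => exact absurd rfl huv
  | cons h _ =>
    obtain ⟨-, e, he, ⟨i, rfl⟩, -⟩ := hGraph_adj_iff.1 h
    exact ⟨e, he, fun j => (hGraph_connectedComponentMk_eq he j i).trans hu⟩

lemma exists_mem_range_of_reachable {U : Type*} {k : ℕ} {E T : Finset (Fin k → U)}
    (hT : ∀ e ∈ T, ∀ f ∈ E, (∃ i j, f i = e j) → f ∈ T) {u v : U} (h : (hGraph E).Reachable u v)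
    (hu : ∃ e ∈ T, u ∈ Set.range e) : ∃ e ∈ T, v ∈ Set.range e := by
  obtain ⟨p⟩ := h
  induction p with
  | nil => exact hu
  | cons h _ ih =>
    obtain ⟨e, he, j, hj⟩ := hu
    obtain ⟨-, f, hf, ⟨i, hi⟩, hw⟩ := hGraph_adj_iff.1 h
    exact ih ⟨f, hT e he f hf ⟨i, j, hi.trans hj.symm⟩, hw⟩

/-- Choosing one hyperedge in each nontrivial component gives a set from which all hyperedges are
reachable. -/
lemma exists_reachableFrom_card_eq_ntCount {U : Type*} [Finite U] {k : ℕ} (hk : 2 ≤ k)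
    {E : Finset (Fin k → U)} (hinj : ∀ e ∈ E, Function.Injective e) :
    ∃ S, #S = ntCount E ∧ ReachableFrom (fun e f => ∃ i j, f i = e j) S E := by
  classical
  let i₀ : Fin k := ⟨0, by omega⟩
  let i₁ : Fin k := ⟨1, by omega⟩
  choose root hmem hroot using
    fun c : {c : (hGraph E).ConnectedComponent // NontrivComp E c} => c.2.exists_edge
  have : Fintype {c : (hGraph E).ConnectedComponent // NontrivComp E c} := Fintype.ofFinite _
  have hrinj : Function.Injective root := fun c c' h =>
    Subtype.ext ((hroot c i₀).symm.trans (h ▸ hroot c' i₀))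
  refine ⟨Finset.univ.image root, ?_, ?_, ?_⟩
  · rw [Finset.card_image_of_injective _ hrinj, Finset.card_univ, ntCount, Nat.card_eq_fintype_card]
  · simpa [Finset.image_subset_iff] using fun c hc => hmem ⟨c, hc⟩
  · intro T _ hST hT e he
    have hne : e i₀ ≠ e i₁ := fun h => by simpa [i₀, i₁] using hinj e he h
    let c : {c : (hGraph E).ConnectedComponent // NontrivComp E c} :=
      ⟨(hGraph E).connectedComponentMk (e i₀), e i₀, e i₁, hne, rfl,
        hGraph_connectedComponentMk_eq he i₁ i₀⟩
    have hreach : (hGraph E).Reachable (root c i₀) (e i₀) :=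
      SimpleGraph.ConnectedComponent.exact (hroot c i₀)
    obtain ⟨f, hf, j, hj⟩ := exists_mem_range_of_reachable hT hreach
      ⟨root c, hST (Finset.mem_image_of_mem _ (Finset.mem_univ c)), i₀, rfl⟩
    exact hT f hf e he ⟨i₀, j, hj.symm⟩

/-- The number of `r`-edge subsets of a bounded-degree hypergraph having exactly `t`
nontrivial connected components is at most `(6d)^r · (3m/t)^t`. -/
theorem stmt12 (k : ℕ) (hk : 2 ≤ k) (d t r : ℕ) (hd : 0 < d) (ht : 0 < t) (hr : 0 < r)
    (htr : t ≤ r) (E : Finset (Fin k → V)) (m : ℕ) (hEm : E.card = m)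
    (hinj : ∀ e ∈ E, Function.Injective e)
    (hdeg : ∀ e ∈ E, (E.filter (fun e' => e' ≠ e ∧ ∃ i j, e' i = e j)).card ≤ d) :
    ((E.powerset.filter (fun E' => E'.card = r ∧ ntCount E' = t)).card : ℝ) ≤
      (6 * (d : ℝ)) ^ r * (3 * (m : ℝ) / (t : ℝ)) ^ t := by
  classical
  let R : (Fin k → V) → (Fin k → V) → Prop := fun e f => ∃ i j, f i = e j
  have hsub : (E.powerset.filter fun E' => E'.card = r ∧ ntCount E' = t) ⊆
      (E.powersetCard t).biUnion fun S => {A ∈ E.powerset | #A = r ∧ ReachableFrom R S A} := by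
    intro A hA
    simp only [Finset.mem_filter, Finset.mem_powerset] at hA
    obtain ⟨hAE, hAr, hAt⟩ := hA
    obtain ⟨S, hS, hreach⟩ :=
      exists_reachableFrom_card_eq_ntCount hk fun e he => hinj e (hAE he)
    simp only [Finset.mem_biUnion, Finset.mem_powersetCard, Finset.mem_filter,
      Finset.mem_powerset]
    exact ⟨S, ⟨hreach.1.trans hAE, hS.trans hAt⟩, hAE, hAr, hreach⟩
  calc ((E.powerset.filter fun E' => E'.card = r ∧ ntCount E' = t).card : ℝ)
      ≤ ∑ S ∈ E.powersetCard t, (#{A ∈ E.powerset | #A = r ∧ ReachableFrom R S A} : ℝ) := by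
        exact_mod_cast (Finset.card_le_card hsub).trans Finset.card_biUnion_le
    _ ≤ ∑ S ∈ E.powersetCard t, (6 * (d : ℝ)) ^ r :=
        Finset.sum_le_sum fun S _ => by
          convert card_reachableFrom_le (R := R) S r hd fun e he => by convert hdeg e he
    _ = (6 * (d : ℝ)) ^ r * (m.choose t : ℝ) := by
        rw [Finset.sum_const, Finset.card_powersetCard, hEm, nsmul_eq_mul, mul_comm]
    _ ≤ (6 * (d : ℝ)) ^ r * (3 * (m : ℝ) / (t : ℝ)) ^ t :=
        mul_le_mul_of_nonneg_left (choose_le_three_mul_div_pow m ht) (by positivity)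
end

section
/- Let k ≥ 2 and N ≥ 2 be integers, and let d, ℓ, m be positive integers with m ≥ ℓ. Let (V, E) be an almost-acyclic k-uniform hypergraph with m hyperedges such that every hyperedge is incident to at most d other hyperedges. Then Σ_{E' ⊆ E} |𝓑_ℓ(E')| ≤ ((15·d·N^k)^4 · m / ℓ)^{ℓ/2}. -/
open Finset

variable {V : Type*} [Fintype V] [DecidableEq V]

/-- The vertices of a hyperedge. -/
def edgeVerts {k : ℕ} (e : Fin k → V) : Finset V := Finset.image e Finset.univ

/-- The set of vertices covered by a set of hyperedges. -/
def cover {k : ℕ} (E' : Finset (Fin k → V)) : Finset V := E'.biUnion edgeVerts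

/-- `𝓑_ℓ(E')`: the maps `B` assigning to each `e ∈ E'` a vector supported on the
vertices of `e` with Hamming weight at least `3`, such that `‖ΣB‖_H = ℓ`. -/
def BBl {k : ℕ} (N : ℕ) [NeZero N] (E' : Finset (Fin k → V)) (ℓ : ℕ) :
    Finset ({e // e ∈ E'} → V → ZMod N) :=
  Finset.univ.filter (fun B =>
    (∀ e : {e // e ∈ E'}, (∀ v, B e v ≠ 0 → ∃ i, (e : Fin k → V) i = v) ∧
      3 ≤ (Finset.univ.filter (fun v => B e v ≠ 0)).card) ∧
    (Finset.univ.filter (fun v => (∑ e, B e) v ≠ 0)).card = ℓ)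

/-- `S` is reachable from `R`: every nonempty part of `S` is adjacent to the rest of `R ∪ S`. -/
def Reach {α : Type*} (adj : α → α → Prop) (R S : Finset α) : Prop :=
  ∀ Z ⊆ S, Z.Nonempty → ∃ z ∈ Z, ∃ y, (y ∈ R ∨ y ∈ S) ∧ y ∉ Z ∧ adj z y

/-- A map between index sets that is injective and increases the summand increases the sum. -/
lemma sum_le_sum_of_injOn_of_le {α β : Type*} [DecidableEq β] {s : Finset α} {t : Finset β}
    {f : α → ℝ} {g : β → ℝ} (i : α → β) (hmaps : ∀ a ∈ s, i a ∈ t)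
    (hinj : Set.InjOn i s) (hfg : ∀ a ∈ s, f a ≤ g (i a)) (hg : ∀ b ∈ t, 0 ≤ g b) :
    ∑ a ∈ s, f a ≤ ∑ b ∈ t, g b := by
  calc ∑ a ∈ s, f a ≤ ∑ a ∈ s, g (i a) := sum_le_sum hfg
    _ = ∑ b ∈ s.image i, g b := (sum_image hinj).symm
    _ ≤ ∑ b ∈ t, g b := sum_le_sum_of_subset_of_nonneg
        (image_subset_iff.2 hmaps) (fun b hb _ => hg b hb)

lemma sum_powerset_pow_card {α : Type*} (s : Finset α) (a : ℝ) :
    ∑ t ∈ s.powerset, a ^ #t = (1 + a) ^ #s := by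
  have h := Finset.sum_pow_mul_eq_add_pow a 1 s
  simp only [one_pow, mul_one] at h
  rw [h, add_comm]

open Classical in
/-- Weighted count of the sets reachable from `R` in a graph of bounded degree. -/
lemma sum_reach_le {α : Type*} [DecidableEq α] (adj : α → α → Prop) (E : Finset α) (d : ℕ) {x t : ℝ}
    (hx : 0 ≤ x) (ht : 1 ≤ t) (hxt : (1 + x * t) ^ d ≤ t)
    (hdeg : ∀ r ∈ E, #{z ∈ E | adj z r} ≤ d) (n : ℕ) :
    ∀ X R : Finset α, X ⊆ E → R ⊆ E → #X + #R ≤ n →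
      ∑ S ∈ X.powerset with Reach adj R S, x ^ #S ≤ t ^ #R := by
  induction n with
  | zero =>
    intro X R _ _ h
    have hX : X = ∅ := by rw [← card_eq_zero]; omega
    have hR : R = ∅ := by rw [← card_eq_zero]; omega
    subst hX hR
    refine (sum_le_sum_of_subset_of_nonneg (filter_subset _ _)
      (fun S _ _ => pow_nonneg hx _)).trans ?_
    simp
  | succ n ih =>
    intro X R hX hR h
    rcases R.eq_empty_or_nonempty with rfl | ⟨r, hr⟩
    · have hsub : {S ∈ X.powerset | Reach adj ∅ S} ⊆ {∅} := by
        intro S hS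
        rw [mem_filter] at hS
        rw [mem_singleton]
        by_contra hne
        obtain ⟨z, _, y, hy, hy', _⟩ := hS.2 S subset_rfl (nonempty_iff_ne_empty.2 hne)
        simp_all
      refine (sum_le_sum_of_subset_of_nonneg hsub (fun S _ _ => pow_nonneg hx _)).trans ?_
      simp
    · set K := {z ∈ X | adj z r} with hK
      have hKX : K ⊆ X := filter_subset _ _
      have hKd : #K ≤ d := (card_le_card (filter_subset_filter _ hX)).trans (hdeg r (hR hr))
      have hRpos : 0 < #R := card_pos.2 ⟨r, hr⟩
      have hcardK : #(X \ K) + #K = #X := card_sdiff_add_card_eq_card hKX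
      have hfib : ∀ M ∈ K.powerset,
          ∑ S ∈ X.powerset with Reach adj R S ∧ S ∩ K = M, x ^ #S
            ≤ t ^ (#R - 1) * (x * t) ^ #M := by
        intro M hM
        rw [mem_powerset] at hM
        have hcard : #(R.erase r ∪ M) ≤ #R - 1 + #M :=
          (card_union_le _ _).trans (by rw [card_erase_of_mem hr])
        have hIH := ih (X \ K) (R.erase r ∪ M) (sdiff_subset.trans hX)
          (union_subset ((erase_subset _ _).trans hR) (hM.trans (hKX.trans hX)))
          (by have := card_le_card hM; omega)
        calc ∑ S ∈ X.powerset with Reach adj R S ∧ S ∩ K = M, x ^ #S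
            ≤ ∑ S ∈ (X \ K).powerset with Reach adj (R.erase r ∪ M) S, x ^ #M * x ^ #S := by
              refine sum_le_sum_of_injOn_of_le (fun S => S \ K) ?_ ?_ ?_
                (fun S _ => mul_nonneg (pow_nonneg hx _) (pow_nonneg hx _))
              · intro S hS
                rw [mem_filter, mem_powerset] at hS ⊢
                obtain ⟨hSX, hS, rfl⟩ := hS
                refine ⟨sdiff_subset_sdiff hSX subset_rfl, ?_⟩
                intro Z hZ hZne
                obtain ⟨z, hz, y, hy, hyZ, hzy⟩ := hS Z (hZ.trans sdiff_subset) hZne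
                refine ⟨z, hz, y, ?_, hyZ, hzy⟩
                have hz' := mem_sdiff.1 (hZ hz)
                have hyr : y ≠ r := by
                  rintro rfl
                  exact hz'.2 (mem_filter.2 ⟨hSX hz'.1, hzy⟩)
                simp only [mem_union, mem_erase, mem_inter, mem_sdiff]
                tauto
              · intro S hS S' hS' hSS'
                simp only [coe_filter, Set.mem_ofPred_eq] at hS hS'
                simp only at hSS'
                rw [← sdiff_union_inter S K, ← sdiff_union_inter S' K, hSS', hS.2.2, hS'.2.2]
              · intro S hS
                rw [mem_filter] at hS
                rw [← hS.2.2, ← pow_add, add_comm, card_sdiff_add_card_inter]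
          _ = x ^ #M * ∑ S ∈ (X \ K).powerset with Reach adj (R.erase r ∪ M) S, x ^ #S := by
              rw [mul_sum]
          _ ≤ x ^ #M * t ^ (#R - 1 + #M) :=
              mul_le_mul_of_nonneg_left (hIH.trans (pow_le_pow_right₀ ht hcard))
                (pow_nonneg hx _)
          _ = t ^ (#R - 1) * (x * t) ^ #M := by rw [pow_add, mul_pow]; ring
      have hxt0 : 0 ≤ x * t := mul_nonneg hx (by linarith)
      calc ∑ S ∈ X.powerset with Reach adj R S, x ^ #S
          = ∑ M ∈ K.powerset, ∑ S ∈ X.powerset with Reach adj R S ∧ S ∩ K = M, x ^ #S := by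
            rw [← sum_fiberwise_of_maps_to (g := fun S => S ∩ K) (t := K.powerset)
              (fun S _ => mem_powerset.2 inter_subset_right)]
            simp only [filter_filter]
        _ ≤ ∑ M ∈ K.powerset, t ^ (#R - 1) * (x * t) ^ #M := sum_le_sum hfib
        _ = t ^ (#R - 1) * (1 + x * t) ^ #K := by rw [← mul_sum, sum_powerset_pow_card]
        _ ≤ t ^ (#R - 1) * t := by
            refine mul_le_mul_of_nonneg_left ?_ (by positivity)
            exact (pow_le_pow_right₀ (by linarith) hKd).trans hxt
        _ = t ^ #R := by rw [← pow_succ]; congr 1; omega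

open Classical in
/-- A superadditive `g` that is at least `2` on every nonempty union of components admits a set
of representatives of the components of size at most `g F / 2`. -/
lemma exists_reach_roots {α : Type*} [DecidableEq α] (adj : α → α → Prop)
    (hsymm : ∀ a b, adj a b → adj b a)
    (g : Finset α → ℕ) (n : ℕ) : ∀ F : Finset α, #F ≤ n →
    (∀ W ⊆ F, (∀ z ∈ W, ∀ y ∈ F, y ∉ W → ¬ adj z y) → W.Nonempty → 2 ≤ g W) →
    (∀ W ⊆ F, ∀ W' ⊆ F, (∀ z ∈ W, ∀ y ∈ W', z ≠ y ∧ ¬ adj z y) → g W + g W' ≤ g (W ∪ W')) →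
    ∃ R ⊆ F, 2 * #R ≤ g F ∧ Reach adj R (F \ R) := by
  induction n with
  | zero =>
    intro F hF _ _
    obtain rfl : F = ∅ := by rw [← card_eq_zero]; omega
    refine ⟨∅, subset_rfl, by simp, ?_⟩
    intro Z hZ hne
    obtain ⟨z, hz⟩ := hne
    simpa using hZ hz
  | succ n ih =>
    intro F hF h2 hadd
    rcases F.eq_empty_or_nonempty with rfl | hFne
    · exact ih ∅ (by simp) h2 hadd
    let P : Finset α → Prop :=
      fun W => W ⊆ F ∧ (∀ z ∈ W, ∀ y ∈ F, y ∉ W → ¬ adj z y) ∧ W.Nonempty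
    have hPF : F ∈ F.powerset.filter P := by
      simp only [mem_filter, mem_powerset, subset_refl, true_and]
      exact ⟨subset_rfl, fun z _ y hy hy' => absurd hy hy', hFne⟩
    obtain ⟨W, hW, hmin⟩ := exists_min_image (F.powerset.filter P) card ⟨F, hPF⟩
    obtain ⟨hWF, hWcl, r, hr⟩ := (mem_filter.1 hW).2
    have hlt : #(F \ W) < #F := card_lt_card
      (Finset.ssubset_iff_subset_ne.2 ⟨sdiff_subset, fun he => by
        have := hWF hr
        rw [← he] at this
        exact (mem_sdiff.1 this).2 hr⟩)
    obtain ⟨R, hRF, hRcard, hR⟩ := ih (F \ W) (by omega)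
      (by
        intro Z hZ hcl hne
        refine h2 Z (hZ.trans sdiff_subset) ?_ hne
        intro z hz y hy hyZ hzy
        by_cases hyW : y ∈ W
        · exact hWcl y hyW z (mem_sdiff.1 (hZ hz)).1 (mem_sdiff.1 (hZ hz)).2 (hsymm _ _ hzy)
        · exact hcl z hz y (mem_sdiff.2 ⟨hy, hyW⟩) hyZ hzy)
      (fun Z hZ Z' hZ' h => hadd Z (hZ.trans sdiff_subset) Z' (hZ'.trans sdiff_subset) h)
    refine ⟨insert r R, insert_subset (hWF hr) (hRF.trans sdiff_subset), ?_, ?_⟩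
    · have h1 := hadd W hWF (F \ W) sdiff_subset (by
        intro z hz y hy
        rw [mem_sdiff] at hy
        exact ⟨fun he => hy.2 (he ▸ hz), hWcl z hz y hy.1 hy.2⟩)
      rw [union_sdiff_of_subset hWF] at h1
      have h3 := h2 W hWF hWcl ⟨r, hr⟩
      have h4 := card_insert_le r R
      omega
    · intro Y hY hYne
      by_cases hYW : (Y ∩ W).Nonempty
      · have hrY : r ∉ Y := fun h => (mem_sdiff.1 (hY h)).2 (mem_insert_self _ _)
        have hlt' : #(Y ∩ W) < #W := card_lt_card
          (Finset.ssubset_iff_subset_ne.2 ⟨inter_subset_right, fun he => by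
            rw [← he] at hr
            exact hrY (mem_inter.1 hr).1⟩)
        have hnot : ¬ (∀ z ∈ Y ∩ W, ∀ y ∈ F, y ∉ Y ∩ W → ¬ adj z y) := by
          intro hcl
          have hsub : Y ∩ W ⊆ F := inter_subset_right.trans hWF
          have := hmin (Y ∩ W) (mem_filter.2 ⟨mem_powerset.2 hsub, hsub, hcl, hYW⟩)
          omega
        push Not at hnot
        obtain ⟨z, hz, y, hyF, hy, hzy⟩ := hnot
        have hyW : y ∈ W := by
          by_contra hyW
          exact hWcl z (mem_inter.1 hz).2 y hyF hyW hzy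
        refine ⟨z, (mem_inter.1 hz).1, y, ?_, fun h => hy (mem_inter.2 ⟨h, hyW⟩), hzy⟩
        simp only [mem_sdiff]
        tauto
      · rw [not_nonempty_iff_eq_empty] at hYW
        obtain ⟨z, hz, y, hy, hyY, hzy⟩ := hR Y (by
          intro z hz
          have h1 := mem_sdiff.1 (hY hz)
          have h2 : z ∉ W := fun h => by
            have : z ∈ Y ∩ W := mem_inter.2 ⟨hz, h⟩
            simp [hYW] at this
          simp only [mem_sdiff, mem_insert] at h1 ⊢
          tauto) hYne
        refine ⟨z, hz, y, ?_, hyY, hzy⟩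
        simp only [mem_sdiff, mem_insert] at hy ⊢
        tauto

/-- In a union `Z` of components of `F`, the number of nonzero coordinates of the sum is large
unless the hyperedges of `Z` overlap a lot. -/
lemma three_mul_card_add_le {k : ℕ} {A : Type*} [AddCommMonoid A] [DecidableEq A]
    (F Z : Finset (Fin k → V)) (hZF : Z ⊆ F)
    (hinj : ∀ e ∈ F, Function.Injective e)
    (hcl : ∀ z ∈ Z, ∀ y ∈ F, y ∉ Z → ∀ i j, z i ≠ y j)
    (b : (Fin k → V) → V → A)
    (hsupp : ∀ e ∈ F, ∀ v, b e v ≠ 0 → ∃ i, e i = v)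
    (hwt : ∀ e ∈ F, 3 ≤ #{v | b e v ≠ 0}) :
    3 * #Z + 2 * #(cover Z) ≤ #{v ∈ cover Z | ∑ e ∈ F, b e v ≠ 0} + 2 * (k * #Z) := by
  have hmem : ∀ {e : Fin k → V} {v : V}, v ∈ edgeVerts e ↔ ∃ i, e i = v := by
    intro e v
    simp [edgeVerts]
  have hdeg : ∑ v ∈ cover Z, #{e ∈ Z | v ∈ edgeVerts e} = k * #Z := by
    refine (sum_card_bipartiteAbove_eq_sum_card_bipartiteBelow
      (fun (v : V) (e : Fin k → V) => v ∈ edgeVerts e)).trans ?_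
    rw [sum_congr rfl (g := fun _ => k), sum_const, smul_eq_mul, mul_comm]
    intro e he
    have : {v ∈ cover Z | v ∈ edgeVerts e} = edgeVerts e := by
      ext v
      simp only [mem_filter, cover, mem_biUnion, and_iff_right_iff_imp]
      exact fun hv => ⟨e, he, hv⟩
    rw [bipartiteBelow, this, edgeVerts, card_image_of_injective _ (hinj e (hZF he))]
    simp
  have hdegb : 3 * #Z ≤ ∑ v ∈ cover Z, #{e ∈ Z | b e v ≠ 0} := by
    refine le_of_le_of_eq ?_ (sum_card_bipartiteAbove_eq_sum_card_bipartiteBelow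
      (fun (v : V) (e : Fin k → V) => b e v ≠ 0)).symm
    rw [mul_comm, ← smul_eq_mul]
    refine card_nsmul_le_sum _ _ _ (fun e he => (hwt e (hZF he)).trans (card_le_card ?_))
    intro v hv
    have hv : b e v ≠ 0 := by simpa using hv
    simp only [bipartiteBelow, mem_filter, cover, mem_biUnion]
    exact ⟨⟨e, he, hmem.2 (hsupp e (hZF he) v hv)⟩, hv⟩
  have hpt : ∀ v ∈ cover Z, #{e ∈ Z | b e v ≠ 0} + 2 ≤
      (if ∑ e ∈ F, b e v ≠ 0 then 1 else 0) + 2 * #{e ∈ Z | v ∈ edgeVerts e} := by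
    intro v hv
    simp only [cover, mem_biUnion] at hv
    obtain ⟨e, he, hev⟩ := hv
    have hsub : {e ∈ Z | b e v ≠ 0} ⊆ {e ∈ Z | v ∈ edgeVerts e} := by
      intro e' he'
      rw [mem_filter] at he' ⊢
      exact ⟨he'.1, hmem.2 (hsupp e' (hZF he'.1) v he'.2)⟩
    have hle := card_le_card hsub
    have hpos : 0 < #{e ∈ Z | v ∈ edgeVerts e} := card_pos.2 ⟨e, mem_filter.2 ⟨he, hev⟩⟩
    by_cases h2 : 2 ≤ #{e ∈ Z | v ∈ edgeVerts e}
    · omega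
    have h1 : #{e ∈ Z | v ∈ edgeVerts e} = 1 := by omega
    by_cases h0 : #{e ∈ Z | b e v ≠ 0} = 0
    · omega
    obtain ⟨e', he'⟩ := card_pos.1 (Nat.pos_of_ne_zero h0)
    have he'2 := mem_filter.1 he'
    have hsum : ∑ f ∈ F, b f v = b e' v := by
      refine sum_eq_single_of_mem e' (hZF he'2.1) (fun f hf hfe => ?_)
      by_contra hne
      obtain ⟨i, hi⟩ := hsupp f hf v hne
      by_cases hfZ : f ∈ Z
      · exact hfe (card_le_one.1 h1.le f (mem_filter.2 ⟨hfZ, hmem.2 ⟨i, hi⟩⟩) e' (hsub he'))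
      · obtain ⟨j, hj⟩ := hmem.1 hev
        exact hcl e he f hf hfZ j i (hj.trans hi.symm)
    rw [hsum, if_pos he'2.2]
    omega
  have hsum := sum_le_sum hpt
  rw [sum_add_distrib, sum_add_distrib, ← mul_sum, hdeg, sum_const, smul_eq_mul,
    ← card_filter] at hsum
  omega

/-- The number of maps in `𝓑_ℓ(F)` is at most the number of all labellings of the incidences. -/
lemma card_BBl_le {k N : ℕ} [NeZero N] (F : Finset (Fin k → V)) (ℓ : ℕ) :
    #(BBl N F ℓ) ≤ (N ^ k) ^ #F := by
  have h : #(BBl N F ℓ) ≤ #(univ : Finset ({e // e ∈ F} → Fin k → ZMod N)) := by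
    refine card_le_card_of_injOn (fun B e i => B e ((e : Fin k → V) i))
      (fun _ _ => mem_coe.2 (mem_univ _)) ?_
    intro B hB B' hB' h
    have hB := (mem_filter.1 (mem_coe.1 hB)).2.1
    have hB' := (mem_filter.1 (mem_coe.1 hB')).2.1
    funext e v
    by_cases hv : ∃ i, (e : Fin k → V) i = v
    · obtain ⟨i, rfl⟩ := hv
      exact congrFun (congrFun h e) i
    · rw [not_imp_comm.1 ((hB e).1 v) hv, not_imp_comm.1 ((hB' e).1 v) hv]
  refine h.trans (le_of_eq ?_)
  simp [ZMod.card]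

/-- Distinct hyperedges sharing a vertex. -/
def Incident {k : ℕ} (e' e : Fin k → V) : Prop := e' ≠ e ∧ ∃ i j, e' i = e j

/-- If `𝓑_ℓ(F)` is nonempty then `F` is small and has few components. -/
lemma exists_roots_of_BBl_nonempty {k N ℓ : ℕ} [NeZero N] {F : Finset (Fin k → V)}
    (hinj : ∀ e ∈ F, Function.Injective e)
    (hac : ∀ Z ⊆ F, (#Z : ℝ) * ((k : ℝ) - 1.1) ≤ (#(cover Z) : ℝ))
    (hne : (BBl N F ℓ).Nonempty) :
    #F ≤ 2 * ℓ ∧ ∃ R ⊆ F, 2 * #R ≤ ℓ ∧ Reach Incident R (F \ R) := by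
  obtain ⟨B, hB⟩ := hne
  obtain ⟨hB1, hBℓ⟩ := (mem_filter.1 hB).2
  let b : (Fin k → V) → V → ZMod N := fun e v => if h : e ∈ F then B ⟨e, h⟩ v else 0
  have hbB : ∀ e (h : e ∈ F), b e = B ⟨e, h⟩ := fun e h => by
    funext v
    exact dif_pos h
  have hsum : ∀ v, ∑ e ∈ F, b e v = (∑ e, B e) v := by
    intro v
    rw [Finset.sum_apply, ← sum_coe_sort F]
    exact sum_congr rfl fun e _ => by rw [hbB e e.2]
  let g : Finset (Fin k → V) → ℕ := fun Z => #{v ∈ cover Z | ∑ e ∈ F, b e v ≠ 0}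
  have hg : ∀ Z, g Z ≤ ℓ := by
    intro Z
    rw [← hBℓ]
    refine card_le_card fun v hv => ?_
    rw [mem_filter, hsum] at hv
    exact mem_filter.2 ⟨mem_univ _, hv.2⟩
  have hkey : ∀ Z ⊆ F, (∀ z ∈ Z, ∀ y ∈ F, y ∉ Z → ¬ Incident z y) →
      3 * #Z + 2 * #(cover Z) ≤ g Z + 2 * (k * #Z) := by
    intro Z hZ hcl
    refine three_mul_card_add_le F Z hZ hinj ?_ b ?_ ?_
    · intro z hz y hy hyZ i j hij
      exact hcl z hz y hy hyZ ⟨fun h => hyZ (h ▸ hz), i, j, hij⟩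
    · intro e he v hv
      rw [hbB e he] at hv
      exact (hB1 ⟨e, he⟩).1 v hv
    · intro e he
      rw [hbB e he]
      exact (hB1 ⟨e, he⟩).2
  have hlow : ∀ Z ⊆ F, (∀ z ∈ Z, ∀ y ∈ F, y ∉ Z → ¬ Incident z y) → 4 * #Z ≤ 5 * g Z := by
    intro Z hZ hcl
    have h1 : (3 * #Z + 2 * #(cover Z) : ℝ) ≤ g Z + 2 * (k * #Z) := by
      exact_mod_cast hkey Z hZ hcl
    have h2 := hac Z hZ
    have h3 : (4 * #Z : ℝ) ≤ 5 * g Z := by linarith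
    exact_mod_cast h3
  refine ⟨?_, ?_⟩
  · have h1 := hlow F subset_rfl (fun z _ y hy hy' => absurd hy hy')
    have h2 := hg F
    omega
  · obtain ⟨R, hRF, hR, hreach⟩ := exists_reach_roots (Incident (V := V) (k := k))
      (fun a b h => ⟨h.1.symm, by obtain ⟨_, i, j, hij⟩ := h; exact ⟨j, i, hij.symm⟩⟩)
      g (#F) F le_rfl
      (by
        intro W hW hcl hne
        have h1 := hlow W hW hcl
        have h2 := card_pos.2 hne
        by_cases hc : #W = 1
        · have h3 := hkey W hW hcl
          obtain ⟨e, rfl⟩ := card_eq_one.1 hc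
          have h4 : #(cover {e}) = k := by
            rw [cover, singleton_biUnion, edgeVerts,
              card_image_of_injective _ (hinj e (hW (mem_singleton_self e)))]
            simp
          rw [h4, hc] at h3
          omega
        · omega)
      (by
        intro W _ W' _ h
        refine le_of_eq ?_
        have hd : Disjoint (cover W) (cover W') := by
          rw [disjoint_left]
          intro v hv hv'
          simp only [cover, mem_biUnion, edgeVerts, mem_image, mem_univ, true_and] at hv hv'
          obtain ⟨e, he, i, hi⟩ := hv
          obtain ⟨e', he', j, hj⟩ := hv'
          exact (h e he e' he').2 ⟨(h e he e' he').1, i, j, hi.trans hj.symm⟩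
        have hu : cover (W ∪ W') = cover W ∪ cover W' := union_biUnion
        simp only [g]
        rw [hu, filter_union, card_union_of_disjoint (disjoint_filter_filter hd)])
    exact ⟨R, hRF, hR.trans (hg F), hreach⟩

open Classical in
/-- Weighted count of the pairs consisting of a set and a choice of roots for it. -/
lemma sum_sum_reach_le {α : Type*} [DecidableEq α] (adj : α → α → Prop) (E : Finset α) (d : ℕ) {x y t : ℝ}
    (hx : 0 ≤ x) (hy : 0 ≤ y) (ht : 1 ≤ t) (hxt : (1 + x * t) ^ d ≤ t)
    (hdeg : ∀ r ∈ E, #{z ∈ E | adj z r} ≤ d) :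
    ∑ F ∈ E.powerset, ∑ R ∈ E.powerset with R ⊆ F ∧ Reach adj R (F \ R),
      y ^ #R * x ^ #(F \ R) ≤ (1 + y * t) ^ #E := by
  simp only [sum_filter]
  rw [sum_comm]
  simp only [← sum_filter]
  rw [← sum_powerset_pow_card]
  refine sum_le_sum fun R hR => ?_
  rw [mem_powerset] at hR
  rw [← mul_sum, mul_pow]
  refine mul_le_mul_of_nonneg_left ?_ (pow_nonneg hy _)
  refine le_trans ?_ (sum_reach_le adj E d hx ht hxt hdeg _ E R subset_rfl hR le_rfl)
  refine sum_le_sum_of_injOn_of_le (fun F => F \ R) ?_ ?_ (fun _ _ => le_rfl)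
    (fun _ _ => pow_nonneg hx _)
  · intro F hF
    rw [mem_filter, mem_powerset] at hF ⊢
    exact ⟨sdiff_subset.trans hF.1, hF.2.2⟩
  · intro F hF F' hF' h
    simp only [coe_filter, Set.mem_ofPred_eq] at hF hF'
    simp only at h
    rw [← sdiff_union_of_subset hF.2.1, ← sdiff_union_of_subset hF'.2.1, h]

/-- For an almost-acyclic bounded-degree hypergraph with `m` hyperedges,
`Σ_{E' ⊆ E} |𝓑_ℓ(E')| ≤ ((15·d·N^k)^4 · m / ℓ)^{ℓ/2}`. -/
theorem stmt14 (k N : ℕ) [NeZero N] (hk : 2 ≤ k) (hN : 2 ≤ N)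
    (d ℓ m : ℕ) (hd : 0 < d) (hℓ : 0 < ℓ) (hm : 0 < m) (hℓm : ℓ ≤ m)
    (E : Finset (Fin k → V)) (hEm : E.card = m)
    (hinj : ∀ e ∈ E, Function.Injective e)
    (hac : ∀ E' ⊆ E, (E'.card : ℝ) * ((k : ℝ) - 1.1) ≤ ((cover E').card : ℝ))
    (hdeg : ∀ e ∈ E, (E.filter (fun e' => e' ≠ e ∧ ∃ i j, e' i = e j)).card ≤ d) :
    (∑ E' ∈ E.powerset, ((BBl N E' ℓ).card : ℝ)) ≤
      (((15 * (d : ℝ) * (N : ℝ) ^ k) ^ 4 * (m : ℝ)) / (ℓ : ℝ)) ^ ((ℓ : ℝ) / 2) := by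
  classical
  have hd1 : (1 : ℝ) ≤ d := by exact_mod_cast hd
  have hℓ0 : (0 : ℝ) < ℓ := by exact_mod_cast hℓ
  have hm0 : (0 : ℝ) < m := by exact_mod_cast hm
  have hN1 : (1 : ℝ) ≤ (N : ℝ) ^ k := one_le_pow₀ (by exact_mod_cast (by omega : 1 ≤ N))
  have he3 : Real.exp 1 ≤ 2.7182818286 := Real.exp_one_lt_d9.le
  set x : ℝ := 1 / (3 * d) with hx
  set y : ℝ := ℓ / m with hy
  set D : ℝ := 3 * d * (N : ℝ) ^ k with hD
  set Q : ℝ := ((m : ℝ) / ℓ) ^ ((ℓ : ℝ) / 2) with hQ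
  have hx0 : 0 < x := by positivity
  have hy0 : 0 < y := by positivity
  have hy1 : y ≤ 1 := (div_le_one hm0).2 (by exact_mod_cast hℓm)
  have hQ0 : 0 < Q := by positivity
  have hD1 : 1 ≤ D := by nlinarith
  have hxt : (1 + x * 3) ^ d ≤ 3 := by
    have h1 : x * 3 = 1 / d := by rw [hx]; field_simp
    have h2 : (1 + x * 3) ^ d ≤ Real.exp (1 / d) ^ d := by
      rw [h1]
      exact pow_le_pow_left₀ (by positivity) (by linarith [Real.add_one_le_exp (1 / (d : ℝ))]) _
    rw [← Real.exp_nat_mul, mul_one_div_cancel (by positivity)] at h2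
    linarith
  have hterm : ∀ F ∈ E.powerset, ((BBl N F ℓ).card : ℝ) ≤
      D ^ (2 * ℓ) * Q * ∑ R ∈ E.powerset with R ⊆ F ∧ Reach Incident R (F \ R),
        y ^ #R * x ^ #(F \ R) := by
    intro F hF
    rw [mem_powerset] at hF
    have hnn : ∀ R : Finset (Fin k → V), 0 ≤ y ^ #R * x ^ #(F \ R) := fun R => by positivity
    rcases (BBl N F ℓ).eq_empty_or_nonempty with h0 | hne
    · rw [h0]
      simp only [card_empty, Nat.cast_zero]
      exact mul_nonneg (by positivity) (sum_nonneg fun R _ => hnn R)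
    obtain ⟨hFℓ, R, hRF, hRℓ, hreach⟩ := exists_roots_of_BBl_nonempty
      (fun e he => hinj e (hF he)) (fun Z hZ => hac Z (hZ.trans hF)) hne
    have hQy : 1 ≤ Q * y ^ #R := by
      have h1 : Q = (y ^ ((ℓ : ℝ) / 2))⁻¹ := by
        rw [hQ, hy, ← Real.inv_rpow (by positivity), inv_div]
      have h2 : y ^ ((ℓ : ℝ) / 2) ≤ y ^ #R := by
        rw [← Real.rpow_natCast]
        refine Real.rpow_le_rpow_of_exponent_ge hy0 hy1 ?_
        have : (2 * #R : ℝ) ≤ ℓ := by exact_mod_cast hRℓ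
        linarith
      rw [h1, inv_mul_eq_div, one_le_div (by positivity)]
      exact h2
    have hDx : ((N : ℝ) ^ k) ^ #F ≤ D ^ (2 * ℓ) * x ^ #(F \ R) := by
      have h1 : ((N : ℝ) ^ k) = D * x := by rw [hx, hD]; field_simp
      have hx1 : x ≤ 1 := by
        rw [hx, div_le_one (by positivity)]
        linarith
      calc ((N : ℝ) ^ k) ^ #F = D ^ #F * x ^ #F := by rw [h1, mul_pow]
        _ ≤ D ^ (2 * ℓ) * x ^ #(F \ R) := by
          refine mul_le_mul (pow_le_pow_right₀ hD1 hFℓ) ?_ (by positivity) (by positivity)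
          exact pow_le_pow_of_le_one hx0.le hx1 (card_le_card sdiff_subset)
    calc ((BBl N F ℓ).card : ℝ) ≤ ((N : ℝ) ^ k) ^ #F := by exact_mod_cast card_BBl_le F ℓ
      _ ≤ D ^ (2 * ℓ) * x ^ #(F \ R) := hDx
      _ ≤ D ^ (2 * ℓ) * x ^ #(F \ R) * (Q * y ^ #R) :=
          le_mul_of_one_le_right (by positivity) hQy
      _ = D ^ (2 * ℓ) * Q * (y ^ #R * x ^ #(F \ R)) := by ring
      _ ≤ _ := by
          refine mul_le_mul_of_nonneg_left ?_ (by positivity)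
          exact single_le_sum (f := fun R => y ^ #R * x ^ #(F \ R)) (fun R _ => hnn R)
            (mem_filter.2 ⟨mem_powerset.2 (hRF.trans hF), hRF, hreach⟩)
  have hcount := sum_sum_reach_le (Incident (V := V) (k := k)) E d hx0.le hy0.le
    (by norm_num) hxt (fun r hr => by
      refine le_trans (le_of_eq ?_) (hdeg r hr)
      congr 1
      exact filter_congr fun _ _ => Iff.rfl)
  have hexp : (1 + y * 3) ^ #E ≤ 25 ^ ℓ := by
    have h1 : (1 + y * 3) ^ m ≤ Real.exp (y * 3) ^ m :=
      pow_le_pow_left₀ (by positivity) (by linarith [Real.add_one_le_exp (y * 3)]) _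
    have h2 : Real.exp (y * 3) ^ m = (Real.exp 1 ^ 3) ^ ℓ := by
      rw [← Real.exp_nat_mul, ← pow_mul, ← Real.exp_nat_mul]
      congr 1
      rw [hy]
      push_cast
      field_simp
    rw [hEm]
    refine h1.trans (h2.le.trans (pow_le_pow_left₀ (by positivity) ?_ _))
    exact (pow_le_pow_left₀ (Real.exp_pos 1).le he3 3).trans (by norm_num)
  have hfin : ((15 * (d : ℝ) * (N : ℝ) ^ k) ^ 4 * (m : ℝ) / (ℓ : ℝ)) ^ ((ℓ : ℝ) / 2)
      = D ^ (2 * ℓ) * Q * 25 ^ ℓ := by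
    have h1 : ((15 * (d : ℝ) * (N : ℝ) ^ k) ^ 4) ^ ((ℓ : ℝ) / 2) = (5 * D) ^ (2 * ℓ) := by
      have h2 : 15 * (d : ℝ) * (N : ℝ) ^ k = 5 * D := by rw [hD]; ring
      have h3 : ((4 : ℕ) : ℝ) * ((ℓ : ℝ) / 2) = ((2 * ℓ : ℕ) : ℝ) := by push_cast; ring
      rw [h2, ← Real.rpow_natCast _ 4, ← Real.rpow_mul (by positivity), h3, Real.rpow_natCast]
    rw [mul_div_assoc, Real.mul_rpow (by positivity) (by positivity), h1, mul_pow,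
      pow_mul (5 : ℝ)]
    norm_num
    ring
  rw [hfin]
  calc (∑ E' ∈ E.powerset, ((BBl N E' ℓ).card : ℝ))
      ≤ D ^ (2 * ℓ) * Q * ∑ F ∈ E.powerset,
          ∑ R ∈ E.powerset with R ⊆ F ∧ Reach Incident R (F \ R), y ^ #R * x ^ #(F \ R) := by
        rw [mul_sum]
        exact sum_le_sum hterm
    _ ≤ D ^ (2 * ℓ) * Q * 25 ^ ℓ :=
        mul_le_mul_of_nonneg_left (hcount.trans hexp) (by positivity)
end

section
/- Let k ≥ 2 and N ≥ 2 be integers, and let (V, E) be a cycle-free k-uniform hypergraph on a finite vertex set V. For each hyperedge e ∈ E let μ_e be a one-wise independent probability mass function on (Fin k → ZMod N) and let w_e ∈ (Fin k → ZMod N) be a label, and define g : (V → ZMod N) → ℝ by g(x) = ∏_{e∈E} N^k · μ_e(x|_e − w_e). Let V_1,…,V_t be the nontrivial connected components of (V, E). Then for every b : V → ZMod N, if 𝔼_x[g(x)·conj(χ_b(x))] ≠ 0 (expectation over uniform x : V → ZMod N), then supp(b) ⊆ V_1 ∪ … ∪ V_t and |supp(b) ∩ V_i| ≠ 1 for every i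 ∈ [t]. -/
open Finset
open scoped Classical

variable {V : Type*} [Fintype V] [DecidableEq V]

noncomputable section

/-- Expectation of a complex-valued function over a uniformly random point of a finite type. -/
def uexpC {α : Type*} [Fintype α] (g : α → ℂ) : ℂ :=
  (∑ x, g x) / (Fintype.card α : ℂ)

/-- The Fourier character `χ_b` on `(ZMod N)^V`. -/
def chiV (N : ℕ) (b x : V → ZMod N) : ℂ :=
  Complex.exp (2 * Real.pi * Complex.I / (N : ℂ) *
    ∑ v, ((b v).val : ℂ) * ((x v).val : ℂ))

end
/-- `IsHypertree v T A`: the set of hyperedges `T` is obtained from the single vertex `v` by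
repeatedly attaching a hyperedge at exactly one of its vertices, and `A` is the set of all
vertices reached in this way. -/
inductive IsHypertree {k : ℕ} (v : V) : Finset (Fin k → V) → Finset V → Prop
  | root : IsHypertree v ∅ {v}
  | attach (T : Finset (Fin k → V)) (A : Finset V) (e : Fin k → V) (i : Fin k) :
      IsHypertree v T A → e ∉ T → Function.Injective e → e i ∈ A →
      (∀ j, j ≠ i → e j ∉ A) → IsHypertree v (insert e T) (A ∪ edgeVerts e)

theorem mem_edgeVerts {k : ℕ} (e : Fin k → V) (u : V) : u ∈ edgeVerts e ↔ ∃ i, e i = u := by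
  simp [edgeVerts]

namespace IsHypertree

variable {k : ℕ} {v : V} {T : Finset (Fin k → V)} {A : Finset V}

theorem root_mem (h : IsHypertree v T A) : v ∈ A := by
  induction h with
  | root => simp
  | attach T A e i _ _ _ _ _ ih => exact mem_union_left _ ih

theorem verts_mem (h : IsHypertree v T A) : ∀ e ∈ T, ∀ i, e i ∈ A := by
  induction h with
  | root => simp
  | attach T A e i _ _ _ _ _ ih =>
    intro f hf j
    rcases Finset.mem_insert.1 hf with rfl | hf
    · exact mem_union_right _ ((mem_edgeVerts _ _).2 ⟨j, rfl⟩)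
    · exact mem_union_left _ (ih f hf j)

theorem card_eq (h : IsHypertree v T A) : A.card = T.card * (k - 1) + 1 := by
  induction h with
  | root => simp
  | attach T A e i _ heT hinj hi hj ih =>
    have hinter : A ∩ edgeVerts e = {e i} := by
      ext u
      simp only [Finset.mem_inter, mem_edgeVerts, Finset.mem_singleton]
      constructor
      · rintro ⟨hu, j, rfl⟩
        by_contra hne
        exact hj j (fun hji => hne (hji ▸ rfl)) hu
      · rintro rfl
        exact ⟨hi, i, rfl⟩
    have hcard : (edgeVerts e).card = k := by
      simp [edgeVerts, Finset.card_image_of_injective _ hinj]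
    have hunion := Finset.card_union_add_card_inter A (edgeVerts e)
    rw [hinter, Finset.card_singleton, hcard, ih] at hunion
    have hk : 1 ≤ k := i.pos
    rw [Finset.card_insert_of_notMem heT, Nat.succ_mul]
    omega

theorem reachable (h : IsHypertree v T A) {E : Finset (Fin k → V)} (hT : T ⊆ E) :
    ∀ u ∈ A, (hGraph E).Reachable v u := by
  induction h with
  | root =>
    intro u hu
    rw [Finset.mem_singleton.1 hu]
  | attach T A e i _ _ _ hi _ ih =>
    intro u hu
    have ih' := ih ((Finset.subset_insert _ _).trans hT)
    rcases Finset.mem_union.1 hu with hu | hu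
    · exact ih' u hu
    · obtain ⟨j, rfl⟩ := (mem_edgeVerts _ _).1 hu
      refine (ih' _ hi).trans ?_
      by_cases hij : e i = e j
      · rw [hij]
      · refine SimpleGraph.Adj.reachable ?_
        rw [hGraph, SimpleGraph.fromRel_adj]
        exact ⟨hij, Or.inl ⟨e, hT (Finset.mem_insert_self _ _), i, j, rfl, rfl⟩⟩

theorem cover_subset (h : IsHypertree v T A) : cover T ⊆ A := by
  intro u hu
  obtain ⟨e, he, hu⟩ := Finset.mem_biUnion.1 hu
  obtain ⟨i, rfl⟩ := (mem_edgeVerts _ _).1 hu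
  exact h.verts_mem e he i

/-- In a cycle-free hypergraph, every vertex is the root of a hypertree disjoint from all
the remaining hyperedges. -/
theorem exists_maximal {E : Finset (Fin k → V)} (hinj : ∀ e ∈ E, Function.Injective e)
    (hcyclefree : ∀ E' ⊆ E, E'.Nonempty → E'.card * (k - 1) < (cover E').card) (v : V) :
    ∃ T A, IsHypertree v T A ∧ T ⊆ E ∧ ∀ e ∈ E, e ∉ T → ∀ i, e i ∉ A := by
  obtain ⟨T, hT, hmax⟩ := Finset.exists_max_image
    (E.powerset.filter fun T => ∃ A, IsHypertree v T A) Finset.card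
    ⟨∅, by simpa using ⟨_, IsHypertree.root⟩⟩
  obtain ⟨hTE, A, hA⟩ := Finset.mem_filter.1 hT
  rw [Finset.mem_powerset] at hTE
  refine ⟨T, A, hA, hTE, fun e he heT i hi => ?_⟩
  have hsub : insert e T ⊆ E := Finset.insert_subset he hTE
  have hother : ∀ j, j ≠ i → e j ∉ A := by
    intro j hji hj
    have hlt := hcyclefree _ hsub (Finset.insert_nonempty _ _)
    have hcover : cover (insert e T) ⊆ A ∪ edgeVerts e := by
      rw [cover, Finset.biUnion_insert, Finset.union_comm]
      exact Finset.union_subset_union_left hA.cover_subset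
    have hle := Finset.card_le_card hcover
    have hpair : ({e i, e j} : Finset V) ⊆ A ∩ edgeVerts e := by
      intro u hu
      simp only [Finset.mem_insert, Finset.mem_singleton] at hu
      rw [Finset.mem_inter, mem_edgeVerts]
      rcases hu with rfl | rfl
      · exact ⟨hi, i, rfl⟩
      · exact ⟨hj, j, rfl⟩
    have htwo := Finset.card_le_card hpair
    rw [Finset.card_pair fun hij => hji (hinj e he hij).symm] at htwo
    have hcard : (edgeVerts e).card = k := by
      simp [edgeVerts, Finset.card_image_of_injective _ (hinj e he)]
    have hunion := Finset.card_union_add_card_inter A (edgeVerts e)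
    rw [hcard, hA.card_eq] at hunion
    rw [Finset.card_insert_of_notMem heT, Nat.succ_mul] at hlt
    omega
  have hgrow := hmax (insert e T) (Finset.mem_filter.2 ⟨Finset.mem_powerset.2 hsub, _,
    hA.attach T A e i heT (hinj e he) hi hother⟩)
  rw [Finset.card_insert_of_notMem heT] at hgrow
  omega

end IsHypertree

theorem sum_mul_comp_edge_eq_zero {k N : ℕ} [NeZero N] {e : Fin k → V}
    (he : Function.Injective e) (i : Fin k) (P : (V → ZMod N) → ℂ)
    (hP : ∀ x y : V → ZMod N, (∀ u, (∀ j, j ≠ i → e j ≠ u) → y u = 0) → P (x + y) = P x)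
    (hsum : ∑ x, P x = 0) (φ : (Fin k → ZMod N) → ℂ) (c : ℂ)
    (hφ : ∀ σ, ∑ a ∈ Finset.univ.filter (fun a : Fin k → ZMod N => a i = σ), φ a = c) :
    ∑ x : V → ZMod N, φ (x ∘ e) * P x = 0 := by
  set Z := Finset.univ.filter (fun z : Fin k → ZMod N => z i = 0) with hZ
  have hshift : ∀ z ∈ Z,
      ∑ x : V → ZMod N, φ (x ∘ e) * P x = ∑ x : V → ZMod N, φ (x ∘ e + z) * P x := by
    intro z hz
    rw [← Equiv.sum_comp (Equiv.addRight (Function.extend e z 0))]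
    refine Finset.sum_congr rfl fun x _ => ?_
    rw [Equiv.coe_addRight, hP x]
    · congr 2
      ext j
      simp [he.extend_apply]
    · intro u hu
      by_cases hex : ∃ j, e j = u
      · obtain ⟨j, rfl⟩ := hex
        rw [he.extend_apply]
        have hji : j = i := by
          by_contra hne
          exact hu j hne rfl
        rw [hji]
        exact (Finset.mem_filter.1 hz).2
      · rw [Function.extend_apply' _ _ _ hex]
        rfl
  have hconst : ∀ a : Fin k → ZMod N, ∑ z ∈ Z, φ (a + z) = c := by
    intro a
    rw [← hφ (a i)]
    refine Finset.sum_equiv (Equiv.addLeft a) (fun z => ?_) fun z _ => rfl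
    simp [hZ]
  have hmul : (Z.card : ℂ) * ∑ x : V → ZMod N, φ (x ∘ e) * P x = 0 := by
    rw [← nsmul_eq_mul, ← Finset.sum_const, Finset.sum_congr rfl hshift, Finset.sum_comm]
    simp_rw [← Finset.sum_mul, hconst]
    rw [← Finset.mul_sum, hsum, mul_zero]
  refine (mul_eq_zero.1 hmul).resolve_left ?_
  refine Nat.cast_ne_zero.2 ?_
  exact Finset.card_ne_zero_of_mem (a := 0) (by simp [hZ])

theorem IsHypertree.sum_prod_mul_eq_zero {k N : ℕ} [NeZero N] {v : V}
    {T : Finset (Fin k → V)} {A : Finset V} (h : IsHypertree v T A)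
    (F : (Fin k → V) → (Fin k → ZMod N) → ℂ) (c : ℂ)
    (hF : ∀ e ∈ T, ∀ i σ,
      ∑ a ∈ Finset.univ.filter (fun a : Fin k → ZMod N => a i = σ), F e a = c)
    (H : (V → ZMod N) → ℂ)
    (hH : ∀ x y : V → ZMod N, (∀ u, u ∉ A ∨ u = v → y u = 0) → H (x + y) = H x)
    (hsum : ∑ x, H x = 0) :
    ∑ x : V → ZMod N, (∏ e ∈ T, F e (x ∘ e)) * H x = 0 := by
  induction h with
  | root => simpa using hsum
  | attach T A e i hT heT hinj hi hj ih =>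
    simp_rw [Finset.prod_insert heT, mul_assoc]
    refine sum_mul_comp_edge_eq_zero hinj i (fun x => (∏ f ∈ T, F f (x ∘ f)) * H x) ?_ ?_ (F e) c
      (hF e (Finset.mem_insert_self _ _) i)
    · intro x y hy
      have hyA : ∀ u ∈ A, y u = 0 := fun u hu => hy u fun j hji hju => hj j hji (hju ▸ hu)
      have hprod : ∀ f ∈ T, F f ((x + y) ∘ f) = F f (x ∘ f) := by
        intro f hf
        congr 1
        ext j
        simp [hyA _ (hT.verts_mem f hf j)]
      rw [Finset.prod_congr rfl hprod, hH x y]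
      rintro u (hu | rfl)
      · refine hy u fun j _ hju => hu (Finset.mem_union_right _ ?_)
        exact (mem_edgeVerts _ _).2 ⟨j, hju⟩
      · exact hyA _ hT.root_mem
    · refine ih (fun f hf => hF f (Finset.mem_insert_of_mem hf)) fun x y hy => hH x y ?_
      rintro u (hu | rfl)
      · exact hy u (Or.inl fun huA => hu (Finset.mem_union_left _ huA))
      · exact hy _ (Or.inr rfl)

theorem chiV_eq_stdAddChar (N : ℕ) [NeZero N] (b x : V → ZMod N) :
    chiV N b x = ZMod.stdAddChar (∑ v, b v * x v) := by
  have hcast : (∑ v, b v * x v : ZMod N) =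
      ((∑ v, ((b v).val : ℤ) * ((x v).val : ℤ) : ℤ) : ZMod N) := by
    push_cast
    simp
  rw [hcast, ZMod.stdAddChar_coe, chiV]
  congr 1
  push_cast
  ring

/-- The Fourier coefficient at `b` vanishes if some `v` in the support of `b` is the only
element of the support in its connected component. -/
theorem uexpC_prod_mul_conj_chiV_eq_zero {k N : ℕ} [NeZero N] {E : Finset (Fin k → V)}
    (hinj : ∀ e ∈ E, Function.Injective e)
    (hcyclefree : ∀ E' ⊆ E, E'.Nonempty → E'.card * (k - 1) < (cover E').card)
    (F : (Fin k → V) → (Fin k → ZMod N) → ℂ) (c : ℂ)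
    (hF : ∀ e ∈ E, ∀ i σ,
      ∑ a ∈ Finset.univ.filter (fun a : Fin k → ZMod N => a i = σ), F e a = c)
    (b : V → ZMod N) (v : V) (hv : b v ≠ 0)
    (hb : ∀ u, u ≠ v → (hGraph E).Reachable v u → b u = 0) :
    uexpC (fun x : V → ZMod N =>
      (∏ e ∈ E, F e (x ∘ e)) * (starRingEnd ℂ) (chiV N b x)) = 0 := by
  obtain ⟨T, A, hT, hTE, hdisj⟩ := IsHypertree.exists_maximal hinj hcyclefree v
  set H : (V → ZMod N) → ℂ := fun x =>
    (∏ e ∈ E \ T, F e (x ∘ e)) * (starRingEnd ℂ) (chiV N b x) with hHdef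
  have hHadd : ∀ x y : V → ZMod N, (∀ u ∉ A, y u = 0) →
      H (x + y) = (starRingEnd ℂ) (ZMod.stdAddChar (∑ u, b u * y u)) * H x := by
    intro x y hy
    have hprod : ∀ e ∈ E \ T, F e ((x + y) ∘ e) = F e (x ∘ e) := by
      intro e he
      rw [Finset.mem_sdiff] at he
      congr 1
      ext j
      simp [hy _ (hdisj e he.1 he.2 j)]
    simp only [hHdef]
    rw [Finset.prod_congr rfl hprod, chiV_eq_stdAddChar, chiV_eq_stdAddChar]
    simp only [Pi.add_apply, mul_add, Finset.sum_add_distrib, AddChar.map_add_eq_mul, map_mul]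
    ring
  have hHsum : ∑ x, H x = 0 := by
    have hshift : ∑ x, H x =
        (starRingEnd ℂ) (ZMod.stdAddChar (b v)) * ∑ x, H x := by
      rw [Finset.mul_sum]
      conv_lhs => rw [← Equiv.sum_comp (Equiv.addRight (Pi.single v (1 : ZMod N)))]
      refine Finset.sum_congr rfl fun x _ => ?_
      rw [Equiv.coe_addRight, hHadd]
      · simp [Pi.single_apply]
      · intro u hu
        exact Pi.single_eq_of_ne (fun huv : u = v => hu (huv ▸ hT.root_mem)) _
    by_contra hne
    have hone : (starRingEnd ℂ) (ZMod.stdAddChar (b v)) = 1 :=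
      (mul_eq_right₀ hne).1 hshift.symm
    rw [map_eq_one_iff _ (starRingEnd ℂ).injective, ← AddChar.map_zero_eq_one (ZMod.stdAddChar (N := N))]
      at hone
    exact hv (ZMod.injective_stdAddChar hone)
  have hzero := hT.sum_prod_mul_eq_zero F c (fun e he => hF e (hTE he)) H
    (fun x y hy => by
      rw [hHadd x y fun u hu => hy u (Or.inl hu), Finset.sum_eq_zero]
      · simp
      · intro u _
        by_cases hu : u ∉ A ∨ u = v
        · rw [hy u hu, mul_zero]
        · rw [not_or, not_not] at hu
          rw [hb u hu.2 (hT.reachable hTE u hu.1), zero_mul]) hHsum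
  rw [uexpC, ← zero_div (Fintype.card (V → ZMod N) : ℂ), ← hzero]
  congr 1
  refine Finset.sum_congr rfl fun x _ => ?_
  rw [← Finset.prod_sdiff hTE, hHdef]
  ring

/-- For a cycle-free hypergraph with one-wise independent edge distributions, a nonzero
Fourier coefficient of `g` can only occur on `b` supported in the union of the
nontrivial connected components, intersecting each in a set of size `≠ 1`. -/
theorem stmt15 (k N : ℕ) [NeZero N] (hk : 2 ≤ k) (hN : 2 ≤ N)
    (E : Finset (Fin k → V))
    (hinj : ∀ e ∈ E, Function.Injective e)
    (hcyclefree : ∀ E' ⊆ E, E'.Nonempty → E'.card * (k - 1) < (cover E').card)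
    (μ : (Fin k → V) → (Fin k → ZMod N) → ℝ)
    (hμ0 : ∀ e ∈ E, ∀ w, 0 ≤ μ e w)
    (hμ1 : ∀ e ∈ E, (∑ w, μ e w) = 1)
    (hμone : ∀ e ∈ E, ∀ (i : Fin k) (σ : ZMod N),
      (∑ w ∈ Finset.univ.filter (fun w => w i = σ), μ e w) = 1 / (N : ℝ))
    (w : (Fin k → V) → (Fin k → ZMod N))
    (b : V → ZMod N)
    (hne : uexpC (fun x : V → ZMod N =>
        ((∏ e ∈ E, (N : ℝ) ^ k * μ e (fun i => x (e i) - w e i) : ℝ) : ℂ) *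
          (starRingEnd ℂ) (chiV N b x)) ≠ 0) :
    (∀ v : V, b v ≠ 0 → ∃ u : V, u ≠ v ∧
        (hGraph E).connectedComponentMk u = (hGraph E).connectedComponentMk v) ∧
    ∀ c : (hGraph E).ConnectedComponent, NontrivComp E c →
      (Finset.univ.filter (fun v : V =>
          b v ≠ 0 ∧ (hGraph E).connectedComponentMk v = c)).card ≠ 1 := by
  set F : (Fin k → V) → (Fin k → ZMod N) → ℂ := fun e a =>
    (((N : ℝ) ^ k * μ e (a - w e) : ℝ) : ℂ) with hFdef
  have hF : ∀ e ∈ E, ∀ i σ,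
      ∑ a ∈ Finset.univ.filter (fun a : Fin k → ZMod N => a i = σ), F e a =
        (((N : ℝ) ^ k * (1 / (N : ℝ)) : ℝ) : ℂ) := by
    intro e he i σ
    rw [← hμone e he i (σ - w e i), Finset.mul_sum, Complex.ofReal_sum]
    refine Finset.sum_equiv (Equiv.subRight (w e)) (fun a => ?_) fun a _ => rfl
    simp
  have hlonely : ∀ v, b v ≠ 0 → ¬ ∀ u, u ≠ v → (hGraph E).Reachable v u → b u = 0 := by
    intro v hv hb
    refine hne (Eq.trans ?_
      (uexpC_prod_mul_conj_chiV_eq_zero hinj hcyclefree F _ hF b v hv hb))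
    congr 1
    ext x
    rw [Complex.ofReal_prod]
    rfl
  refine ⟨fun v hv => ?_, fun c _ hcard => ?_⟩
  · by_contra! hcon
    exact hlonely v hv fun u hu hvu =>
      absurd (SimpleGraph.ConnectedComponent.sound hvu.symm) (hcon u hu)
  · obtain ⟨v, hv⟩ := Finset.card_eq_one.1 hcard
    have hvmem := Finset.mem_singleton_self v
    rw [← hv, Finset.mem_filter] at hvmem
    refine hlonely v hvmem.2.1 fun u hu hvu => ?_
    by_contra hbu
    refine hu (Finset.mem_singleton.1 ?_)
    rw [← hv, Finset.mem_filter]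
    exact ⟨Finset.mem_univ u, hbu,
      (SimpleGraph.ConnectedComponent.sound hvu.symm).trans hvmem.2.2⟩
end

section
/- Let k ≥ 2 and N ≥ 2 be integers, and let (V, E) be an almost-acyclic k-uniform hypergraph on a finite vertex set V. For each hyperedge e ∈ E let μ_e be a two-wise independent probability mass function on (Fin k → ZMod N) and let w_e ∈ (Fin k → ZMod N) be a label, and define g : (V → ZMod N) → ℝ by g(x) = ∏_{e∈E} N^k · μ_e(x|_e − w_e). Then 𝔼_x[g(x)] = 1, the expectation over a uniformly random x : V → ZMod N. -/
open Finset

variable {V : Type*} [Fintype V] [DecidableEq V]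

noncomputable section

/-- Expectation of a real-valued function over a uniformly random point of a finite type. -/
def uexpR {α : Type*} [Fintype α] (g : α → ℝ) : ℝ :=
  (∑ x, g x) / (Fintype.card α : ℝ)

end

/-- Every covered vertex is counted at least twice by the edges together with their private parts,
the private part of an edge being the vertices that lie in no other edge. -/
theorem two_mul_card_cover_le {k : ℕ} (E : Finset (Fin k → V)) :
    2 * (cover E).card ≤
      ∑ e ∈ E, ((edgeVerts e).card + (edgeVerts e \ cover (E.erase e)).card) := by
  have hswap : ∑ v ∈ cover E, ∑ e ∈ E, ((if v ∈ edgeVerts e then 1 else 0) +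
      (if v ∈ edgeVerts e \ cover (E.erase e) then 1 else 0)) ≤
      ∑ e ∈ E, ((edgeVerts e).card + (edgeVerts e \ cover (E.erase e)).card) := by
    rw [Finset.sum_comm]
    refine Finset.sum_le_sum fun e _ => ?_
    rw [Finset.sum_add_distrib, ← Finset.card_filter, ← Finset.card_filter]
    refine add_le_add (Finset.card_le_card fun v hv => (Finset.mem_filter.1 hv).2)
      (Finset.card_le_card fun v hv => (Finset.mem_filter.1 hv).2)
  refine le_trans ?_ hswap
  rw [mul_comm, ← smul_eq_mul, ← Finset.sum_const]
  refine Finset.sum_le_sum fun v hv => ?_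
  obtain ⟨e, he, hve⟩ := Finset.mem_biUnion.1 hv
  by_cases hp : v ∈ cover (E.erase e)
  · obtain ⟨e', he', hve'⟩ := Finset.mem_biUnion.1 hp
    obtain ⟨hne, he'E⟩ := Finset.mem_erase.1 he'
    have hsub : ({e, e'} : Finset (Fin k → V)) ⊆ E := by
      simp [Finset.insert_subset_iff, he, he'E]
    refine le_trans ?_ (Finset.sum_le_sum_of_subset hsub)
    rw [Finset.sum_pair hne.symm, if_pos hve, if_pos hve']
    omega
  · refine le_trans ?_ (Finset.single_le_sum (fun _ _ => Nat.zero_le _) he)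
    rw [if_pos hve, if_pos (Finset.mem_sdiff.2 ⟨hve, hp⟩)]

/-- A sparse nonempty hypergraph has an edge sharing at most two vertices with the others. -/
theorem exists_edge_card_inter_cover_le_two {k : ℕ} {E : Finset (Fin k → V)} (hE : E.Nonempty)
    (hsparse : (E.card : ℝ) * ((k : ℝ) - 1.1) ≤ ((cover E).card : ℝ)) :
    ∃ e ∈ E, (edgeVerts e ∩ cover (E.erase e)).card ≤ 2 := by
  by_contra! hcon
  have hsum : ∑ e ∈ E, ((edgeVerts e).card + (edgeVerts e \ cover (E.erase e)).card + 3) ≤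
      ∑ _e ∈ E, 2 * k := by
    refine Finset.sum_le_sum fun e he => ?_
    have h3 := hcon e he
    have hsplit := Finset.card_sdiff_add_card_inter (edgeVerts e) (cover (E.erase e))
    have hk : (edgeVerts e).card ≤ k := by
      simpa [edgeVerts] using Finset.card_image_le (s := Finset.univ) (f := e)
    omega
  rw [Finset.sum_add_distrib, Finset.sum_const, Finset.sum_const, smul_eq_mul, smul_eq_mul] at hsum
  have hle : 2 * (cover E).card + E.card * 3 ≤ E.card * (2 * k) :=
    (Nat.add_le_add_right (two_mul_card_cover_le E) _).trans hsum
  have hleR : 2 * ((cover E).card : ℝ) + E.card * 3 ≤ E.card * (2 * k) := by exact_mod_cast hle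
  have hpos : (0 : ℝ) < E.card := by exact_mod_cast hE.card_pos
  nlinarith

/-- A sparse nonempty hypergraph has an edge all of whose vertices, except those at two positions,
lie in no other edge. -/
theorem exists_edge_private_off_pair {k : ℕ} (hk : 2 ≤ k) {E : Finset (Fin k → V)}
    (hE : E.Nonempty) (hinj : ∀ e ∈ E, Function.Injective e)
    (hsparse : (E.card : ℝ) * ((k : ℝ) - 1.1) ≤ ((cover E).card : ℝ)) :
    ∃ e ∈ E, ∃ i j : Fin k, i ≠ j ∧ ∀ l, e l ∈ cover (E.erase e) → l = i ∨ l = j := by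
  obtain ⟨e, he, hcard⟩ := exists_edge_card_inter_cover_le_two hE hsparse
  have hpos : (Finset.univ.filter fun l => e l ∈ cover (E.erase e)).card ≤ 2 := by
    refine le_trans (Finset.card_le_card_of_injOn e (fun l hl => ?_) (hinj e he).injOn) hcard
    have hl' : e l ∈ cover (E.erase e) := by simpa using hl
    simp [edgeVerts, hl']
  obtain ⟨t, hst, ht⟩ := Finset.exists_superset_card_eq hpos (by simpa using hk)
  obtain ⟨i, j, hij, rfl⟩ := Finset.card_eq_two.1 ht
  refine ⟨e, he, i, j, hij, fun l hl => ?_⟩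
  simpa using hst (Finset.mem_filter.2 ⟨Finset.mem_univ l, hl⟩)

/-- The number of functions vanishing at two given points. -/
theorem sq_mul_card_filter_eq_zero_pair {k N : ℕ} [NeZero N] {i j : Fin k} (hij : i ≠ j) :
    N ^ 2 * (Finset.univ.filter fun a : Fin k → ZMod N => a i = 0 ∧ a j = 0).card = N ^ k := by
  have hpi : (Finset.univ.filter fun a : Fin k → ZMod N => a i = 0 ∧ a j = 0) =
      Fintype.piFinset fun l => if l ∈ ({i, j} : Finset (Fin k)) then {0} else Finset.univ := by
    ext a
    simp only [Finset.mem_filter, Finset.mem_univ, true_and, Fintype.mem_piFinset]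
    constructor
    · rintro ⟨hi, hj⟩ l
      split_ifs with hl
      · rcases (by simpa using hl : l = i ∨ l = j) with rfl | rfl <;> simpa
      · simp
    · intro h
      exact ⟨by simpa using h i, by simpa using h j⟩
  have hterm : ∀ l : Fin k, (if l ∈ ({i, j} : Finset (Fin k)) then ({0} : Finset (ZMod N))
      else Finset.univ).card = if l ∈ ({i, j} : Finset (Fin k)) then 1 else N := by
    intro l
    split_ifs <;> simp [ZMod.card]
  have h2 : ({i, j} : Finset (Fin k)).card = 2 := Finset.card_pair hij
  have hk : 2 ≤ k := by simpa [h2] using Finset.card_le_univ ({i, j} : Finset (Fin k))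
  have hcompl : (Finset.univ.filter fun l : Fin k => l ∉ ({i, j} : Finset (Fin k))).card = k - 2 := by
    rw [Finset.filter_notMem_eq_sdiff, Finset.card_univ_sdiff, h2, Fintype.card_fin]
  rw [hpi, Fintype.card_piFinset, Finset.prod_congr rfl fun l _ => hterm l, Finset.prod_ite,
    Finset.prod_const_one, one_mul, Finset.prod_const, hcompl, ← pow_add]
  congr 1
  omega

/-- A normalized edge factor whose conditional averages, given the coordinates `i` and `j`, are `1`
can be removed from a sum against a function that does not depend on the other vertices of the
edge. -/
theorem sum_mul_edge_eq_sum {k N : ℕ} [NeZero N] {e : Fin k → V} (he : Function.Injective e)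
    {i j : Fin k} (hij : i ≠ j) (F : (V → ZMod N) → ℝ)
    (hF : ∀ x, ∀ a : Fin k → ZMod N, a i = 0 → a j = 0 → F (x + Function.extend e a 0) = F x)
    (ν : (Fin k → ZMod N) → ℝ)
    (hν : ∀ σ τ : ZMod N,
      (∑ w ∈ Finset.univ.filter (fun w => w i = σ ∧ w j = τ), ν w) = 1 / (N : ℝ) ^ 2)
    (c : Fin k → ZMod N) :
    ∑ x : V → ZMod N, (N : ℝ) ^ k * ν (fun l => x (e l) - c l) * F x = ∑ x, F x := by
  set A := Finset.univ.filter fun a : Fin k → ZMod N => a i = 0 ∧ a j = 0 with hA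
  have hcard : (N : ℝ) ^ 2 * (A.card : ℝ) = (N : ℝ) ^ k := by
    exact_mod_cast sq_mul_card_filter_eq_zero_pair (N := N) hij
  have hN : (N : ℝ) ≠ 0 := by exact_mod_cast NeZero.ne N
  have hA0 : (A.card : ℝ) ≠ 0 := fun h => pow_ne_zero k hN (by rw [← hcard, h, mul_zero])
  have hinner : ∀ x : V → ZMod N,
      ∑ a ∈ A, (N : ℝ) ^ k * ν (fun l => x (e l) + a l - c l) = A.card := by
    intro x
    have hbij : ∑ a ∈ A, ν (fun l => x (e l) + a l - c l) =
        ∑ w ∈ Finset.univ.filter (fun w : Fin k → ZMod N =>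
          w i = x (e i) - c i ∧ w j = x (e j) - c j), ν w := by
      refine Finset.sum_bij' (fun a _ l => x (e l) + a l - c l)
        (fun w _ l => w l - x (e l) + c l) ?_ ?_ ?_ ?_ ?_
      · intro a ha
        simp_all
      · intro a ha
        simp_all
      · intro a _
        funext l
        ring
      · intro a _
        funext l
        ring
      · intro a _
        rfl
    rw [← Finset.mul_sum, hbij, hν, ← hcard]
    field_simp
  have hshift : ∀ a ∈ A, ∑ x : V → ZMod N, (N : ℝ) ^ k * ν (fun l => x (e l) - c l) * F x =
      ∑ x : V → ZMod N, (N : ℝ) ^ k * ν (fun l => x (e l) + a l - c l) * F x := by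
    intro a ha
    obtain ⟨hi, hj⟩ := (Finset.mem_filter.1 ha).2
    rw [← Equiv.sum_comp (Equiv.addRight (Function.extend e a 0))]
    refine Finset.sum_congr rfl fun x _ => ?_
    simp [hF x a hi hj, he.extend_apply]
  have hdouble := Finset.sum_congr rfl hshift
  rw [Finset.sum_const, nsmul_eq_mul, Finset.sum_comm] at hdouble
  simp_rw [← Finset.sum_mul, hinner, ← Finset.mul_sum] at hdouble
  exact mul_left_cancel₀ hA0 hdouble

/-- For an almost-acyclic hypergraph with two-wise independent edge distributions,
the structured-part density `g` has expectation `1`. -/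
theorem stmt16 (k N : ℕ) [NeZero N] (hk : 2 ≤ k) (hN : 2 ≤ N)
    (E : Finset (Fin k → V))
    (hinj : ∀ e ∈ E, Function.Injective e)
    (hac : ∀ E' ⊆ E, (E'.card : ℝ) * ((k : ℝ) - 1.1) ≤ ((cover E').card : ℝ))
    (μ : (Fin k → V) → (Fin k → ZMod N) → ℝ)
    (hμ0 : ∀ e ∈ E, ∀ w, 0 ≤ μ e w)
    (hμ1 : ∀ e ∈ E, (∑ w, μ e w) = 1)
    (hμtwo : ∀ e ∈ E, ∀ i j : Fin k, i ≠ j → ∀ σ τ : ZMod N,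
      (∑ w ∈ Finset.univ.filter (fun w => w i = σ ∧ w j = τ), μ e w) = 1 / (N : ℝ) ^ 2)
    (w : (Fin k → V) → (Fin k → ZMod N)) :
    uexpR (fun x : V → ZMod N =>
      ∏ e ∈ E, (N : ℝ) ^ k * μ e (fun i => x (e i) - w e i)) = 1 := by
  have hmain : ∀ E' ⊆ E, ∑ x : V → ZMod N,
      ∏ e ∈ E', (N : ℝ) ^ k * μ e (fun i => x (e i) - w e i) =
        (Fintype.card (V → ZMod N) : ℝ) := by
    intro E'
    induction E' using Finset.strongInduction with
    | H E' ih =>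
      intro hsub
      rcases E'.eq_empty_or_nonempty with rfl | hne
      · simp
      obtain ⟨e, he, i, j, hij, hpriv⟩ := exists_edge_private_off_pair hk hne
        (fun e he => hinj e (hsub he)) (hac E' hsub)
      rw [← ih (E'.erase e) (Finset.erase_ssubset he) ((Finset.erase_subset e E').trans hsub)]
      simp_rw [← Finset.mul_prod_erase E' _ he]
      refine sum_mul_edge_eq_sum (hinj e (hsub he)) hij _ (fun x a hi hj => ?_) (μ e)
        (hμtwo e (hsub he) i j hij) (w e)
      refine Finset.prod_congr rfl fun e' he' => ?_
      have hfix : ∀ m, Function.extend e a 0 (e' m) = 0 := by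
        intro m
        by_cases hm : ∃ l, e l = e' m
        · obtain ⟨l, hl⟩ := hm
          have hmem : e l ∈ cover (E'.erase e) :=
            Finset.mem_biUnion.2 ⟨e', he', by simp [edgeVerts, hl]⟩
          rw [← hl, (hinj e (hsub he)).extend_apply]
          rcases hpriv l hmem with rfl | rfl <;> assumption
        · simp [Function.extend_apply' _ _ _ hm]
      simp [hfix]
  rw [uexpR, hmain E subset_rfl]
  exact div_self (by exact_mod_cast Fintype.card_ne_zero)
end

section
/- For all real numbers x and ℓ with x ≥ 0 and ℓ ≥ 2, one has (1 + x)^ℓ − ℓ·x ≤ (1 + 2ℓx²)^{ℓ/2}. -/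
/-- A quadratic upper bound for the exponential on `[0, 4/3]`. -/
lemma exp_le_one_add_add_sq {y : ℝ} (hy : 0 ≤ y) (hy' : y ≤ 4 / 3) :
    Real.exp y ≤ 1 + y + y ^ 2 := by
  obtain ⟨z, rfl⟩ : ∃ z, y = 2 * z := ⟨y / 2, by ring⟩
  have hz : 0 ≤ z := by linarith
  have hz' : z ≤ 2 / 3 := by linarith
  have hexp : Real.exp z ≤ 1 + z + z ^ 2 / 2 + 2 / 9 * z ^ 3 := by
    have h := Real.exp_bound' hz (by linarith) (n := 3) (by norm_num)
    norm_num [Finset.sum_range_succ, Nat.factorial] at h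
    linarith
  have hpoly : 13 / 9 * z + 25 / 36 * z ^ 2 + 2 / 9 * z ^ 3 + 4 / 81 * z ^ 4 ≤ 2 := by
    have h2 : z ^ 2 ≤ (2 / 3) ^ 2 := by gcongr
    have h3 : z ^ 3 ≤ (2 / 3) ^ 3 := by gcongr
    have h4 : z ^ 4 ≤ (2 / 3) ^ 4 := by gcongr
    linarith
  calc Real.exp (2 * z) = Real.exp z ^ 2 := by rw [← Real.exp_nat_mul]; norm_num
    _ ≤ (1 + z + z ^ 2 / 2 + 2 / 9 * z ^ 3) ^ 2 := by gcongr
    _ ≤ 1 + 2 * z + (2 * z) ^ 2 := by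
      linarith [mul_le_mul_of_nonneg_left hpoly (sq_nonneg z)]

theorem stmt18 (x ℓ : ℝ) (hx : 0 ≤ x) (hℓ : 2 ≤ ℓ) :
    (1 + x) ^ ℓ - ℓ * x ≤ (1 + 2 * ℓ * x ^ 2) ^ (ℓ / 2) := by
  have hlx : 0 ≤ ℓ * x := by positivity
  rcases le_total (2 * ℓ * x) (2 + x) with h | h
  · have hexp : (1 + x) ^ ℓ ≤ Real.exp (ℓ * x) := by
      rw [mul_comm, Real.exp_mul]
      gcongr
      linarith [Real.add_one_le_exp x]
    have hquad := exp_le_one_add_add_sq hlx (by nlinarith)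
    have hbern := one_add_mul_self_le_rpow_one_add
      (s := 2 * ℓ * x ^ 2) (by nlinarith [sq_nonneg x]) (p := ℓ / 2) (by linarith)
    linarith
  · calc (1 + x) ^ ℓ - ℓ * x ≤ (1 + x) ^ ℓ := by linarith
      _ = ((1 + x) ^ 2) ^ (ℓ / 2) := by
        rw [← Real.rpow_natCast, ← Real.rpow_mul (by linarith)]
        congr 1
        push_cast
        ring
      _ ≤ (1 + 2 * ℓ * x ^ 2) ^ (ℓ / 2) := by
        gcongr
        linarith [mul_le_mul_of_nonneg_left h hx]
end

section
/- For all real numbers a, b, c, d with 0 < a ≤ b ≤ c ≤ d and a + d = b + c, one has 1 ≤ a^a · d^d / (b^b · c^c) ≤ 2^d. -/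
/-- The graph of `x * log x` lies above its tangent line at `y`. -/
theorem mul_log_tangent_le {x y : ℝ} (hx : 0 < x) (hy : 0 < y) :
    x * Real.log y + x - y ≤ x * Real.log x := by
  have h := mul_le_mul_of_nonneg_left (Real.log_le_sub_one_of_pos (div_pos hy hx)) hx.le
  rw [Real.log_div hy.ne' hx.ne', mul_sub, mul_sub, mul_div_cancel₀ _ hx.ne'] at h
  linarith

theorem mul_log_add_le_of_add_eq {a b c d : ℝ} (ha : 0 < a) (hab : a ≤ b) (hbc : b ≤ c)
    (hcd : c ≤ d) (hsum : a + d = b + c) :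
    b * Real.log b + c * Real.log c ≤ a * Real.log a + d * Real.log d := by
  have hb : 0 < b := by linarith
  have hc : 0 < c := by linarith
  have h1 := mul_log_tangent_le ha hb
  have h2 := mul_log_tangent_le (hc.trans_le hcd) hc
  obtain rfl : d = b + c - a := by linarith
  nlinarith [mul_nonneg (sub_nonneg.2 hab) (sub_nonneg.2 (Real.log_le_log hb hbc))]

theorem mul_log_add_le_add_mul_log_two {a b c d : ℝ} (ha : 0 < a) (hb : 0 < b) (hc : 0 < c)
    (had : a ≤ d) (hsum : a + d = b + c) :
    a * Real.log a + d * Real.log d ≤ b * Real.log b + c * Real.log c + d * Real.log 2 := by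
  have hd : 0 < d := ha.trans_le had
  have hm : 0 < (a + d) / 2 := by positivity
  have h1 := mul_log_tangent_le hb hm
  have h2 := mul_log_tangent_le hc hm
  have h3 := mul_le_mul_of_nonneg_left
    (Real.log_le_log ha (by linarith : a ≤ (a + d) / 2)) ha.le
  have h4 := mul_le_mul_of_nonneg_left
    (Real.log_le_log hd (by linarith : d ≤ (a + d) / 2 * 2)) hd.le
  rw [Real.log_mul hm.ne' two_ne_zero] at h4
  have h5 : (a + d) * Real.log ((a + d) / 2) = (b + c) * Real.log ((a + d) / 2) := by rw [hsum]
  linarith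

theorem stmt19 (a b c d : ℝ) (ha : 0 < a) (hab : a ≤ b) (hbc : b ≤ c) (hcd : c ≤ d)
    (hsum : a + d = b + c) :
    1 ≤ a ^ a * d ^ d / (b ^ b * c ^ c) ∧ a ^ a * d ^ d / (b ^ b * c ^ c) ≤ 2 ^ d := by
  have hb : 0 < b := ha.trans_le hab
  have hc : 0 < c := hb.trans_le hbc
  have hd : 0 < d := hc.trans_le hcd
  have hpos : 0 < b ^ b * c ^ c := by positivity
  have h1 := mul_log_add_le_of_add_eq ha hab hbc hcd hsum
  have h2 := mul_log_add_le_add_mul_log_two ha hb hc (hab.trans (hbc.trans hcd)) hsum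
  rw [one_le_div hpos, div_le_iff₀ hpos]
  simp only [Real.rpow_def_of_pos ha, Real.rpow_def_of_pos hb, Real.rpow_def_of_pos hc,
    Real.rpow_def_of_pos hd, Real.rpow_def_of_pos two_pos, ← Real.exp_add, Real.exp_le_exp]
  constructor <;> linarith
end
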